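/- Let W be a 2-dimensional complex vector space with a fixed basis. If Z : 𝒦(W) → 𝒦(W*) is a continuous, translation invariant, SL(W,ℂ)-contravariant Minkowski valuation which is homogeneous of degree 3 (Z(λK) = λ³ZK for λ > 0), then there exists N ∈ 𝒦(ℂ), unique up to translation, with Z = Π_N. If instead Z is homogeneous of degree 1 (Z(λK) = λZK for λ > 0), then there exists M ∈ 𝒦(ℂ), unique up to translation, with Z = D̃_M. -/

import Mathlib

open scoped Pointwise
open MeasureTheory Module

noncomputable section

section CommonDefs

variable {V V' A : Type*}
variable [NormedAddCommGroup V] [NormedSpace ℝ V]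
variable [NormedAddCommGroup V'] [NormedSpace ℝ V']
variable [NormedAddCommGroup A] [NormedSpace ℝ A]

/-- The supremum of a (pairing) functional over a convex body; used to express the
support function `h(K, ξ) = sup_{x ∈ K} ⟨ξ, x⟩` for the various pairings `p = ⟨ξ, ·⟩`. -/
def hSupp (K : ConvexBody V) (p : V → ℝ) : ℝ := sSup (p '' (K : Set V))

/-- The translate `x + K` of a convex body. -/
def ConvexBody.translate (K : ConvexBody V) (x : V) : ConvexBody V :=
  ⟨(fun y => x + y) '' (K : Set V), K.convex.translate x,
    K.isCompact.image (continuous_const.add continuous_id),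
    K.nonempty.image _⟩

/-- The image of a convex body under a continuous linear map. -/
def ConvexBody.mapCLM (f : V →L[ℝ] V') (K : ConvexBody V) : ConvexBody V' :=
  ⟨f '' (K : Set V), K.convex.linear_image (f : V →ₗ[ℝ] V'),
    K.isCompact.image f.continuous, K.nonempty.image _⟩

/-- The reflection `-K` of a convex body about the origin. -/
def ConvexBody.neg (K : ConvexBody V) : ConvexBody V :=
  K.mapCLM (-(ContinuousLinearMap.id ℝ V))

/-- The union of two convex bodies (a convex body provided it is convex). -/
def ConvexBody.union (K L : ConvexBody V) (h : Convex ℝ ((K : Set V) ∪ (L : Set V))) :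
    ConvexBody V :=
  ⟨(K : Set V) ∪ (L : Set V), h, K.isCompact.union L.isCompact,
    K.nonempty.mono Set.subset_union_left⟩

/-- The intersection of two convex bodies (a convex body provided it is nonempty). -/
def ConvexBody.inter (K L : ConvexBody V) (h : ((K : Set V) ∩ (L : Set V)).Nonempty) :
    ConvexBody V :=
  ⟨(K : Set V) ∩ (L : Set V), K.convex.inter L.convex,
    K.isCompact.inter_right L.isClosed, h⟩

/-- A Minkowski valuation: `Z(K ∪ L) + Z(K ∩ L) = Z(K) + Z(L)` (Minkowski addition)
whenever `K, L, K ∪ L` are convex bodies. -/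
def IsMinkowskiValuation (Z : ConvexBody V → ConvexBody A) : Prop :=
  ∀ (K L : ConvexBody V) (hU : Convex ℝ ((K : Set V) ∪ (L : Set V)))
    (hI : ((K : Set V) ∩ (L : Set V)).Nonempty),
    Z (K.union L hU) + Z (K.inter L hI) = Z K + Z L

/-- A real-valued valuation: `φ(K ∪ L) + φ(K ∩ L) = φ(K) + φ(L)`
whenever `K, L, K ∪ L` are convex bodies. -/
def IsValuation (φ : ConvexBody V → ℝ) : Prop :=
  ∀ (K L : ConvexBody V) (hU : Convex ℝ ((K : Set V) ∪ (L : Set V)))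
    (hI : ((K : Set V) ∩ (L : Set V)).Nonempty),
    φ (K.union L hU) + φ (K.inter L hI) = φ K + φ L

/-- Translation invariance of a map defined on convex bodies. -/
def IsTranslationInvariant {α : Type*} (Z : ConvexBody V → α) : Prop :=
  ∀ (K : ConvexBody V) (x : V), Z (K.translate x) = Z K

/-- The mixed volume (w.r.t. the Lebesgue (Haar) measure `μ`) of an `n`-tuple of convex
bodies, given by the polarization formula
`V(K₁, …, Kₙ) = (1/n!) ∑_{S ⊆ {1,…,n}} (-1)^{n - |S|} vol(∑_{i ∈ S} K_i)`. -/
def mixedVol [MeasurableSpace V] (μ : Measure V) {n : ℕ} (K : Fin n → ConvexBody V) : ℝ :=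
  (n.factorial : ℝ)⁻¹ *
    ∑ S : Finset (Fin n), (-1 : ℝ) ^ (n - S.card) * (μ (∑ i ∈ S, (K i : Set V))).toReal

/-- The extension `V(K, …, K, f)` (with `n - 1` copies of `K`) of the mixed volume to
continuous positively `1`-homogeneous functions `f` on the dual space, defined via
Aleksandrov's variational formula: `V(K,…,K,f)` is `1/n` times the right derivative at
`t = 0` of the volume of the Wulff shape (aka Aleksandrov body) of `h_K + t f`.
For `f = h_L` the Wulff shape is `K + t L`, so this indeed extends `L ↦ V(K, …, K, L)`. -/
def mixedVolFn [MeasurableSpace V] (μ : Measure V) (K : ConvexBody V)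
    (f : (V →L[ℝ] ℝ) → ℝ) : ℝ :=
  (Module.finrank ℝ V : ℝ)⁻¹ *
    derivWithin (fun t : ℝ =>
        (μ {x : V | ∀ ξ : V →L[ℝ] ℝ, ξ x ≤ hSupp K ξ + t * f ξ}).toReal)
      (Set.Ici 0) 0

/-- The dimension of a convex body: the dimension of (the direction of) its affine hull. -/
def bodyDim (K : ConvexBody V) : ℕ := Module.finrank ℝ (vectorSpan ℝ (K : Set V))

/-- A convex body contained in a subspace `E`, viewed as a convex body of `E`. -/
def bodyIn (E : Submodule ℝ V) (K : ConvexBody V) (h : (K : Set V) ⊆ (E : Set V)) :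
    ConvexBody ↥E :=
  ⟨Subtype.val ⁻¹' (K : Set V),
    K.convex.linear_preimage (E.subtype),
    by
      rw [Topology.IsEmbedding.subtypeVal.isCompact_iff,
        Set.image_preimage_eq_of_subset (by rw [Subtype.range_coe]; exact h)]
      exact K.isCompact,
    by obtain ⟨x, hx⟩ := K.nonempty; exact ⟨⟨x, h hx⟩, hx⟩⟩

/-- The properties of the components of McMullen's decomposition of (the support function
of) a Minkowski valuation: each `fᵢ(·, u)` is a continuous, translation invariant
valuation, homogeneous of degree `i`, and each `fᵢ(K, ·)` is continuous and positively
`1`-homogeneous. -/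
def McMullenProps (f : ℕ → ConvexBody V → V → ℝ) : Prop :=
  (∀ (i : ℕ) (u : V), Continuous fun K : ConvexBody V => f i K u) ∧
  (∀ (i : ℕ) (u : V), IsValuation fun K : ConvexBody V => f i K u) ∧
  (∀ (i : ℕ) (u : V), IsTranslationInvariant fun K : ConvexBody V => f i K u) ∧
  (∀ (i : ℕ) (K : ConvexBody V) (u : V) (t : ℝ), 0 < t → f i (t • K) u = t ^ i * f i K u) ∧
  (∀ (i : ℕ) (K : ConvexBody V), Continuous fun u : V => f i K u) ∧
  (∀ (i : ℕ) (K : ConvexBody V) (u : V) (t : ℝ), 0 < t → f i K (t • u) = t * f i K u)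

end CommonDefs

/-- The surface area measure `S(M, ·)` on `S¹ ⊆ ℂ` of a planar convex body `M`,
characterized (uniquely) by the property that it is a finite measure concentrated on the
unit circle with `∫_{S¹} h(L, α) dσ(α) = 2 V(M, L)` for every planar convex body `L`. -/
def IsSurfaceAreaMeasure (M : ConvexBody ℂ) (σ : Measure ℂ) : Prop :=
  IsFiniteMeasure σ ∧ σ (Metric.sphere (0 : ℂ) 1)ᶜ = 0 ∧
    ∀ L : ConvexBody ℂ,
      (∫ α, hSupp L (fun c => (c * (starRingEnd ℂ) α).re) ∂σ) = 2 * mixedVol volume ![M, L]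

section ComplexDefs

variable {W : Type*} [NormedAddCommGroup W] [NormedSpace ℂ W] [FiniteDimensional ℂ W]

/-- The determinant pairing `det(u, v)` on a 2-dimensional complex vector space,
with respect to a fixed basis `b`. -/
def cdet (b : Basis (Fin 2) ℂ W) (u v : W) : ℂ :=
  b.coord 0 u * b.coord 1 v - b.coord 1 u * b.coord 0 v

/-- `det(·, w) : W → ℂ` as a continuous real-linear map. -/
def cdetCLM (b : Basis (Fin 2) ℂ W) (w : W) : W →L[ℝ] ℂ :=
  LinearMap.toContinuousLinearMap
    (((b.coord 1 w) • (b.coord 0 : W →ₗ[ℂ] ℂ)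
      - (b.coord 0 w) • (b.coord 1 : W →ₗ[ℂ] ℂ)).restrictScalars ℝ)

/-- `det(K, w) = {det(k, w) : k ∈ K} ⊆ ℂ`. -/
def detBody (b : Basis (Fin 2) ℂ W) (K : ConvexBody W) (w : W) : ConvexBody ℂ :=
  K.mapCLM (cdetCLM b w)

/-- `N · w = {c • w : c ∈ N} ⊆ W` for a planar convex body `N ⊆ ℂ`. -/
def dotBody (N : ConvexBody ℂ) (w : W) : ConvexBody W :=
  N.mapCLM (LinearMap.toContinuousLinearMap ((LinearMap.toSpanSingleton ℂ W w).restrictScalars ℝ))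

/-- A complex-linear endomorphism, as a continuous real-linear map. -/
def cReal (g : W →ₗ[ℂ] W) : W →L[ℝ] W :=
  LinearMap.toContinuousLinearMap (g.restrictScalars ℝ)

/-- Precomposition `ξ ↦ ξ ∘ g` on the complex dual `W* = W →L[ℂ] ℂ`,
as a continuous real-linear map. The adjoint of `g` is `precompDual g`, and
`g^{-*} = precompDual g⁻¹`. -/
def precompDual (g : W →L[ℂ] W) : (W →L[ℂ] ℂ) →L[ℝ] (W →L[ℂ] ℂ) :=
  LinearMap.toContinuousLinearMap
    { toFun := fun ξ => ξ.comp g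
      map_add' := fun ξ η => ContinuousLinearMap.add_comp ξ η g
      map_smul' := fun r ξ => ContinuousLinearMap.smul_comp r ξ g }

/-- `Z : 𝒦(W) → 𝒦(W*)` is `SL(W,ℂ)`-contravariant: `Z(gK) = g^{-*} Z(K)` for every
`g ∈ SL(W,ℂ)`. -/
def IsSLContravariant (Z : ConvexBody W → ConvexBody (W →L[ℂ] ℂ)) : Prop :=
  ∀ g : W ≃L[ℂ] W, LinearMap.det ((g : W →L[ℂ] W) : W →ₗ[ℂ] W) = 1 →
    ∀ K : ConvexBody W,
      Z (K.mapCLM (cReal (g : W →ₗ[ℂ] W))) =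
        (Z K).mapCLM (precompDual (g.symm : W →L[ℂ] W))

/-- `Z : 𝒦(W) → 𝒦(W)` is `SL(W,ℂ)`-covariant: `Z(gK) = g Z(K)` for every
`g ∈ SL(W,ℂ)`. -/
def IsSLCovariant (Z : ConvexBody W → ConvexBody W) : Prop :=
  ∀ g : W ≃L[ℂ] W, LinearMap.det ((g : W →L[ℂ] W) : W →ₗ[ℂ] W) = 1 →
    ∀ K : ConvexBody W,
      Z (K.mapCLM (cReal (g : W →ₗ[ℂ] W))) = (Z K).mapCLM (cReal (g : W →ₗ[ℂ] W))

end ComplexDefs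

section General

variable {V V' : Type*}
variable [NormedAddCommGroup V] [NormedSpace ℝ V]
variable [NormedAddCommGroup V'] [NormedSpace ℝ V']

/-- Extension of a functional on convex bodies to all sets, by zero. -/
def bext (φ : ConvexBody V → ℝ) (S : Set V) : ℝ :=
  open Classical in
  if h : Convex ℝ S ∧ IsCompact S ∧ S.Nonempty then φ ⟨S, h.1, h.2.1, h.2.2⟩ else 0

theorem bext_coe (φ : ConvexBody V → ℝ) (K : ConvexBody V) : bext φ (K : Set V) = φ K := by
  have h : Convex ℝ (K : Set V) ∧ IsCompact (K : Set V) ∧ (K : Set V).Nonempty :=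
    ⟨K.convex, K.isCompact, K.nonempty⟩
  rw [bext, dif_pos h]
  congr 1

theorem bext_of (φ : ConvexBody V → ℝ) {S : Set V} (h1 : Convex ℝ S) (h2 : IsCompact S)
    (h3 : S.Nonempty) : bext φ S = φ ⟨S, h1, h2, h3⟩ := bext_coe φ ⟨S, h1, h2, h3⟩

theorem bext_empty (φ : ConvexBody V → ℝ) : bext φ ∅ = 0 := by
  rw [bext, dif_neg]; simp

theorem isClosed_le_clm (l : V →L[ℝ] ℝ) (c : ℝ) : IsClosed {x | l x ≤ c} :=
  isClosed_le l.continuous continuous_const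

theorem isClosed_ge_clm (l : V →L[ℝ] ℝ) (c : ℝ) : IsClosed {x | c ≤ l x} :=
  isClosed_le continuous_const l.continuous

theorem convex_le_clm (l : V →L[ℝ] ℝ) (c : ℝ) : Convex ℝ {x | l x ≤ c} :=
  convex_halfSpace_le l.toLinearMap.isLinear c

theorem convex_ge_clm (l : V →L[ℝ] ℝ) (c : ℝ) : Convex ℝ {x | c ≤ l x} :=
  convex_halfSpace_ge l.toLinearMap.isLinear c

theorem exists_mem_inter_segment {K L : Set V} (hK : IsClosed K) (hL : IsClosed L) {x y : V}
    (hx : x ∈ K) (hy : y ∈ L) (h : segment ℝ x y ⊆ K ∪ L) :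
    ∃ z ∈ segment ℝ x y, z ∈ K ∧ z ∈ L := by
  have hc : IsPreconnected (segment ℝ x y) := (convex_segment x y).isPreconnected
  obtain ⟨z, hz, hz1⟩ := isPreconnected_closed_iff.1 hc K L hK hL h
    ⟨x, left_mem_segment ℝ x y, hx⟩ ⟨y, right_mem_segment ℝ x y, hy⟩
  exact ⟨z, hz, hz1⟩

theorem bext_cut {φ : ConvexBody V → ℝ} (hφ : IsValuation φ) {S : Set V} (hS : Convex ℝ S)
    (hc : IsCompact S) (l : V →L[ℝ] ℝ) (c : ℝ) :
    bext φ (S ∩ {x | l x ≤ c}) + bext φ (S ∩ {x | c ≤ l x}) =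
      bext φ S + bext φ (S ∩ {x | l x = c}) := by
  by_cases h1 : (S ∩ {x | l x ≤ c}).Nonempty
  swap
  · have e1 : S ∩ {x | l x ≤ c} = ∅ := Set.not_nonempty_iff_eq_empty.1 h1
    have e2 : S ∩ {x | l x = c} = ∅ :=
      Set.subset_empty_iff.1 (e1 ▸ fun x hx => ⟨hx.1, le_of_eq hx.2⟩)
    have e3 : S ∩ {x | c ≤ l x} = S := by
      refine Set.inter_eq_left.2 fun x hx => ?_
      by_contra h
      exact h1 ⟨x, hx, show l x ≤ c from le_of_not_ge h⟩
    rw [e1, e2, e3, bext_empty]; ring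
  by_cases h2 : (S ∩ {x | c ≤ l x}).Nonempty
  swap
  · have e1 : S ∩ {x | c ≤ l x} = ∅ := Set.not_nonempty_iff_eq_empty.1 h2
    have e2 : S ∩ {x | l x = c} = ∅ :=
      Set.subset_empty_iff.1 (e1 ▸ fun x hx => ⟨hx.1, ge_of_eq hx.2⟩)
    have e3 : S ∩ {x | l x ≤ c} = S := by
      refine Set.inter_eq_left.2 fun x hx => ?_
      by_contra h
      exact h2 ⟨x, hx, show c ≤ l x from le_of_not_ge h⟩
    rw [e1, e2, e3, bext_empty]
  let K : ConvexBody V := ⟨_, hS.inter (convex_le_clm l c), hc.inter_right (isClosed_le_clm l c),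
    h1⟩
  let L : ConvexBody V := ⟨_, hS.inter (convex_ge_clm l c), hc.inter_right (isClosed_ge_clm l c),
    h2⟩
  have eU : (K : Set V) ∪ L = S := by
    change (S ∩ {x | l x ≤ c}) ∪ (S ∩ {x | c ≤ l x}) = S
    rw [← Set.inter_union_distrib_left]
    exact Set.inter_eq_left.2 fun x _ => le_total (l x) c
  have eI : (K : Set V) ∩ L = S ∩ {x | l x = c} := by
    change (S ∩ {x | l x ≤ c}) ∩ (S ∩ {x | c ≤ l x}) = _
    rw [← Set.inter_inter_distrib_left]
    congr 1
    ext x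
    exact ⟨fun h => le_antisymm h.1 h.2, fun h => ⟨le_of_eq h, ge_of_eq h⟩⟩
  have hU : Convex ℝ ((K : Set V) ∪ L) := eU ▸ hS
  obtain ⟨x, hx⟩ := h1
  obtain ⟨y, hy⟩ := h2
  obtain ⟨z, -, hz⟩ := exists_mem_inter_segment K.isClosed L.isClosed hx hy
    (hU.segment_subset (Or.inl hx) (Or.inr hy))
  have hI : ((K : Set V) ∩ L).Nonempty := ⟨z, hz⟩
  have := hφ K L hU hI
  rw [← bext_coe φ, ← bext_coe φ, ← bext_coe φ K, ← bext_coe φ L] at this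
  change bext φ ((K : Set V) ∪ L) + bext φ ((K : Set V) ∩ L) = _ at this
  rw [eU, eI] at this
  exact this.symm

theorem ConvexBody.dist_le_of {K L : ConvexBody V} {r : ℝ} (hr : 0 ≤ r)
    (h1 : ∀ x ∈ (K : Set V), ∃ y ∈ (L : Set V), dist x y ≤ r)
    (h2 : ∀ x ∈ (L : Set V), ∃ y ∈ (K : Set V), dist x y ≤ r) : dist K L ≤ r := by
  rw [← ConvexBody.hausdorffDist_coe]
  exact Metric.hausdorffDist_le_of_mem_dist hr h1 h2

theorem ConvexBody.exists_dist_lt {K L : ConvexBody V} {r : ℝ} (h : dist K L < r) {x : V}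
    (hx : x ∈ (K : Set V)) : ∃ y ∈ (L : Set V), dist x y < r := by
  rw [← ConvexBody.hausdorffDist_coe] at h
  exact Metric.exists_dist_lt_of_hausdorffDist_lt hx h ConvexBody.hausdorffEDist_ne_top

theorem ConvexBody.exists_dist_le (K L : ConvexBody V) {x : V}
    (hx : x ∈ (K : Set V)) : ∃ y ∈ (L : Set V), dist x y ≤ dist K L := by
  obtain ⟨y, hy, h⟩ := L.isCompact.exists_infDist_eq_dist L.nonempty x
  refine ⟨y, hy, le_of_forall_gt fun r hr => ?_⟩
  obtain ⟨z, hz, h'⟩ := ConvexBody.exists_dist_lt hr hx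
  rw [← h]
  exact (Metric.infDist_le_dist_of_mem hz).trans_lt h'

theorem ConvexBody.dist_mapCLM_le (f : V →L[ℝ] V') (K L : ConvexBody V) :
    dist (K.mapCLM f) (L.mapCLM f) ≤ ‖f‖ * dist K L := by
  refine ConvexBody.dist_le_of (by positivity) ?_ ?_
  · rintro _ ⟨x, hx, rfl⟩
    obtain ⟨y, hy, h⟩ := ConvexBody.exists_dist_le K L hx
    refine ⟨f y, ⟨y, hy, rfl⟩, ?_⟩
    exact (f.dist_le_opNorm x y).trans (by gcongr)
  · rintro _ ⟨x, hx, rfl⟩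
    obtain ⟨y, hy, h⟩ := ConvexBody.exists_dist_le L K hx
    refine ⟨f y, ⟨y, hy, rfl⟩, ?_⟩
    rw [dist_comm L K] at h
    exact (f.dist_le_opNorm x y).trans (by gcongr)

theorem ConvexBody.continuous_mapCLM (f : V →L[ℝ] V') :
    Continuous (ConvexBody.mapCLM f : ConvexBody V → ConvexBody V') :=
  (LipschitzWith.of_dist_le_mul (K := ‖f‖₊)
    fun K L => by simpa using ConvexBody.dist_mapCLM_le f K L).continuous

theorem ConvexBody.dist_add_le (K L M N : ConvexBody V) :
    dist (K + M) (L + N) ≤ dist K L + dist M N := by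
  refine ConvexBody.dist_le_of (by positivity) ?_ ?_
  · intro z hz
    rw [ConvexBody.coe_add] at hz
    obtain ⟨x, hx, m, hm, rfl⟩ := hz
    obtain ⟨y, hy, h⟩ := ConvexBody.exists_dist_le K L hx
    obtain ⟨n, hn, h'⟩ := ConvexBody.exists_dist_le M N hm
    refine ⟨y + n, by rw [ConvexBody.coe_add]; exact ⟨y, hy, n, hn, rfl⟩, ?_⟩
    exact (dist_add_add_le x m y n).trans (by gcongr)
  · intro z hz
    rw [ConvexBody.coe_add] at hz
    obtain ⟨x, hx, m, hm, rfl⟩ := hz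
    obtain ⟨y, hy, h⟩ := ConvexBody.exists_dist_le L K hx
    obtain ⟨n, hn, h'⟩ := ConvexBody.exists_dist_le N M hm
    refine ⟨y + n, by rw [ConvexBody.coe_add]; exact ⟨y, hy, n, hn, rfl⟩, ?_⟩
    rw [dist_comm K L, dist_comm M N]
    exact (dist_add_add_le x m y n).trans (by gcongr)

instance : ContinuousAdd (ConvexBody V) := ⟨by
  refine (LipschitzWith.of_dist_le_mul (K := 2) fun p q => ?_).continuous
  refine (ConvexBody.dist_add_le p.1 q.1 p.2 q.2).trans ?_
  have := le_max_left (dist p.1 q.1) (dist p.2 q.2)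
  have := le_max_right (dist p.1 q.1) (dist p.2 q.2)
  rw [Prod.dist_eq]; push_cast; linarith⟩

theorem ConvexBody.coe_mapCLM (f : V →L[ℝ] V') (K : ConvexBody V) :
    (K.mapCLM f : Set V') = f '' (K : Set V) := rfl

theorem ConvexBody.coe_translate (K : ConvexBody V) (x : V) :
    (K.translate x : Set V) = (fun y => x + y) '' (K : Set V) := rfl

theorem ConvexBody.smul_eq_mapCLM (t : ℝ) (K : ConvexBody V) :
    t • K = K.mapCLM (t • ContinuousLinearMap.id ℝ V) := by
  apply ConvexBody.ext
  rw [ConvexBody.coe_smul, ConvexBody.coe_mapCLM]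
  rfl

theorem ConvexBody.mapCLM_mapCLM {V'' : Type*} [NormedAddCommGroup V''] [NormedSpace ℝ V'']
    (f : V →L[ℝ] V') (g : V' →L[ℝ] V'') (K : ConvexBody V) :
    (K.mapCLM f).mapCLM g = K.mapCLM (g.comp f) := by
  apply ConvexBody.ext
  simp only [ConvexBody.coe_mapCLM, Set.image_image]
  rfl

theorem ConvexBody.mapCLM_translate (f : V →L[ℝ] V') (K : ConvexBody V) (x : V) :
    (K.translate x).mapCLM f = (K.mapCLM f).translate (f x) := by
  apply ConvexBody.ext
  simp only [ConvexBody.coe_mapCLM, ConvexBody.coe_translate, Set.image_image, map_add]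

theorem ConvexBody.mapCLM_add (f : V →L[ℝ] V') (K L : ConvexBody V) :
    (K + L).mapCLM f = K.mapCLM f + L.mapCLM f := by
  apply ConvexBody.ext
  simp only [ConvexBody.coe_mapCLM, ConvexBody.coe_add, Set.image_add]

/-- Bodies depending continuously on a parameter through linear maps. -/
theorem ConvexBody.dist_mapCLM_mapCLM_le (f g : V →L[ℝ] V') (K : ConvexBody V) {R : ℝ}
    (hR : ∀ x ∈ (K : Set V), ‖x‖ ≤ R) :
    dist (K.mapCLM f) (K.mapCLM g) ≤ ‖f - g‖ * R := by
  have hR0 : 0 ≤ R := by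
    obtain ⟨x, hx⟩ := K.nonempty
    exact (norm_nonneg x).trans (hR x hx)
  have key : ∀ x ∈ (K : Set V), dist (f x) (g x) ≤ ‖f - g‖ * R := fun x hx => by
    rw [dist_eq_norm, ← sub_apply]
    exact ((f - g).le_opNorm x).trans (by gcongr; exact hR x hx)
  refine ConvexBody.dist_le_of (by positivity) ?_ ?_
  · rintro _ ⟨x, hx, rfl⟩
    exact ⟨g x, ⟨x, hx, rfl⟩, key x hx⟩
  · rintro _ ⟨x, hx, rfl⟩
    exact ⟨f x, ⟨x, hx, rfl⟩, by rw [dist_comm]; exact key x hx⟩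

theorem ConvexBody.exists_norm_le (K : ConvexBody V) : ∃ R, 0 ≤ R ∧ ∀ x ∈ (K : Set V), ‖x‖ ≤ R := by
  obtain ⟨R, hR⟩ := K.isBounded.exists_norm_le
  exact ⟨max R 0, le_max_right _ _, fun x hx => (hR x hx).trans (le_max_left _ _)⟩

theorem ConvexBody.continuous_mapCLM_apply (K : ConvexBody V) :
    Continuous fun f : V →L[ℝ] V' => K.mapCLM f := by
  obtain ⟨R, hR0, hR⟩ := K.exists_norm_le
  refine (LipschitzWith.of_dist_le_mul (K := ⟨R, hR0⟩) fun f g => ?_).continuous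
  refine (ConvexBody.dist_mapCLM_mapCLM_le f g K hR).trans ?_
  rw [dist_eq_norm, mul_comm]; rfl

theorem ConvexBody.continuous_smul_left (K : ConvexBody V) : Continuous fun t : ℝ => t • K := by
  simp_rw [ConvexBody.smul_eq_mapCLM]
  exact K.continuous_mapCLM_apply.comp (by fun_prop)

theorem ConvexBody.continuous_smul_right (t : ℝ) : Continuous fun K : ConvexBody V => t • K := by
  simp_rw [ConvexBody.smul_eq_mapCLM]
  exact ConvexBody.continuous_mapCLM _

/-! ### Support functions -/

theorem ConvexBody.le_hSupp (K : ConvexBody V) {p : V → ℝ} (hp : Continuous p) {x : V}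
    (hx : x ∈ (K : Set V)) : p x ≤ hSupp K p :=
  le_csSup (K.isCompact.image hp).bddAbove ⟨x, hx, rfl⟩

theorem ConvexBody.hSupp_le (K : ConvexBody V) {p : V → ℝ} {c : ℝ}
    (h : ∀ x ∈ (K : Set V), p x ≤ c) : hSupp K p ≤ c :=
  csSup_le (K.nonempty.image p) (by rintro _ ⟨x, hx, rfl⟩; exact h x hx)

theorem ConvexBody.exists_hSupp (K : ConvexBody V) {p : V → ℝ} (hp : Continuous p) :
    ∃ x ∈ (K : Set V), hSupp K p = p x := by
  obtain ⟨x, hx, h⟩ := K.isCompact.exists_isMaxOn K.nonempty hp.continuousOn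
  exact ⟨x, hx, le_antisymm (K.hSupp_le h) (K.le_hSupp hp hx)⟩

theorem ConvexBody.hSupp_add (K L : ConvexBody V) (l : V →L[ℝ] ℝ) :
    hSupp (K + L) l = hSupp K l + hSupp L l := by
  apply le_antisymm
  · refine ConvexBody.hSupp_le _ fun z hz => ?_
    rw [ConvexBody.coe_add] at hz
    obtain ⟨x, hx, y, hy, rfl⟩ := hz
    rw [map_add]
    exact add_le_add (K.le_hSupp l.continuous hx) (L.le_hSupp l.continuous hy)
  · obtain ⟨x, hx, h1⟩ := K.exists_hSupp l.continuous
    obtain ⟨y, hy, h2⟩ := L.exists_hSupp l.continuous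
    rw [h1, h2, ← map_add]
    refine ConvexBody.le_hSupp _ l.continuous ?_
    rw [ConvexBody.coe_add]
    exact ⟨x, hx, y, hy, rfl⟩

theorem ConvexBody.hSupp_mapCLM (f : V →L[ℝ] V') (K : ConvexBody V) (p : V' → ℝ) :
    hSupp (K.mapCLM f) p = hSupp K (fun x => p (f x)) := by
  simp only [hSupp, ConvexBody.coe_mapCLM, Set.image_image]

theorem ConvexBody.hSupp_smul {t : ℝ} (ht : 0 ≤ t) (K : ConvexBody V) (l : V →L[ℝ] ℝ) :
    hSupp (t • K) l = t * hSupp K l := by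
  rw [ConvexBody.smul_eq_mapCLM, ConvexBody.hSupp_mapCLM]
  obtain ⟨x, hx, h1⟩ := K.exists_hSupp l.continuous
  apply le_antisymm
  · refine ConvexBody.hSupp_le _ fun z hz => ?_
    simpa using mul_le_mul_of_nonneg_left (K.le_hSupp l.continuous hz) ht
  · rw [h1]
    have := K.le_hSupp (p := fun x => l ((t • ContinuousLinearMap.id ℝ V) x)) (by fun_prop) hx
    simpa using this

theorem ConvexBody.hSupp_translate (K : ConvexBody V) (x : V) (l : V →L[ℝ] ℝ) :
    hSupp (K.translate x) l = l x + hSupp K l := by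
  obtain ⟨y, hy, h1⟩ := K.exists_hSupp l.continuous
  apply le_antisymm
  · refine ConvexBody.hSupp_le _ ?_
    rintro _ ⟨z, hz, rfl⟩
    simpa using K.le_hSupp l.continuous hz
  · rw [h1, ← map_add]
    exact ConvexBody.le_hSupp _ l.continuous ⟨y, hy, rfl⟩

theorem ConvexBody.hSupp_mono {K L : ConvexBody V} (h : (K : Set V) ⊆ L) {p : V → ℝ}
    (hp : Continuous p) : hSupp K p ≤ hSupp L p :=
  K.hSupp_le fun _ hx => L.le_hSupp hp (h hx)

theorem ConvexBody.hSupp_lipschitz (l : V →L[ℝ] ℝ) (K L : ConvexBody V) :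
    hSupp K l ≤ hSupp L l + ‖l‖ * dist K L := by
  refine K.hSupp_le fun x hx => ?_
  obtain ⟨y, hy, h⟩ := ConvexBody.exists_dist_le K L hx
  have h1 := L.le_hSupp l.continuous hy
  have h2 := (le_abs_self _).trans (l.dist_le_opNorm x y)
  have h3 : ‖l‖ * dist x y ≤ ‖l‖ * dist K L := by gcongr
  linarith

theorem ConvexBody.continuous_hSupp (l : V →L[ℝ] ℝ) :
    Continuous fun K : ConvexBody V => hSupp K l := by
  refine (LipschitzWith.of_dist_le_mul (K := ‖l‖₊) fun K L => ?_).continuous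
  rw [Real.dist_eq, abs_le]
  have h1 := ConvexBody.hSupp_lipschitz l K L
  have h2 := ConvexBody.hSupp_lipschitz l L K
  rw [dist_comm] at h2
  simp only [coe_nnnorm]
  constructor <;> linarith

theorem ConvexBody.hSupp_isValuation (l : V →L[ℝ] ℝ) :
    IsValuation fun K : ConvexBody V => hSupp K l := by
  intro K L hU hI
  wlog h : hSupp K l ≤ hSupp L l generalizing K L
  · have := this L K (by rwa [Set.union_comm]) (by rwa [Set.inter_comm]) (not_le.1 h).le
    have e1 : L.union K (by rwa [Set.union_comm]) = K.union L hU :=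
      ConvexBody.ext (Set.union_comm _ _)
    have e2 : L.inter K (by rwa [Set.inter_comm]) = K.inter L hI :=
      ConvexBody.ext (Set.inter_comm _ _)
    rw [e1, e2] at this
    rw [this, add_comm]
  have hu : hSupp (K.union L hU) l = hSupp L l := by
    apply le_antisymm
    · refine ConvexBody.hSupp_le _ ?_
      rintro x (hx | hx)
      · exact (K.le_hSupp l.continuous hx).trans h
      · exact L.le_hSupp l.continuous hx
    · exact ConvexBody.hSupp_mono (K := L) (L := K.union L hU) Set.subset_union_right l.continuous
  have hi : hSupp (K.inter L hI) l = hSupp K l := by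
    apply le_antisymm
    · exact ConvexBody.hSupp_mono (L := K) (K := K.inter L hI) Set.inter_subset_left l.continuous
    · obtain ⟨x, hx, h1⟩ := K.exists_hSupp l.continuous
      obtain ⟨y, hy, h2⟩ := L.exists_hSupp l.continuous
      obtain ⟨z, hz, hzK, hzL⟩ := exists_mem_inter_segment K.isClosed L.isClosed hx hy
        (hU.segment_subset (Or.inl hx) (Or.inr hy))
      have h3 : l z ≤ hSupp (K.inter L hI) l :=
        ConvexBody.le_hSupp _ l.continuous ⟨hzK, hzL⟩
      refine le_trans ?_ h3
      rw [h1]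
      exact (convex_ge_clm l (l x)).segment_subset (le_refl (l x))
        (show l x ≤ l y by rw [← h1, ← h2]; exact h) hz
  simp only [hu, hi, add_comm]

theorem ConvexBody.subset_of_hSupp_le {K L : ConvexBody V}
    (h : ∀ l : V →L[ℝ] ℝ, hSupp K l ≤ hSupp L l) : (K : Set V) ⊆ L := by
  intro x hx
  by_contra hxL
  obtain ⟨l, u, h1, h2⟩ := geometric_hahn_banach_closed_point L.convex L.isClosed hxL
  have h3 : hSupp L l ≤ u := L.hSupp_le fun y hy => (h1 y hy).le
  have h4 := K.le_hSupp l.continuous hx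
  linarith [h l]

theorem ConvexBody.eq_of_hSupp_eq {K L : ConvexBody V}
    (h : ∀ l : V →L[ℝ] ℝ, hSupp K l = hSupp L l) : K = L :=
  ConvexBody.ext ((ConvexBody.subset_of_hSupp_le fun l => (h l).le).antisymm
    (ConvexBody.subset_of_hSupp_le fun l => (h l).ge))

/-! ### Valuations -/

theorem inter_add_eq {K L M : Set V} (hK : IsClosed K) (hL : IsClosed L)
    (hM : Convex ℝ M) (hU : Convex ℝ (K ∪ L)) :
    (K ∩ L) + M = (K + M) ∩ (L + M) := by
  apply Set.Subset.antisymm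
  · exact Set.inter_add_subset
  · rintro z ⟨⟨k, hk, m, hm, rfl⟩, ⟨l, hl, m', hm', he⟩⟩
    simp only at he
    obtain ⟨w, hw, hwK, hwL⟩ := exists_mem_inter_segment hK hL hk hl
        (hU.segment_subset (Or.inl hk) (Or.inr hl))
    obtain ⟨s, t, hs, ht, hst, rfl⟩ := hw
    refine ⟨s • k + t • l, ⟨hwK, hwL⟩, s • m + t • m', hM hm hm' hs ht hst, ?_⟩
    have : s • k + t • l + (s • m + t • m') = s • (k + m) + t • (l + m') := by
      simp only [smul_add]; abel
    simp only [this, he, ← add_smul, hst, one_smul]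

theorem IsValuation.of_eq {φ : ConvexBody V → ℝ} (hφ : IsValuation φ) {K L U I : ConvexBody V}
    (hU : (U : Set V) = (K : Set V) ∪ L) (hI : (I : Set V) = (K : Set V) ∩ L) :
    φ U + φ I = φ K + φ L := by
  have h := hφ K L (hU ▸ U.convex) (hI ▸ I.nonempty)
  rw [← h]
  congr 2
  · exact ConvexBody.ext hU
  · exact ConvexBody.ext hI

theorem IsValuation.comp_add {φ : ConvexBody V → ℝ} (hφ : IsValuation φ) (M : ConvexBody V) :
    IsValuation fun K => φ (K + M) := by
  intro K L hU hI
  have e1 : ((K + M : ConvexBody V) : Set V) ∪ (L + M : ConvexBody V) =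
      (K.union L hU + M : ConvexBody V) := by
    simp only [ConvexBody.coe_add, ← Set.union_add]
    rfl
  have e2 : ((K + M : ConvexBody V) : Set V) ∩ (L + M : ConvexBody V) =
      (K.inter L hI + M : ConvexBody V) := by
    simp only [ConvexBody.coe_add]
    exact (inter_add_eq K.isClosed L.isClosed M.convex hU).symm
  exact hφ.of_eq e1.symm e2.symm

theorem IsValuation.add {φ ψ : ConvexBody V → ℝ} (hφ : IsValuation φ) (hψ : IsValuation ψ) :
    IsValuation fun K => φ K + ψ K := fun K L hU hI => by
  linarith [hφ K L hU hI, hψ K L hU hI]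

theorem IsValuation.sub {φ ψ : ConvexBody V → ℝ} (hφ : IsValuation φ) (hψ : IsValuation ψ) :
    IsValuation fun K => φ K - ψ K := fun K L hU hI => by
  linarith [hφ K L hU hI, hψ K L hU hI]

theorem IsValuation.const_mul {φ : ConvexBody V → ℝ} (hφ : IsValuation φ) (c : ℝ) :
    IsValuation fun K => c * φ K := fun K L hU hI => by
  linear_combination c * hφ K L hU hI

theorem isValuation_const (c : ℝ) : IsValuation fun _ : ConvexBody V => c := fun _ _ _ _ => rfl

theorem IsValuation.comp_mapCLM {φ : ConvexBody V' → ℝ} (hφ : IsValuation φ) {f : V →L[ℝ] V'}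
    (hf : Function.Injective f) : IsValuation fun K => φ (K.mapCLM f) := by
  intro K L hU hI
  have e1 : (K.mapCLM f : Set V') ∪ L.mapCLM f = (K.union L hU).mapCLM f :=
    (Set.image_union _ _ _).symm
  have e2 : (K.mapCLM f : Set V') ∩ L.mapCLM f = (K.inter L hI).mapCLM f :=
    (Set.image_inter hf).symm
  exact hφ.of_eq e1.symm e2.symm

theorem volume_isValuation [MeasurableSpace V] [BorelSpace V] (μ : Measure V)
    [IsFiniteMeasureOnCompacts μ] : IsValuation fun K : ConvexBody V => μ.real (K : Set V) := by
  intro K L hU hI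
  change μ.real ((K : Set V) ∪ L) + μ.real ((K : Set V) ∩ L) = _
  exact measureReal_union_add_inter₀ L.isClosed.measurableSet.nullMeasurableSet
    K.isCompact.measure_ne_top L.isCompact.measure_ne_top

end General

section General2

open Filter Topology

variable {V : Type*} [NormedAddCommGroup V] [NormedSpace ℝ V]

theorem ConvexBody.mem_of_ball_subset {K L : ConvexBody V} {x : V} {r : ℝ}
    (hr : Metric.ball x r ⊆ (K : Set V)) (h : dist K L < r) : x ∈ (L : Set V) := by
  by_contra hxL
  obtain ⟨l, u, h1, h2⟩ := geometric_hahn_banach_closed_point L.convex L.isClosed hxL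
  obtain ⟨y0, hy0⟩ := L.nonempty
  have hr0 : 0 < r := dist_nonneg.trans_lt h
  have hl : 0 < ‖l‖ := by
    rw [norm_pos_iff]
    rintro rfl
    have := h1 y0 hy0
    simp only [_root_.zero_apply] at *
    linarith
  have hd : dist K L / r * ‖l‖ < ‖l‖ := by
    have : dist K L / r < 1 := (div_lt_one hr0).2 h
    nlinarith
  obtain ⟨e, he, hle⟩ := l.exists_lt_apply_of_lt_opNorm hd
  have key : ∀ w : V, ‖w‖ < r → l w < ‖l‖ * dist K L := by
    intro w hw
    obtain ⟨y, hy, hd⟩ := ConvexBody.exists_dist_le K L (hr (show x + w ∈ Metric.ball x r by simpa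
      using hw))
    have h3 := (le_abs_self _).trans (l.dist_le_opNorm (x + w) y)
    have h4 : ‖l‖ * dist (x + w) y ≤ ‖l‖ * dist K L := by gcongr
    have := h1 y hy
    rw [map_add] at h3
    linarith
  have hre : ‖r • e‖ < r := by
    rw [norm_smul, Real.norm_of_nonneg hr0.le]; nlinarith
  have k1 := key (r • e) hre
  have k2 := key (-(r • e)) (by rwa [norm_neg])
  rw [map_neg] at k2
  rw [map_smul, smul_eq_mul] at k1 k2
  have k3 : r * |l e| < ‖l‖ * dist K L := by
    rcases abs_cases (l e) with h | h <;> rw [h.1] <;> linarith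
  rw [Real.norm_eq_abs] at hle
  have : dist K L * ‖l‖ < r * |l e| := by
    have := mul_lt_mul_of_pos_left hle hr0
    have e1 : r * (dist K L / r * ‖l‖) = dist K L * ‖l‖ := by field_simp
    linarith
  linarith

theorem ConvexBody.eventually_mem {K : ConvexBody V} {x : V} (hx : x ∈ interior (K : Set V)) :
    ∀ᶠ L : ConvexBody V in 𝓝 K, x ∈ (L : Set V) := by
  obtain ⟨r, hr0, hr⟩ := Metric.isOpen_iff.1 isOpen_interior x hx
  filter_upwards [Metric.ball_mem_nhds K hr0] with L hL
  rw [Metric.mem_ball, dist_comm] at hL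
  exact ConvexBody.mem_of_ball_subset (hr.trans interior_subset) hL

theorem ConvexBody.eventually_notMem {K : ConvexBody V} {x : V} (hx : x ∉ (K : Set V)) :
    ∀ᶠ L : ConvexBody V in 𝓝 K, x ∉ (L : Set V) := by
  have h0 : 0 < Metric.infDist x (K : Set V) :=
    (K.isClosed.notMem_iff_infDist_pos K.nonempty).1 hx
  filter_upwards [Metric.ball_mem_nhds K h0] with L hL hxL
  obtain ⟨y, hy, hd⟩ := ConvexBody.exists_dist_lt hL hxL
  exact absurd (Metric.infDist_le_dist_of_mem hy) (not_le.2 hd)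

theorem ConvexBody.eventually_norm_le (K : ConvexBody V) :
    ∃ R, ∀ᶠ L : ConvexBody V in 𝓝 K, ∀ x ∈ (L : Set V), ‖x‖ ≤ R := by
  obtain ⟨R, hR0, hR⟩ := K.exists_norm_le
  refine ⟨R + 1, ?_⟩
  filter_upwards [Metric.ball_mem_nhds K one_pos] with L hL x hx
  obtain ⟨y, hy, hd⟩ := ConvexBody.exists_dist_lt hL hx
  have h1 := hR y hy
  rw [dist_eq_norm] at hd
  have := norm_add_le (x - y) y
  rw [sub_add_cancel] at this
  linarith

theorem ConvexBody.continuous_volume [FiniteDimensional ℝ V] [MeasurableSpace V] [BorelSpace V]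
    (μ : Measure V) [μ.IsAddHaarMeasure] :
    Continuous fun K : ConvexBody V => μ.real (K : Set V) := by
  rw [continuous_iff_continuousAt]
  intro K
  obtain ⟨R, hR⟩ := K.eventually_norm_le
  have h_int : ∀ L : ConvexBody V, μ.real (L : Set V) =
      ∫ x, (L : Set V).indicator (fun _ => (1 : ℝ)) x ∂μ := fun L => by
    rw [integral_indicator L.isClosed.measurableSet]; simp
  rw [ContinuousAt]
  simp only [h_int]
  refine tendsto_integral_filter_of_dominated_convergence
    ((Metric.closedBall (0 : V) R).indicator fun _ => (1 : ℝ)) ?_ ?_ ?_ ?_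
  · exact Eventually.of_forall fun L =>
      (measurable_const.indicator L.isClosed.measurableSet).aestronglyMeasurable
  · filter_upwards [hR] with L hL
    refine Eventually.of_forall fun x => ?_
    by_cases hx : x ∈ (L : Set V)
    · rw [Set.indicator_of_mem hx, Set.indicator_of_mem (by simpa using hL x hx)]
      simp
    · rw [Set.indicator_of_notMem hx, norm_zero]
      exact Set.indicator_nonneg (fun _ _ => zero_le_one) x
  · rw [integrable_indicator_iff Metric.isClosed_closedBall.measurableSet]
    have := (isCompact_closedBall (0 : V) R).measure_ne_top (μ := μ)
    exact integrableOn_const this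
  · have h0 : μ (frontier (K : Set V)) = 0 := K.convex.addHaar_frontier μ
    have h1 : ∀ᵐ x ∂μ, x ∉ frontier (K : Set V) := measure_eq_zero_iff_ae_notMem.1 h0
    filter_upwards [h1] with x hx
    refine tendsto_const_nhds.congr' ?_
    by_cases hxK : x ∈ (K : Set V)
    · have hxi : x ∈ interior (K : Set V) := by
        by_contra h
        exact hx ⟨subset_closure hxK, h⟩
      filter_upwards [ConvexBody.eventually_mem hxi] with L hL
      rw [Set.indicator_of_mem hL, Set.indicator_of_mem hxK]
    · filter_upwards [ConvexBody.eventually_notMem hxK] with L hL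
      rw [Set.indicator_of_notMem hL, Set.indicator_of_notMem hxK]

/-- The underlying nonempty compact set of a convex body. -/
def ConvexBody.toNC (K : ConvexBody V) : TopologicalSpace.NonemptyCompacts V :=
  ⟨⟨K, K.isCompact⟩, K.nonempty⟩

theorem ConvexBody.isometry_toNC : Isometry (ConvexBody.toNC : ConvexBody V → _) :=
  Isometry.of_dist_eq fun _ _ => rfl

theorem ConvexBody.isCompact_subsets [ProperSpace V] {B : Set V} (hB : IsCompact B) :
    IsCompact {K : ConvexBody V | (K : Set V) ⊆ B} := by
  rw [ConvexBody.isometry_toNC.isUniformInducing.isInducing.isCompact_iff]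
  have hc : IsClosed {C : TopologicalSpace.NonemptyCompacts V | Convex ℝ (C : Set V)} := by
    rw [← isSeqClosed_iff_isClosed]
    intro Cn C hCn hlim x hx y hy a b ha hb hab
    rw [C.isCompact.isClosed.mem_iff_infDist_zero C.nonempty]
    refine le_antisymm (le_of_forall_pos_le_add fun ε hε => ?_) Metric.infDist_nonneg
    obtain ⟨n, hn⟩ := (Metric.tendsto_atTop.1 hlim (ε / 2) (by positivity))
    have hd := hn n le_rfl
    rw [Metric.NonemptyCompacts.dist_eq] at hd
    have hne : Metric.hausdorffEDist (Cn n : Set V) C ≠ ⊤ :=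
      Metric.hausdorffEDist_ne_top_of_nonempty_of_bounded (Cn n).nonempty C.nonempty
        (Cn n).isCompact.isBounded C.isCompact.isBounded
    obtain ⟨x', hx', hdx⟩ := Metric.exists_dist_lt_of_hausdorffDist_lt' hx hd hne
    obtain ⟨y', hy', hdy⟩ := Metric.exists_dist_lt_of_hausdorffDist_lt' hy hd hne
    have hz : a • x' + b • y' ∈ (Cn n : Set V) := hCn n hx' hy' ha hb hab
    obtain ⟨z, hz, hdz⟩ := Metric.exists_dist_lt_of_hausdorffDist_lt hz hd hne
    have h1 : dist (a • x + b • y) (a • x' + b • y') ≤ ε / 2 := by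
      refine (dist_add_add_le _ _ _ _).trans ?_
      rw [dist_smul₀, dist_smul₀, Real.norm_of_nonneg ha, Real.norm_of_nonneg hb,
        dist_comm x, dist_comm y]
      nlinarith
    have := dist_triangle (a • x + b • y) (a • x' + b • y') z
    have := Metric.infDist_le_dist_of_mem (x := a • x + b • y) hz
    linarith
  have := (TopologicalSpace.NonemptyCompacts.isCompact_subsets_of_isCompact hB).inter_right hc
  have e : ConvexBody.toNC '' {K : ConvexBody V | (K : Set V) ⊆ B} =
      {C : TopologicalSpace.NonemptyCompacts V | (C : Set V) ⊆ B} ∩ {C | Convex ℝ (C : Set V)} := ?_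
  · rw [e]; exact this
  ext C
  constructor
  · rintro ⟨K, hK, rfl⟩
    exact ⟨hK, K.convex⟩
  · rintro ⟨h1, h2⟩
    exact ⟨⟨C, h2, C.isCompact, C.nonempty⟩, h1, rfl⟩

theorem ConvexBody.exists_bound [ProperSpace V] {φ : ConvexBody V → ℝ} (hφ : Continuous φ)
    {B : Set V} (hB : IsCompact B) :
    ∃ C, 0 ≤ C ∧ ∀ S : Set V, S ⊆ B → |bext φ S| ≤ C := by
  obtain ⟨C, hC⟩ := ((ConvexBody.isCompact_subsets hB).image hφ.abs).bddAbove
  refine ⟨max C 0, le_max_right _ _, fun S hS => ?_⟩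
  by_cases h : Convex ℝ S ∧ IsCompact S ∧ S.Nonempty
  · rw [bext, dif_pos h]
    exact (hC ⟨_, hS, rfl⟩).trans (le_max_left _ _)
  · rw [bext, dif_neg h, abs_zero]
    exact le_max_right _ _

/-- The polyhedron cut out by a list of linear inequalities. -/
def polyh (P : List ((V →L[ℝ] ℝ) × ℝ)) : Set V := {x | ∀ p ∈ P, p.1 x ≤ p.2}

theorem polyh_nil : polyh ([] : List ((V →L[ℝ] ℝ) × ℝ)) = Set.univ := by
  simp [polyh]

theorem polyh_cons (p : (V →L[ℝ] ℝ) × ℝ) (P : List ((V →L[ℝ] ℝ) × ℝ)) :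
    polyh (p :: P) = {x | p.1 x ≤ p.2} ∩ polyh P := by
  ext; simp [polyh]

theorem isClosed_polyh (P : List ((V →L[ℝ] ℝ) × ℝ)) : IsClosed (polyh P) := by
  induction P with
  | nil => rw [polyh_nil]; exact isClosed_univ
  | cons p P ih => rw [polyh_cons]; exact (isClosed_le_clm _ _).inter ih

theorem convex_polyh (P : List ((V →L[ℝ] ℝ) × ℝ)) : Convex ℝ (polyh P) := by
  induction P with
  | nil => rw [polyh_nil]; exact convex_univ
  | cons p P ih => rw [polyh_cons]; exact (convex_le_clm _ _).inter ih

theorem exists_polyh (T L : ConvexBody V) {U : Set V} (hU : IsOpen U) (hLU : (L : Set V) ⊆ U) :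
    ∃ P : List ((V →L[ℝ] ℝ) × ℝ), (L : Set V) ⊆ polyh P ∧ (T : Set V) ∩ polyh P ⊆ U := by
  classical
  let ι := {p : (V →L[ℝ] ℝ) × ℝ // ∀ x ∈ (L : Set V), p.1 x ≤ p.2}
  have hcov : (T : Set V) \ U ⊆ ⋃ p : ι, {x | p.1.2 < p.1.1 x} := by
    intro x hx
    obtain ⟨l, u, h1, h2⟩ := geometric_hahn_banach_closed_point L.convex L.isClosed
      (fun h => hx.2 (hLU h) : x ∉ (L : Set V))
    exact Set.mem_iUnion.2 ⟨⟨(l, u), fun y hy => (h1 y hy).le⟩, h2⟩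
  obtain ⟨t, ht⟩ := (T.isCompact.diff hU).elim_finite_subcover _
    (fun p : ι => isOpen_lt continuous_const p.1.1.continuous) hcov
  refine ⟨t.toList.map Subtype.val, ?_, ?_⟩
  · intro x hx p hp
    obtain ⟨q, -, rfl⟩ := List.mem_map.1 hp
    exact q.2 x hx
  · rintro x ⟨hxT, hxP⟩
    by_contra hxU
    obtain ⟨p, hp, hx⟩ := Set.mem_iUnion₂.1 (ht ⟨hxT, hxU⟩)
    have := hxP p.1 (List.mem_map.2 ⟨p, Finset.mem_toList.2 hp, rfl⟩)
    exact absurd this (not_le.2 hx)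

theorem eq_zero_of_bext_polyh {D : ConvexBody V → ℝ} (hD : Continuous D) {T L : ConvexBody V}
    (hLT : (L : Set V) ⊆ T)
    (h : ∀ P : List ((V →L[ℝ] ℝ) × ℝ), bext D ((T : Set V) ∩ polyh P) = 0) : D L = 0 := by
  by_contra hne
  have hopen : IsOpen {K | D K ≠ 0} := isOpen_ne_fun hD continuous_const
  obtain ⟨ε, hε, hb⟩ := Metric.isOpen_iff.1 hopen L hne
  obtain ⟨P, h1, h2⟩ := exists_polyh T L (U := Metric.thickening (ε / 2) (L : Set V))
    Metric.isOpen_thickening (Metric.self_subset_thickening (by positivity) _)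
  have hsub : (L : Set V) ⊆ (T : Set V) ∩ polyh P := Set.subset_inter hLT h1
  let K : ConvexBody V := ⟨_, T.convex.inter (convex_polyh P),
    T.isCompact.inter_right (isClosed_polyh P), L.nonempty.mono hsub⟩
  have hd : dist K L ≤ ε / 2 := by
    refine ConvexBody.dist_le_of (by positivity) ?_ ?_
    · intro x hx
      obtain ⟨y, hy, hxy⟩ := Metric.mem_thickening_iff.1 (h2 hx)
      exact ⟨y, hy, hxy.le⟩
    · intro x hx
      exact ⟨x, hsub hx, by simp; positivity⟩
  have : D K ≠ 0 := hb (show dist K L < ε by linarith)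
  rw [← bext_coe D K] at this
  exact this (h P)

end General2

section Simplices

variable {V V' : Type*} [NormedAddCommGroup V] [NormedSpace ℝ V]
variable [NormedAddCommGroup V'] [NormedSpace ℝ V']

/-- The triangle with vertices `p`, `q`, `r`. -/
def triSet (p q r : V) : Set V :=
  {x | ∃ v w : ℝ, 0 ≤ v ∧ 0 ≤ w ∧ v + w ≤ 1 ∧ x = p + v • (q - p) + w • (r - p)}

theorem convex_triSet (p q r : V) : Convex ℝ (triSet p q r) := by
  rintro x ⟨v, w, hv, hw, hvw, rfl⟩ y ⟨v', w', hv', hw', hvw', rfl⟩ s t hs ht hst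
  refine ⟨s * v + t * v', s * w + t * w', by positivity, by positivity, by nlinarith, ?_⟩
  obtain rfl : t = 1 - s := by linarith
  module

theorem isCompact_triSet (p q r : V) : IsCompact (triSet p q r) := by
  have hK : IsCompact {z : ℝ × ℝ | 0 ≤ z.1 ∧ 0 ≤ z.2 ∧ z.1 + z.2 ≤ 1} := by
    have hc : IsClosed {z : ℝ × ℝ | 0 ≤ z.1 ∧ 0 ≤ z.2 ∧ z.1 + z.2 ≤ 1} :=
      (isClosed_le continuous_const continuous_fst).inter
        ((isClosed_le continuous_const continuous_snd).inter
          (isClosed_le (continuous_fst.add continuous_snd) continuous_const))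
    refine (isCompact_Icc (a := ((0 : ℝ), (0 : ℝ))) (b := (1, 1))).of_isClosed_subset hc ?_
    rintro ⟨a, b⟩ ⟨h1, h2, h3⟩
    simp only at h1 h2 h3
    exact ⟨⟨h1, h2⟩, ⟨by simp; linarith, by simp; linarith⟩⟩
  have := hK.image (f := fun z : ℝ × ℝ => p + z.1 • (q - p) + z.2 • (r - p)) (by fun_prop)
  convert this using 1
  ext x
  constructor
  · rintro ⟨v, w, hv, hw, hvw, rfl⟩
    exact ⟨(v, w), ⟨hv, hw, hvw⟩, rfl⟩
  · rintro ⟨⟨v, w⟩, ⟨hv, hw, hvw⟩, rfl⟩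
    exact ⟨v, w, hv, hw, hvw, rfl⟩

theorem left_mem_triSet (p q r : V) : p ∈ triSet p q r := ⟨0, 0, by simp, by simp, by simp, by simp⟩
theorem mid_mem_triSet (p q r : V) : q ∈ triSet p q r := ⟨1, 0, by simp, by simp, by simp, by simp⟩
theorem right_mem_triSet (p q r : V) : r ∈ triSet p q r :=
  ⟨0, 1, by simp, by simp, by simp, by simp⟩

/-- The triangle with vertices `p`, `q`, `r`, as a convex body. -/
def tri (p q r : V) : ConvexBody V :=
  ⟨triSet p q r, convex_triSet p q r, isCompact_triSet p q r, ⟨p, left_mem_triSet p q r⟩⟩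

theorem coe_tri (p q r : V) : (tri p q r : Set V) = triSet p q r := rfl

theorem triSet_subset {S : Set V} (hS : Convex ℝ S) {p q r : V} (hp : p ∈ S) (hq : q ∈ S)
    (hr : r ∈ S) : triSet p q r ⊆ S := by
  rintro x ⟨v, w, hv, hw, hvw, rfl⟩
  have := hS.sum_mem (t := Finset.univ) (w := ![1 - v - w, v, w]) (z := ![p, q, r])
    (by intro i _; fin_cases i <;> simp <;> linarith) (by simp [Fin.sum_univ_three]; ring)
    (by intro i _; fin_cases i <;> simpa)
  convert this using 1
  simp [Fin.sum_univ_three]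
  module

theorem tri_swap (p q r : V) : tri p q r = tri p r q := by
  apply ConvexBody.ext
  apply Set.Subset.antisymm <;>
  exact triSet_subset (convex_triSet _ _ _) (left_mem_triSet _ _ _) (right_mem_triSet _ _ _)
      (mid_mem_triSet _ _ _)

theorem tri_rotate (p q r : V) : tri p q r = tri q r p := by
  apply ConvexBody.ext
  apply Set.Subset.antisymm
  · exact triSet_subset (convex_triSet _ _ _) (right_mem_triSet _ _ _) (left_mem_triSet _ _ _)
      (mid_mem_triSet _ _ _)
  · exact triSet_subset (convex_triSet _ _ _) (mid_mem_triSet _ _ _) (right_mem_triSet _ _ _)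
      (left_mem_triSet _ _ _)

theorem mapCLM_tri (f : V →L[ℝ] V') (p q r : V) :
    (tri p q r).mapCLM f = tri (f p) (f q) (f r) := by
  apply ConvexBody.ext
  ext x
  constructor
  · rintro ⟨_, ⟨v, w, hv, hw, hvw, rfl⟩, rfl⟩
    exact ⟨v, w, hv, hw, hvw, by simp⟩
  · rintro ⟨v, w, hv, hw, hvw, rfl⟩
    exact ⟨_, ⟨v, w, hv, hw, hvw, rfl⟩, by simp⟩

theorem translate_tri (p q r x : V) :
    (tri p q r).translate x = tri (x + p) (x + q) (x + r) := by
  apply ConvexBody.ext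
  ext y
  constructor
  · rintro ⟨_, ⟨v, w, hv, hw, hvw, rfl⟩, rfl⟩
    exact ⟨v, w, hv, hw, hvw, by simp [add_assoc]⟩
  · rintro ⟨v, w, hv, hw, hvw, rfl⟩
    exact ⟨_, ⟨v, w, hv, hw, hvw, rfl⟩, by simp [add_assoc]⟩

/-- The segment with endpoints `p`, `q` as a convex body. -/
def segB (p q : V) : ConvexBody V :=
  ⟨segment ℝ p q, convex_segment p q, by
    rw [segment_eq_image]
    exact isCompact_Icc.image (by fun_prop), ⟨p, left_mem_segment ℝ p q⟩⟩

theorem coe_segB (p q : V) : (segB p q : Set V) = segment ℝ p q := rfl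

theorem segB_comm (p q : V) : segB p q = segB q p := ConvexBody.ext (segment_symm ℝ p q)

theorem tri_self_right (p q : V) : tri p q q = segB p q := by
  apply ConvexBody.ext
  apply Set.Subset.antisymm
  · exact triSet_subset (convex_segment p q) (left_mem_segment ℝ _ _) (right_mem_segment ℝ _ _)
      (right_mem_segment ℝ _ _)
  · exact (convex_triSet p q q).segment_subset (left_mem_triSet _ _ _) (mid_mem_triSet _ _ _)

theorem mapCLM_segB (f : V →L[ℝ] V') (p q : V) : (segB p q).mapCLM f = segB (f p) (f q) := by
  rw [← tri_self_right, mapCLM_tri, tri_self_right]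

theorem translate_segB (p q x : V) : (segB p q).translate x = segB (x + p) (x + q) := by
  rw [← tri_self_right, translate_tri, tri_self_right]

theorem segB_self_translate (p q : V) : segB p q = (segB 0 (q - p)).translate p := by
  rw [translate_segB]; simp

theorem add_segB_zero_self (K : ConvexBody V) : K + segB 0 0 = K := by
  apply ConvexBody.ext
  rw [ConvexBody.coe_add, coe_segB, segment_same]
  simp

theorem hSupp_tri (p q r : V) (l : V →L[ℝ] ℝ) :
    hSupp (tri p q r) l = max (l p) (max (l q) (l r)) := by
  apply le_antisymm
  · refine ConvexBody.hSupp_le _ fun x hx => ?_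
    have : triSet p q r ⊆ {x | l x ≤ max (l p) (max (l q) (l r))} :=
      triSet_subset (convex_le_clm l _) (by simp) (by simp) (by simp)
    exact this hx
  · refine max_le ?_ (max_le ?_ ?_)
    · exact ConvexBody.le_hSupp _ l.continuous (left_mem_triSet p q r)
    · exact ConvexBody.le_hSupp _ l.continuous (mid_mem_triSet p q r)
    · exact ConvexBody.le_hSupp _ l.continuous (right_mem_triSet p q r)

theorem hSupp_segB (p q : V) (l : V →L[ℝ] ℝ) : hSupp (segB p q) l = max (l p) (l q) := by
  rw [← tri_self_right, hSupp_tri, max_self]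

theorem ConvexBody.translate_add (K L : ConvexBody V) (x : V) :
    (K + L).translate x = K.translate x + L := by
  apply ConvexBody.ext
  simp only [ConvexBody.coe_translate, ConvexBody.coe_add]
  change (x +ᵥ ((K : Set V) + L)) = (x +ᵥ (K : Set V)) + L
  rw [vadd_add_assoc]

theorem ConvexBody.add_translate (K L : ConvexBody V) (x : V) :
    (K + L).translate x = K + L.translate x := by
  rw [add_comm, ConvexBody.translate_add, add_comm]

/-- If a class of sets is stable under sections and under one side of each cut, valuations vanishing
on it vanish on its polyhedral pieces. -/
theorem bext_polyh_eq_zero {D : ConvexBody V → ℝ} (hv : IsValuation D) (𝒯 : Set (Set V))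
    (hco : ∀ T ∈ 𝒯, Convex ℝ T ∧ IsCompact T)
    (h0 : ∀ T ∈ 𝒯, bext D T = 0)
    (hs : ∀ T ∈ 𝒯, ∀ (l : V →L[ℝ] ℝ) (c : ℝ), T ∩ {x | l x = c} ∈ 𝒯)
    (hc : ∀ T ∈ 𝒯, ∀ (l : V →L[ℝ] ℝ) (c : ℝ),
      T ∩ {x | l x ≤ c} ∈ 𝒯 ∨ T ∩ {x | c ≤ l x} ∈ 𝒯)
    (P : List ((V →L[ℝ] ℝ) × ℝ)) : ∀ T ∈ 𝒯, bext D (T ∩ polyh P) = 0 := by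
  induction P with
  | nil => intro T hT; rw [polyh_nil, Set.inter_univ]; exact h0 T hT
  | cons p P ih =>
    intro T hT
    rw [polyh_cons]
    have hcut := bext_cut hv ((hco T hT).1.inter (convex_polyh P))
      ((hco T hT).2.inter_right (isClosed_polyh P)) p.1 p.2
    rw [ih T hT] at hcut
    have e1 : ∀ A : Set V, T ∩ polyh P ∩ A = T ∩ A ∩ polyh P := fun A => Set.inter_right_comm _ _ _
    rw [e1, e1, e1, ih _ (hs T hT p.1 p.2)] at hcut
    rw [← Set.inter_assoc]
    rcases hc T hT p.1 p.2 with h | h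
    · exact ih _ h
    · rw [ih _ h] at hcut
      linarith

theorem triSet_cut {p q r : V} {l : V →L[ℝ] ℝ} {c : ℝ} (hp : l p < c) (hq : c ≤ l q)
    (hr : c ≤ l r) : ∃ q' r', triSet p q r ∩ {x | l x ≤ c} = triSet p q' r' := by
  have hq' : 0 < l q - l p := by linarith
  have hr' : 0 < l r - l p := by linarith
  set s := (c - l p) / (l q - l p) with hs
  set t := (c - l p) / (l r - l p) with ht
  have hs0 : 0 < s := div_pos (by linarith) hq'
  have ht0 : 0 < t := div_pos (by linarith) hr'
  have hs1 : s ≤ 1 := (div_le_one hq').2 (by linarith)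
  have ht1 : t ≤ 1 := (div_le_one hr').2 (by linarith)
  have es : s * (l q - l p) = c - l p := div_mul_cancel₀ _ hq'.ne'
  have et : t * (l r - l p) = c - l p := div_mul_cancel₀ _ hr'.ne'
  refine ⟨p + s • (q - p), p + t • (r - p), ?_⟩
  apply Set.Subset.antisymm
  · rintro x ⟨⟨v, w, hv, hw, hvw, rfl⟩, hx⟩
    refine ⟨v / s, w / t, by positivity, by positivity, ?_, ?_⟩
    · simp only [Set.mem_ofPred_eq, map_add, map_smul, map_sub, smul_eq_mul] at hx
      have : v / s * (c - l p) + w / t * (c - l p) ≤ c - l p := by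
        nth_rw 1 [← es]; rw [← et]
        have h1 : v / s * (s * (l q - l p)) = v * (l q - l p) := by field_simp
        have h2 : w / t * (t * (l r - l p)) = w * (l r - l p) := by field_simp
        rw [h1, h2, et]; linarith
      have hcp : 0 < c - l p := by linarith
      rw [← add_mul] at this
      nlinarith
    · rw [add_sub_cancel_left, add_sub_cancel_left, smul_smul, smul_smul,
        div_mul_cancel₀ _ hs0.ne', div_mul_cancel₀ _ ht0.ne']
  · apply triSet_subset ((convex_triSet p q r).inter (convex_le_clm l c))
    · exact ⟨left_mem_triSet _ _ _, hp.le⟩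
    · refine ⟨⟨s, 0, hs0.le, le_rfl, by linarith, by simp⟩, ?_⟩
      simp only [Set.mem_ofPred_eq, map_add, map_smul, map_sub, smul_eq_mul]
      linarith
    · refine ⟨⟨0, t, le_rfl, ht0.le, by linarith, by simp⟩, ?_⟩
      simp only [Set.mem_ofPred_eq, map_add, map_smul, map_sub, smul_eq_mul]
      linarith

/-- Sets which are empty or a triangle. -/
def IsTri (T : Set V) : Prop := T = ∅ ∨ ∃ p q r, T = triSet p q r

theorem triSet_rotate (p q r : V) : triSet p q r = triSet q r p :=
  congrArg (fun K : ConvexBody V => (K : Set V)) (tri_rotate p q r)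

theorem isTri_cut (p q r : V) (l : V →L[ℝ] ℝ) (c : ℝ) :
    IsTri (triSet p q r ∩ {x | l x ≤ c}) ∨ IsTri (triSet p q r ∩ {x | c ≤ l x}) := by
  have up : ∀ p q r : V, c ≤ l q → c ≤ l r → IsTri (triSet p q r ∩ {x | l x ≤ c}) ∨
      IsTri (triSet p q r ∩ {x | c ≤ l x}) := by
    intro p q r hq hr
    by_cases hp : l p < c
    · obtain ⟨q', r', h⟩ := triSet_cut hp hq hr
      exact Or.inl (Or.inr ⟨_, _, _, h⟩)
    · refine Or.inr (Or.inr ⟨p, q, r, Set.inter_eq_left.2 ?_⟩)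
      exact triSet_subset (convex_ge_clm l c) (not_lt.1 hp) hq hr
  have dn : ∀ p q r : V, l q ≤ c → l r ≤ c → IsTri (triSet p q r ∩ {x | l x ≤ c}) ∨
      IsTri (triSet p q r ∩ {x | c ≤ l x}) := by
    intro p q r hq hr
    by_cases hp : c < l p
    · obtain ⟨q', r', h⟩ := triSet_cut (l := -l) (c := -c) (p := p) (q := q) (r := r)
        (by simpa using hp) (by simpa using hq) (by simpa using hr)
      refine Or.inr (Or.inr ⟨p, q', r', ?_⟩)
      rw [← h]; simp
    · refine Or.inl (Or.inr ⟨p, q, r, Set.inter_eq_left.2 ?_⟩)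
      exact triSet_subset (convex_le_clm l c) (not_lt.1 hp) hq hr
  rcases le_total c (l p) with hp | hp <;> rcases le_total c (l q) with hq | hq <;>
    rcases le_total c (l r) with hr | hr
  · exact up _ _ _ hq hr
  · rw [triSet_rotate, triSet_rotate]; exact up _ _ _ hp hq
  · rw [triSet_rotate]; exact up _ _ _ hr hp
  · exact dn _ _ _ hq hr
  · exact up _ _ _ hq hr
  · rw [triSet_rotate]; exact dn _ _ _ hr hp
  · rw [triSet_rotate, triSet_rotate]; exact dn _ _ _ hp hq
  · exact dn _ _ _ hq hr

end Simplices

section Plane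

theorem clm_apply_complex (l : ℂ →L[ℝ] ℝ) (x : ℂ) : l x = x.re * l 1 + x.im * l Complex.I := by
  conv_lhs => rw [← Complex.re_add_im x]
  have : ((x.re : ℂ) + x.im * Complex.I) = x.re • (1 : ℂ) + x.im • Complex.I := by simp
  rw [this, map_add, map_smul, map_smul, smul_eq_mul, smul_eq_mul]

theorem eq_segment_of_subset_line {S : Set ℂ} (hS : Convex ℝ S) (hc : IsCompact S)
    (hne : S.Nonempty) {l : ℂ →L[ℝ] ℝ} (hl : l ≠ 0) {c : ℝ} (h : S ⊆ {x | l x = c}) :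
    ∃ p q, S = segment ℝ p q := by
  let m : ℂ →L[ℝ] ℝ := l 1 • Complex.imCLM - l Complex.I • Complex.reCLM
  have hm : ∀ x, m x = l 1 * x.im - l Complex.I * x.re := fun x => rfl
  have hpos : 0 < l 1 * l 1 + l Complex.I * l Complex.I := by
    rcases (add_nonneg (mul_self_nonneg (l 1)) (mul_self_nonneg (l Complex.I))).lt_or_eq with h | h
    · exact h
    · exfalso
      apply hl
      ext x
      have h1 : l 1 = 0 := by nlinarith [mul_self_nonneg (l 1), mul_self_nonneg (l Complex.I)]
      have h2 : l Complex.I = 0 := by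
        nlinarith [mul_self_nonneg (l 1), mul_self_nonneg (l Complex.I)]
      rw [clm_apply_complex, h1, h2]; simp
  have hinj : ∀ x y : ℂ, l x = l y → m x = m y → x = y := by
    intro x y h1 h2
    rw [clm_apply_complex l x, clm_apply_complex l y] at h1
    rw [hm, hm] at h2
    apply Complex.ext
    · have : (l 1 * l 1 + l Complex.I * l Complex.I) * (x.re - y.re) = 0 := by
        linear_combination l 1 * h1 - l Complex.I * h2
      have := (mul_eq_zero.1 this).resolve_left hpos.ne'
      linarith
    · have : (l 1 * l 1 + l Complex.I * l Complex.I) * (x.im - y.im) = 0 := by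
        linear_combination l Complex.I * h1 + l 1 * h2
      have := (mul_eq_zero.1 this).resolve_left hpos.ne'
      linarith
  obtain ⟨p, hp, hpm⟩ := hc.exists_isMinOn hne m.continuous.continuousOn
  obtain ⟨q, hq, hqm⟩ := hc.exists_isMaxOn hne m.continuous.continuousOn
  refine ⟨p, q, Set.Subset.antisymm (fun x hx => ?_) (hS.segment_subset hp hq)⟩
  have hx1 : m p ≤ m x := hpm hx
  have hx2 : m x ≤ m q := hqm hx
  have hx3 : m x ∈ segment ℝ (m p) (m q) := by
    rw [segment_eq_Icc (hx1.trans hx2)]; exact ⟨hx1, hx2⟩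
  obtain ⟨s, t, hs, ht, hst, he⟩ := hx3
  have : x = s • p + t • q := by
    apply hinj
    · rw [h hx, map_add, map_smul, map_smul, h hp, h hq, ← add_smul, hst, one_smul]
    · rw [← he, map_add, map_smul, map_smul]
  exact ⟨s, t, hs, ht, hst, this.symm⟩

theorem isTri_segment {V : Type*} [NormedAddCommGroup V] [NormedSpace ℝ V] (p q : V) :
    IsTri (segment ℝ p q) :=
  Or.inr ⟨p, q, q, congrArg (fun K : ConvexBody V => (K : Set V)) (tri_self_right p q).symm⟩

theorem isTri_section {T : Set ℂ} (hT : IsTri T) (l : ℂ →L[ℝ] ℝ) (c : ℝ) :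
    IsTri (T ∩ {x | l x = c}) := by
  by_cases hne : (T ∩ {x | l x = c}).Nonempty
  swap
  · exact Or.inl (Set.not_nonempty_iff_eq_empty.1 hne)
  obtain rfl | ⟨p, q, r, rfl⟩ := hT
  · simp at hne
  by_cases hl : l = 0
  · have : triSet p q r ∩ {x | l x = c} = triSet p q r := by
      refine Set.inter_eq_left.2 fun x _ => ?_
      obtain ⟨y, -, hy⟩ := hne
      simp [hl] at hy ⊢
      exact hy
    rw [this]; exact Or.inr ⟨_, _, _, rfl⟩
  · have hcl : IsClosed {x | l x = c} := isClosed_eq l.continuous continuous_const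
    have hco : Convex ℝ {x | l x = c} := convex_hyperplane l.toLinearMap.isLinear c
    obtain ⟨a, b, h⟩ := eq_segment_of_subset_line ((convex_triSet p q r).inter hco)
      ((isCompact_triSet p q r).inter_right hcl) hne hl Set.inter_subset_right
    rw [h]; exact isTri_segment a b

theorem exists_tri_superset {S : Set ℂ} (hS : Bornology.IsBounded S) :
    ∃ p q r, S ⊆ triSet p q r := by
  obtain ⟨R, hR⟩ := hS.exists_norm_le
  set M := max R 1
  have hM : 1 ≤ M := le_max_right _ _
  refine ⟨⟨-M, -M⟩, ⟨3 * M, -M⟩, ⟨-M, 3 * M⟩, fun x hx => ?_⟩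
  have h1 : ‖x‖ ≤ M := (hR x hx).trans (le_max_left _ _)
  have h2 := abs_le.1 ((Complex.abs_re_le_norm x).trans h1)
  have h3 := abs_le.1 ((Complex.abs_im_le_norm x).trans h1)
  have h4 : (4 * M) ≠ 0 := by linarith
  obtain ⟨v, hv⟩ : ∃ v, v * (4 * M) = x.re + M := ⟨_, div_mul_cancel₀ _ h4⟩
  obtain ⟨w, hw⟩ : ∃ w, w * (4 * M) = x.im + M := ⟨_, div_mul_cancel₀ _ h4⟩
  refine ⟨v, w, by nlinarith, by nlinarith, by nlinarith, ?_⟩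
  apply Complex.ext
  · simp; linarith
  · simp; linarith

theorem eq_zero_of_tri {D : ConvexBody ℂ → ℝ} (hv : IsValuation D) (hc : Continuous D)
    (h : ∀ p q r, D (tri p q r) = 0) (L : ConvexBody ℂ) : D L = 0 := by
  obtain ⟨p, q, r, hpqr⟩ := exists_tri_superset L.isBounded
  refine eq_zero_of_bext_polyh hc (T := tri p q r) hpqr fun P => ?_
  refine bext_polyh_eq_zero hv {T | IsTri T} ?_ ?_ ?_ ?_ P _ (Or.inr ⟨p, q, r, rfl⟩)
  · rintro T (rfl | ⟨p, q, r, rfl⟩)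
    · exact ⟨convex_empty, isCompact_empty⟩
    · exact ⟨convex_triSet _ _ _, isCompact_triSet _ _ _⟩
  · rintro T (rfl | ⟨p, q, r, rfl⟩)
    · exact bext_empty D
    · rw [← coe_tri, bext_coe, h]
  · intro T hT l c; exact isTri_section hT l c
  · rintro T (rfl | ⟨p, q, r, rfl⟩) l c
    · left; left; simp
    · exact isTri_cut p q r l c

end Plane

section PlaneVolume

/-- The real symplectic form `Im (conj x * a)` on `ℂ`. -/
def om (x a : ℂ) : ℝ := x.re * a.im - x.im * a.re

/-- The functional `om · a`. -/
def omL (a : ℂ) : ℂ →L[ℝ] ℝ := a.im • Complex.reCLM - a.re • Complex.imCLM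

theorem omL_apply (a x : ℂ) : omL a x = om x a := by
  simp [omL, om]; ring

theorem exists_eq_omL (l : ℂ →L[ℝ] ℝ) : ∃ a, l = omL a :=
  ⟨⟨-l Complex.I, l 1⟩, by ext x; rw [clm_apply_complex l, omL_apply]; simp [om]⟩

theorem om_add_left (x y a : ℂ) : om (x + y) a = om x a + om y a := by simp [om]; ring
theorem om_add_right (x a b : ℂ) : om x (a + b) = om x a + om x b := by simp [om]; ring
theorem om_neg_left (x a : ℂ) : om (-x) a = -om x a := by simp [om]; ring
theorem om_neg_right (x a : ℂ) : om x (-a) = -om x a := by simp [om]; ring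
theorem om_sub_left (x y a : ℂ) : om (x - y) a = om x a - om y a := by simp [om]; ring
theorem om_sub_right (x a b : ℂ) : om x (a - b) = om x a - om x b := by simp [om]; ring
theorem om_smul_left (t : ℝ) (x a : ℂ) : om (t • x) a = t * om x a := by simp [om]; ring
theorem om_smul_right (t : ℝ) (x a : ℂ) : om x (t • a) = t * om x a := by simp [om]; ring
theorem om_self (x : ℂ) : om x x = 0 := by simp [om]; ring
theorem om_zero_left (x : ℂ) : om 0 x = 0 := by simp [om]
theorem om_zero_right (x : ℂ) : om x 0 = 0 := by simp [om]
theorem om_swap (x y : ℂ) : om y x = -om x y := by simp [om]; ring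

/-- The support function in symplectic coordinates. -/
def hs (M : ConvexBody ℂ) (a : ℂ) : ℝ := hSupp M (omL a)

theorem om_le_hs (M : ConvexBody ℂ) {x : ℂ} (hx : x ∈ (M : Set ℂ)) (a : ℂ) : om x a ≤ hs M a := by
  rw [← omL_apply]; exact M.le_hSupp (omL a).continuous hx

theorem hs_le (M : ConvexBody ℂ) {a : ℂ} {c : ℝ} (h : ∀ x ∈ (M : Set ℂ), om x a ≤ c) :
    hs M a ≤ c := M.hSupp_le fun x hx => by rw [omL_apply]; exact h x hx

theorem exists_hs (M : ConvexBody ℂ) (a : ℂ) : ∃ x ∈ (M : Set ℂ), hs M a = om x a := by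
  obtain ⟨x, hx, h⟩ := M.exists_hSupp (omL a).continuous
  exact ⟨x, hx, by rw [hs, h, omL_apply]⟩

theorem hs_smul (M : ConvexBody ℂ) {t : ℝ} (ht : 0 ≤ t) (a : ℂ) : hs M (t • a) = t * hs M a := by
  apply le_antisymm
  · refine hs_le M fun x hx => ?_
    rw [om_smul_right]
    exact mul_le_mul_of_nonneg_left (om_le_hs M hx a) ht
  · obtain ⟨x, hx, h⟩ := exists_hs M a
    rw [h, ← om_smul_right]
    exact om_le_hs M hx _

theorem hs_add_le (M : ConvexBody ℂ) (a b : ℂ) : hs M (a + b) ≤ hs M a + hs M b :=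
  hs_le M fun x hx => by
    rw [om_add_right]; exact add_le_add (om_le_hs M hx a) (om_le_hs M hx b)

theorem hs_add (M N : ConvexBody ℂ) (a : ℂ) : hs (M + N) a = hs M a + hs N a :=
  ConvexBody.hSupp_add M N _

theorem hs_smul_body (M : ConvexBody ℂ) {t : ℝ} (ht : 0 ≤ t) (a : ℂ) : hs (t • M) a = t * hs M a :=
  ConvexBody.hSupp_smul ht M _

theorem hs_translate (M : ConvexBody ℂ) (x a : ℂ) : hs (M.translate x) a = om x a + hs M a := by
  rw [hs, ConvexBody.hSupp_translate, omL_apply]; rfl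

theorem hs_segB (p q a : ℂ) : hs (segB p q) a = max (om p a) (om q a) := by
  rw [hs, hSupp_segB, omL_apply, omL_apply]

theorem hs_tri (p q r a : ℂ) : hs (tri p q r) a = max (om p a) (max (om q a) (om r a)) := by
  rw [hs, hSupp_tri, omL_apply, omL_apply, omL_apply]

theorem hs_zero (M : ConvexBody ℂ) : hs M 0 = 0 := by
  have := hs_smul M le_rfl (0 : ℂ)
  simpa using this

theorem continuous_hs (a : ℂ) : Continuous fun M => hs M a := ConvexBody.continuous_hSupp _

theorem hs_isValuation (a : ℂ) : IsValuation fun M => hs M a := ConvexBody.hSupp_isValuation _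

theorem eq_of_hs_eq {K L : ConvexBody ℂ} (h : ∀ a, hs K a = hs L a) : K = L :=
  ConvexBody.eq_of_hSupp_eq fun l => by
    obtain ⟨a, rfl⟩ := exists_eq_omL l
    exact h a

theorem subset_of_hs_le {K L : ConvexBody ℂ} (h : ∀ a, hs K a ≤ hs L a) : (K : Set ℂ) ⊆ L :=
  ConvexBody.subset_of_hSupp_le fun l => by
    obtain ⟨a, rfl⟩ := exists_eq_omL l
    exact h a

/-- The area of a planar body. -/
def vl (K : ConvexBody ℂ) : ℝ := volume.real (K : Set ℂ)

theorem vl_mono {K L : ConvexBody ℂ} (h : (K : Set ℂ) ⊆ L) : vl K ≤ vl L :=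
  measureReal_mono h L.isCompact.measure_ne_top

theorem volume_real_translate {V : Type*} [NormedAddCommGroup V] [NormedSpace ℝ V]
    [MeasurableSpace V] [BorelSpace V] (μ : Measure V) [μ.IsAddLeftInvariant]
    (K : ConvexBody V) (x : V) : μ.real (K.translate x : Set V) = μ.real (K : Set V) := by
  rw [ConvexBody.coe_translate, Set.image_add_left, measureReal_def, measure_preimage_add]
  rfl

theorem vl_translate (K : ConvexBody ℂ) (x : ℂ) : vl (K.translate x) = vl K :=
  volume_real_translate volume K x

theorem vl_smul (t : ℝ) (K : ConvexBody ℂ) : vl (t • K) = t ^ 2 * vl K := by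
  rw [vl, ConvexBody.coe_smul, measureReal_def, Measure.addHaar_smul, Complex.finrank_real_complex,
    ENNReal.toReal_mul, ENNReal.toReal_ofReal (abs_nonneg _), abs_of_nonneg (by positivity)]
  rfl

theorem continuous_vl : Continuous vl := ConvexBody.continuous_volume volume

theorem vl_isValuation : IsValuation vl := volume_isValuation volume

/-- Multiplication by a complex number as a real-linear map. -/
def mulC (c : ℂ) : ℂ →L[ℝ] ℂ := LinearMap.toContinuousLinearMap (LinearMap.mulLeft ℝ c)

theorem mulC_apply (c x : ℂ) : mulC c x = c * x := rfl

theorem vl_mulC (c : ℂ) (K : ConvexBody ℂ) : vl (K.mapCLM (mulC c)) = ‖c‖ ^ 2 * vl K := by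
  have h : LinearMap.det (LinearMap.mulLeft ℝ c) = ‖c‖ ^ 2 := by
    have := Algebra.norm_apply ℝ c
    rw [Algebra.norm_complex_apply, Complex.normSq_eq_norm_sq] at this
    exact this.symm
  have h2 := Measure.addHaar_image_linearMap (volume : Measure ℂ) (LinearMap.mulLeft ℝ c) (K : Set
    ℂ)
  rw [h] at h2
  rw [vl, measureReal_def, ConvexBody.coe_mapCLM]
  change (volume ((LinearMap.mulLeft ℝ c) '' (K : Set ℂ))).toReal = _
  rw [h2, ENNReal.toReal_mul, ENNReal.toReal_ofReal (abs_nonneg _), abs_of_nonneg (by positivity)]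
  rfl

theorem ConvexBody.exists_eq_Icc (K : ConvexBody ℝ) : ∃ a b : ℝ, a ≤ b ∧ (K : Set ℝ) = Set.Icc a b
    := by
  have h := eq_Icc_of_connected_compact ⟨K.nonempty, K.convex.isPreconnected⟩ K.isCompact
  refine ⟨_, _, ?_, h⟩
  have := K.nonempty
  rw [h, Set.nonempty_Icc] at this
  exact this

theorem volume_fiber (S : Set ℂ) (hS : MeasurableSet S) :
    volume S = ∫⁻ y : ℝ, volume {x : ℝ | (⟨x, y⟩ : ℂ) ∈ S} := by
  have h := Complex.volume_preserving_equiv_real_prod.symm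
    Complex.measurableEquivRealProd
  rw [← h.measure_preimage hS.nullMeasurableSet]
  rw [show (volume : Measure (ℝ × ℝ)) = (volume : Measure ℝ).prod volume from rfl,
    Measure.prod_apply_symm (Complex.measurableEquivRealProd.symm.measurable hS)]
  rfl

theorem fiber_convex_compact (K : ConvexBody ℂ) (y : ℝ) :
    Convex ℝ {x : ℝ | (⟨x, y⟩ : ℂ) ∈ (K : Set ℂ)} ∧
      IsCompact {x : ℝ | (⟨x, y⟩ : ℂ) ∈ (K : Set ℂ)} := by
  constructor
  · intro x hx z hz s t hs ht hst
    have := K.convex hx hz hs ht hst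
    have e : (⟨s • x + t • z, y⟩ : ℂ) = s • (⟨x, y⟩ : ℂ) + t • (⟨z, y⟩ : ℂ) := by
      apply Complex.ext
      · simp
      · simp; rw [← add_mul, hst, one_mul]
    rw [Set.mem_ofPred_eq, e]
    exact this
  · have : {x : ℝ | (⟨x, y⟩ : ℂ) ∈ (K : Set ℂ)} ⊆
        Complex.re '' (K : Set ℂ) := fun x hx => ⟨_, hx, rfl⟩
    refine (K.isCompact.image Complex.continuous_re).of_isClosed_subset ?_ this
    refine K.isClosed.preimage ?_
    have e : (fun x : ℝ => (⟨x, y⟩ : ℂ)) = fun x : ℝ => (x : ℂ) + y * Complex.I := by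
      ext x; exact (Complex.mk_eq_add_mul_I x y)
    rw [e]; fun_prop

theorem vl_add_segB_one (M : ConvexBody ℂ) :
    vl (M + segB 0 1) = vl M + hs M 1 + hs M (-1) := by
  obtain ⟨a, b, hab, him⟩ := (M.mapCLM Complex.imCLM).exists_eq_Icc
  have hfib : ∀ y : ℝ, volume {x : ℝ | (⟨x, y⟩ : ℂ) ∈ ((M + segB 0 1 : ConvexBody ℂ) : Set ℂ)} =
      volume {x : ℝ | (⟨x, y⟩ : ℂ) ∈ (M : Set ℂ)} + (Set.Icc a b).indicator (fun _ => 1) y := by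
    intro y
    by_cases hy : {x : ℝ | (⟨x, y⟩ : ℂ) ∈ (M : Set ℂ)}.Nonempty
    · have hyI : y ∈ Set.Icc a b := by
        rw [← him]
        obtain ⟨x, hx⟩ := hy
        exact ⟨_, hx, rfl⟩
      obtain ⟨p, q, hpq, he⟩ := ConvexBody.exists_eq_Icc
        ⟨_, (fiber_convex_compact M y).1, (fiber_convex_compact M y).2, hy⟩
      change {x : ℝ | (⟨x, y⟩ : ℂ) ∈ (M : Set ℂ)} = Set.Icc p q at he
      have hmem : ∀ x : ℝ, (⟨x, y⟩ : ℂ) ∈ (M : Set ℂ) ↔ x ∈ Set.Icc p q := fun x => by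
        rw [← he]; rfl
      have e2 : {x : ℝ | (⟨x, y⟩ : ℂ) ∈ ((M + segB 0 1 : ConvexBody ℂ) : Set ℂ)} =
          Set.Icc p (q + 1) := by
        ext x
        rw [Set.mem_ofPred_eq, ConvexBody.coe_add, Set.mem_add]
        constructor
        · rintro ⟨m, hm, s, ⟨u, v, hu, hv, huv, rfl⟩, h⟩
          have h1 := congrArg Complex.re h
          have h2 := congrArg Complex.im h
          simp at h1 h2
          have : m = ⟨m.re, y⟩ := Complex.ext rfl h2
          rw [this, hmem] at hm
          exact ⟨by linarith [hm.1], by linarith [hm.2]⟩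
        · rintro ⟨h1, h2⟩
          refine ⟨⟨max p (x - 1), y⟩, ?_, ((x - max p (x - 1) : ℝ) : ℂ), ?_, ?_⟩
          · rw [hmem]; exact ⟨le_max_left _ _, max_le hpq (by linarith)⟩
          · refine ⟨1 - (x - max p (x - 1)), x - max p (x - 1), ?_, ?_, by ring, ?_⟩
            · linarith [le_max_right p (x - 1)]
            · have := max_le h1 (show x - 1 ≤ x by linarith); linarith
            · simp
          · apply Complex.ext <;> simp
      rw [e2, he, Set.indicator_of_mem hyI, Real.volume_Icc, Real.volume_Icc,
        ← ENNReal.ofReal_one, ← ENNReal.ofReal_add (by linarith) (by norm_num)]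
      congr 1; ring
    · have hyI : y ∉ Set.Icc a b := by
        rw [← him]
        rintro ⟨z, hz, rfl⟩
        exact hy ⟨z.re, hz⟩
      have e2 : {x : ℝ | (⟨x, y⟩ : ℂ) ∈ ((M + segB 0 1 : ConvexBody ℂ) : Set ℂ)} = ∅ := by
        rw [Set.eq_empty_iff_forall_notMem]
        intro x hx
        rw [Set.mem_ofPred_eq, ConvexBody.coe_add, Set.mem_add] at hx
        obtain ⟨m, hm, s, ⟨u, v, hu, hv, huv, rfl⟩, h⟩ := hx
        have h2 := congrArg Complex.im h
        simp at h2
        exact hy ⟨m.re, by rw [Set.mem_ofPred_eq, ← h2]; exact hm⟩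
      rw [e2, Set.not_nonempty_iff_eq_empty.1 hy, Set.indicator_of_notMem hyI]; simp
  have hv : volume ((M + segB 0 1 : ConvexBody ℂ) : Set ℂ) =
      volume (M : Set ℂ) + ENNReal.ofReal (b - a) := by
    rw [volume_fiber _ (ConvexBody.isClosed _).measurableSet, volume_fiber _
      M.isClosed.measurableSet]
    simp_rw [hfib]
    rw [lintegral_add_right _ (measurable_const.indicator measurableSet_Icc),
      lintegral_indicator measurableSet_Icc]
    simp
  have h1 : hs M 1 = -a := by
    apply le_antisymm
    · refine hs_le M fun x hx => ?_
      have : x.im ∈ Set.Icc a b := by rw [← him]; exact ⟨x, hx, rfl⟩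
      simp [om]; exact this.1
    · obtain ⟨x, hx, hxa⟩ : a ∈ ((M.mapCLM Complex.imCLM : ConvexBody ℝ) : Set ℝ) := by
        rw [him]; exact ⟨le_rfl, hab⟩
      have := om_le_hs M hx 1
      simp [om] at this hxa
      linarith
  have h2 : hs M (-1) = b := by
    apply le_antisymm
    · refine hs_le M fun x hx => ?_
      have : x.im ∈ Set.Icc a b := by rw [← him]; exact ⟨x, hx, rfl⟩
      simp [om]; exact this.2
    · obtain ⟨x, hx, hxa⟩ : b ∈ ((M.mapCLM Complex.imCLM : ConvexBody ℝ) : Set ℝ) := by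
        rw [him]; exact ⟨hab, le_rfl⟩
      have := om_le_hs M hx (-1)
      simp [om] at this hxa
      linarith
  rw [h1, h2, vl, vl, measureReal_def, measureReal_def, hv,
    ENNReal.toReal_add M.isCompact.measure_ne_top ENNReal.ofReal_ne_top,
    ENNReal.toReal_ofReal (by linarith)]
  ring

theorem vl_add_segB (M : ConvexBody ℂ) (c : ℂ) :
    vl (M + segB 0 c) = vl M + hs M c + hs M (-c) := by
  by_cases hc : c = 0
  · subst hc
    rw [add_segB_zero_self, neg_zero, hs_zero]; ring
  · have hM : (M.mapCLM (mulC c⁻¹)).mapCLM (mulC c) = M := by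
      apply ConvexBody.ext
      rw [ConvexBody.mapCLM_mapCLM, ConvexBody.coe_mapCLM]
      convert Set.image_id (M : Set ℂ) using 2
      simp [mulC_apply, hc]
    set M' := M.mapCLM (mulC c⁻¹)
    have hseg : segB 0 c = (segB 0 1).mapCLM (mulC c) := by
      rw [mapCLM_segB]; simp [mulC_apply]
    have hhs : ∀ s : ℝ, hs (M'.mapCLM (mulC c)) (s • c) = ‖c‖ ^ 2 * hs M' (s • 1) := by
      intro s
      rw [← hs_smul _ (by positivity), hs, ConvexBody.hSupp_mapCLM, hs]
      congr 1
      ext x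
      rw [omL_apply, omL_apply, mulC_apply, ← Complex.normSq_eq_norm_sq, Complex.normSq_apply]
      simp [om]; ring
    have h1 := hhs 1
    have h2 := hhs (-1)
    rw [one_smul, one_smul] at h1
    rw [neg_one_smul, neg_one_smul] at h2
    rw [← hM, hseg, ← ConvexBody.mapCLM_add, vl_mulC, vl_mulC, vl_add_segB_one, h1, h2]
    ring

end PlaneVolume

section Staircase

/-- The real-linear map sending `1` to `a` and `I` to `b`. -/
def pmap (a b : ℂ) : ℂ →L[ℝ] ℂ := Complex.reCLM.smulRight a + Complex.imCLM.smulRight b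

theorem pmap_apply (a b x : ℂ) : pmap a b x = x.re • a + x.im • b := rfl

theorem pmap_injective {a b : ℂ} (h : om a b ≠ 0) : Function.Injective (pmap a b) := by
  rw [injective_iff_map_eq_zero]
  intro x hx
  rw [pmap_apply] at hx
  have h1 : om (x.re • a + x.im • b) b = 0 := by rw [hx, om_zero_left]
  have h2 : om a (x.re • a + x.im • b) = 0 := by rw [hx, om_zero_right]
  rw [om_add_left, om_smul_left, om_smul_left, om_self, mul_zero, add_zero] at h1
  rw [om_add_right, om_smul_right, om_smul_right, om_self, mul_zero, zero_add] at h2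
  exact Complex.ext ((mul_eq_zero.1 h1).resolve_right h) ((mul_eq_zero.1 h2).resolve_right h)

theorem ConvexBody.mem_translate {V : Type*} [NormedAddCommGroup V] [NormedSpace ℝ V]
    (K : ConvexBody V) (x y : V) : y ∈ (K.translate x : Set V) ↔ y - x ∈ (K : Set V) := by
  rw [ConvexBody.coe_translate]
  constructor
  · rintro ⟨z, hz, rfl⟩; simpa using hz
  · intro h; exact ⟨_, h, by simp⟩

theorem mem_unit_tri {r : ℝ} (hr : 0 ≤ r) (x : ℂ) :
    x ∈ (tri 0 (r • (1 : ℂ)) (r • (1 + Complex.I)) : Set ℂ) ↔ 0 ≤ x.im ∧ x.im ≤ x.re ∧ x.re ≤ r :=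
      by
  rw [coe_tri]
  constructor
  · rintro ⟨v, w, hv, hw, hvw, rfl⟩
    simp
    refine ⟨by positivity, by positivity, by nlinarith⟩
  · rintro ⟨h1, h2, h3⟩
    rcases hr.eq_or_lt with rfl | hr
    · refine ⟨0, 0, le_rfl, le_rfl, by norm_num, ?_⟩
      apply Complex.ext <;> simp <;> linarith
    · obtain ⟨v, hv⟩ : ∃ v, v * r = x.re - x.im := ⟨_, div_mul_cancel₀ _ hr.ne'⟩
      obtain ⟨w, hw⟩ : ∃ w, w * r = x.im := ⟨_, div_mul_cancel₀ _ hr.ne'⟩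
      refine ⟨v, w, by nlinarith, by nlinarith, by nlinarith, ?_⟩
      apply Complex.ext
      · simp; linarith
      · simp; linarith

theorem mem_segB_one {r : ℝ} (hr : 0 ≤ r) (x : ℂ) :
    x ∈ (segB 0 (r • (1 : ℂ)) : Set ℂ) ↔ 0 ≤ x.re ∧ x.re ≤ r ∧ x.im = 0 := by
  rw [coe_segB]
  constructor
  · rintro ⟨v, w, hv, hw, hvw, rfl⟩
    simp
    exact ⟨by positivity, by nlinarith⟩
  · rintro ⟨h1, h2, h3⟩
    rcases hr.eq_or_lt with rfl | hr
    · refine ⟨1, 0, by norm_num, le_rfl, by norm_num, ?_⟩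
      apply Complex.ext <;> simp <;> linarith
    · obtain ⟨w, hw⟩ : ∃ w, w * r = x.re := ⟨_, div_mul_cancel₀ _ hr.ne'⟩
      refine ⟨1 - w, w, by nlinarith, by nlinarith, by ring, ?_⟩
      apply Complex.ext
      · simp; linarith
      · simp; linarith

theorem mem_segB_I {r : ℝ} (hr : 0 ≤ r) (x : ℂ) :
    x ∈ (segB 0 (r • Complex.I) : Set ℂ) ↔ 0 ≤ x.im ∧ x.im ≤ r ∧ x.re = 0 := by
  rw [coe_segB]
  constructor
  · rintro ⟨v, w, hv, hw, hvw, rfl⟩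
    simp
    exact ⟨by positivity, by nlinarith⟩
  · rintro ⟨h1, h2, h3⟩
    rcases hr.eq_or_lt with rfl | hr
    · refine ⟨1, 0, by norm_num, le_rfl, by norm_num, ?_⟩
      apply Complex.ext <;> simp <;> linarith
    · obtain ⟨w, hw⟩ : ∃ w, w * r = x.im := ⟨_, div_mul_cancel₀ _ hr.ne'⟩
      refine ⟨1 - w, w, by nlinarith, by nlinarith, by ring, ?_⟩
      apply Complex.ext
      · simp; linarith
      · simp; linarith

theorem mem_rect {s t : ℝ} (hs : 0 ≤ s) (ht : 0 ≤ t) (x : ℂ) :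
    x ∈ ((segB 0 (t • (1 : ℂ)) + segB 0 (s • Complex.I) : ConvexBody ℂ) : Set ℂ) ↔
      (0 ≤ x.re ∧ x.re ≤ t) ∧ 0 ≤ x.im ∧ x.im ≤ s := by
  rw [ConvexBody.coe_add, Set.mem_add]
  constructor
  · rintro ⟨y, hy, z, hz, rfl⟩
    rw [mem_segB_one ht] at hy
    rw [mem_segB_I hs] at hz
    simp only [Complex.add_re, Complex.add_im]
    refine ⟨⟨?_, ?_⟩, ?_, ?_⟩ <;> linarith
  · rintro ⟨⟨h1, h2⟩, h3, h4⟩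
    refine ⟨⟨x.re, 0⟩, ?_, ⟨0, x.im⟩, ?_, ?_⟩
    · rw [mem_segB_one ht]; exact ⟨h1, h2, rfl⟩
    · rw [mem_segB_I hs]; exact ⟨h3, h4, rfl⟩
    · apply Complex.ext <;> simp

theorem bext_eq_of_mem_iff {V : Type*} [NormedAddCommGroup V] [NormedSpace ℝ V]
    (φ : ConvexBody V → ℝ) {S : Set V} (K : ConvexBody V)
    (h : ∀ x, x ∈ S ↔ x ∈ (K : Set V)) : bext φ S = φ K := by
  rw [show S = (K : Set V) from Set.ext h, bext_coe]

theorem staircase_unit {χ : ConvexBody ℂ → ℝ} (hv : IsValuation χ)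
    (hT : IsTranslationInvariant χ) {s t : ℝ} (hs : 0 ≤ s) (ht : 0 ≤ t) :
    χ (tri 0 ((s + t) • (1 : ℂ)) ((s + t) • (1 + Complex.I))) =
      χ (tri 0 (s • (1 : ℂ)) (s • (1 + Complex.I))) + χ (tri 0 (t • (1 : ℂ)) (t • (1 + Complex.I)))
        +
      χ (segB 0 (t • (1 : ℂ)) + segB 0 (s • Complex.I)) - χ (segB 0 (s • Complex.I)) -
      χ (segB 0 (t • (1 : ℂ))) := by
  set T := tri 0 ((s + t) • (1 : ℂ)) ((s + t) • (1 + Complex.I)) with hTdef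
  have hmT := fun x => mem_unit_tri (add_nonneg hs ht) x
  have c1 := bext_cut hv T.convex T.isCompact Complex.reCLM s
  have c2 := bext_cut hv (T.convex.inter (convex_ge_clm Complex.reCLM s))
    (T.isCompact.inter_right (isClosed_ge_clm Complex.reCLM s)) Complex.imCLM s
  rw [bext_coe] at c1
  have e1 : bext χ ((T : Set ℂ) ∩ {x | Complex.reCLM x ≤ s}) =
      χ (tri 0 (s • (1 : ℂ)) (s • (1 + Complex.I))) := by
    apply bext_eq_of_mem_iff
    intro x
    rw [mem_unit_tri hs, Set.mem_inter_iff, hmT, Set.mem_ofPred_eq, Complex.reCLM_apply]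
    constructor
    · rintro ⟨⟨h1, h2, h3⟩, h4⟩; exact ⟨h1, h2, h4⟩
    · rintro ⟨h1, h2, h3⟩; exact ⟨⟨h1, h2, by linarith⟩, h3⟩
  have e2 : bext χ ((T : Set ℂ) ∩ {x | Complex.reCLM x = s}) = χ (segB 0 (s • Complex.I)) := by
    rw [← hT (segB 0 (s • Complex.I)) (s • (1 : ℂ))]
    apply bext_eq_of_mem_iff
    intro x
    rw [ConvexBody.mem_translate, mem_segB_I hs, Set.mem_inter_iff, hmT, Set.mem_ofPred_eq,
      Complex.reCLM_apply]
    simp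
    constructor
    · rintro ⟨⟨h1, h2, h3⟩, h4⟩; refine ⟨h1, ?_, ?_⟩ <;> linarith
    · rintro ⟨h1, h2, h3⟩; refine ⟨⟨h1, ?_, ?_⟩, ?_⟩ <;> linarith
  have e3 : bext χ ((T : Set ℂ) ∩ {x | s ≤ Complex.reCLM x} ∩ {x | Complex.imCLM x ≤ s}) =
      χ (segB 0 (t • (1 : ℂ)) + segB 0 (s • Complex.I)) := by
    rw [← hT (segB 0 (t • (1 : ℂ)) + segB 0 (s • Complex.I)) (s • (1 : ℂ))]
    apply bext_eq_of_mem_iff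
    intro x
    rw [ConvexBody.mem_translate, mem_rect hs ht, Set.mem_inter_iff, Set.mem_inter_iff, hmT,
      Set.mem_ofPred_eq, Set.mem_ofPred_eq, Complex.reCLM_apply, Complex.imCLM_apply]
    simp
    constructor
    · rintro ⟨⟨⟨h1, h2, h3⟩, h4⟩, h5⟩; refine ⟨⟨?_, ?_⟩, ?_, ?_⟩ <;> linarith
    · rintro ⟨⟨h1, h2⟩, h3, h4⟩; refine ⟨⟨⟨?_, ?_, ?_⟩, ?_⟩, ?_⟩ <;> linarith
  have e4 : bext χ ((T : Set ℂ) ∩ {x | s ≤ Complex.reCLM x} ∩ {x | s ≤ Complex.imCLM x}) =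
      χ (tri 0 (t • (1 : ℂ)) (t • (1 + Complex.I))) := by
    rw [← hT (tri 0 (t • (1 : ℂ)) (t • (1 + Complex.I))) (s • (1 + Complex.I))]
    apply bext_eq_of_mem_iff
    intro x
    rw [ConvexBody.mem_translate, mem_unit_tri ht, Set.mem_inter_iff, Set.mem_inter_iff, hmT,
      Set.mem_ofPred_eq, Set.mem_ofPred_eq, Complex.reCLM_apply, Complex.imCLM_apply]
    simp
    constructor
    · rintro ⟨⟨⟨h1, h2, h3⟩, h4⟩, h5⟩; refine ⟨?_, ?_, ?_⟩ <;> linarith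
    · rintro ⟨h1, h2, h3⟩; refine ⟨⟨⟨?_, ?_, ?_⟩, ?_⟩, ?_⟩ <;> linarith
  have e5 : bext χ ((T : Set ℂ) ∩ {x | s ≤ Complex.reCLM x} ∩ {x | Complex.imCLM x = s}) =
      χ (segB 0 (t • (1 : ℂ))) := by
    rw [← hT (segB 0 (t • (1 : ℂ))) (s • (1 + Complex.I))]
    apply bext_eq_of_mem_iff
    intro x
    rw [ConvexBody.mem_translate, mem_segB_one ht, Set.mem_inter_iff, Set.mem_inter_iff, hmT,
      Set.mem_ofPred_eq, Set.mem_ofPred_eq, Complex.reCLM_apply, Complex.imCLM_apply]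
    simp
    constructor
    · rintro ⟨⟨⟨h1, h2, h3⟩, h4⟩, h5⟩; refine ⟨?_, ?_, ?_⟩ <;> linarith
    · rintro ⟨h1, h2, h3⟩; refine ⟨⟨⟨?_, ?_, ?_⟩, ?_⟩, ?_⟩ <;> linarith
  rw [e1, e2] at c1
  rw [e3, e4, e5] at c2
  linarith

theorem diag_unit {χ : ConvexBody ℂ → ℝ} (hv : IsValuation χ) :
    χ (segB 0 (1 : ℂ) + segB 0 Complex.I) + χ (segB 0 (1 + Complex.I)) =
      χ (tri 0 1 (1 + Complex.I)) + χ (tri 0 Complex.I (1 + Complex.I)) := by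
  set T := segB 0 (1 : ℂ) + segB 0 Complex.I
  have hmT : ∀ x, x ∈ (T : Set ℂ) ↔ (0 ≤ x.re ∧ x.re ≤ 1) ∧ 0 ≤ x.im ∧ x.im ≤ 1 := fun x => by
    have := mem_rect (s := 1) (t := 1) zero_le_one zero_le_one x
    rw [one_smul, one_smul] at this
    exact this
  have c1 := bext_cut hv T.convex T.isCompact (Complex.reCLM - Complex.imCLM) 0
  rw [bext_coe] at c1
  have e1 : bext χ ((T : Set ℂ) ∩ {x | (Complex.reCLM - Complex.imCLM) x ≤ 0}) =
      χ (tri 0 Complex.I (1 + Complex.I)) := by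
    apply bext_eq_of_mem_iff
    intro x
    rw [Set.mem_inter_iff, hmT, Set.mem_ofPred_eq, coe_tri]
    simp
    constructor
    · rintro ⟨⟨⟨h1, h2⟩, h3, h4⟩, h5⟩
      refine ⟨x.im - x.re, x.re, by linarith, h1, by linarith, ?_⟩
      apply Complex.ext <;> simp
    · rintro ⟨v, w, hv, hw, hvw, rfl⟩
      simp
      refine ⟨⟨⟨?_, ?_⟩, ?_, ?_⟩, ?_⟩ <;> linarith
  have e2 : bext χ ((T : Set ℂ) ∩ {x | 0 ≤ (Complex.reCLM - Complex.imCLM) x}) =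
      χ (tri 0 1 (1 + Complex.I)) := by
    apply bext_eq_of_mem_iff
    intro x
    have := mem_unit_tri (r := 1) zero_le_one x
    rw [one_smul, one_smul] at this
    rw [Set.mem_inter_iff, hmT, Set.mem_ofPred_eq, this]
    simp
    constructor
    · rintro ⟨⟨⟨h1, h2⟩, h3, h4⟩, h5⟩; refine ⟨?_, ?_, ?_⟩ <;> linarith
    · rintro ⟨h1, h2, h3⟩; refine ⟨⟨⟨?_, ?_⟩, ?_, ?_⟩, ?_⟩ <;> linarith
  have e3 : bext χ ((T : Set ℂ) ∩ {x | (Complex.reCLM - Complex.imCLM) x = 0}) =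
      χ (segB 0 (1 + Complex.I)) := by
    apply bext_eq_of_mem_iff
    intro x
    rw [Set.mem_inter_iff, hmT, Set.mem_ofPred_eq, coe_segB]
    simp
    constructor
    · rintro ⟨⟨⟨h1, h2⟩, h3, h4⟩, h5⟩
      refine ⟨1 - x.re, x.re, by linarith, h1, by linarith, ?_⟩
      apply Complex.ext <;> simp <;> linarith
    · rintro ⟨v, w, hv, hw, hvw, rfl⟩
      simp
      constructor <;> linarith
  rw [e1, e2, e3] at c1
  linarith

theorem staircase {ψ : ConvexBody ℂ → ℝ} (hv : IsValuation ψ)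
    (hT : IsTranslationInvariant ψ) {a b : ℂ} (hab : om a b ≠ 0) {s t : ℝ} (hs : 0 ≤ s)
    (ht : 0 ≤ t) :
    ψ (tri 0 ((s + t) • a) ((s + t) • (a + b))) =
      ψ (tri 0 (s • a) (s • (a + b))) + ψ (tri 0 (t • a) (t • (a + b))) +
      ψ (segB 0 (t • a) + segB 0 (s • b)) - ψ (segB 0 (s • b)) - ψ (segB 0 (t • a)) := by
  have := staircase_unit (hv.comp_mapCLM (pmap_injective hab))
    (fun K x => by change ψ _ = ψ _; rw [ConvexBody.mapCLM_translate, hT]) hs ht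
  simp only [mapCLM_tri, ConvexBody.mapCLM_add, mapCLM_segB, map_zero, map_smul, map_add] at this
  simpa [pmap_apply] using this

theorem diag_cut {ψ : ConvexBody ℂ → ℝ} (hv : IsValuation ψ) {a b : ℂ} (hab : om a b ≠ 0) :
    ψ (segB 0 a + segB 0 b) + ψ (segB 0 (a + b)) =
      ψ (tri 0 a (a + b)) + ψ (tri 0 b (a + b)) := by
  have := diag_unit (hv.comp_mapCLM (pmap_injective hab))
  simp only [mapCLM_tri, ConvexBody.mapCLM_add, mapCLM_segB, map_zero, map_add] at this
  simpa [pmap_apply] using this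

end Staircase

theorem eq_mul_of_additive {g : ℝ → ℝ} (hg : ∀ s t, 0 ≤ s → 0 ≤ t → g (s + t) = g s + g t)
    (hc : Continuous g) {t : ℝ} (ht : 0 ≤ t) : g t = t * g 1 := by
  have h0 : g 0 = 0 := by have := hg 0 0 le_rfl le_rfl; simp at this; exact this
  have hn : ∀ (n : ℕ) (x : ℝ), 0 ≤ x → g (n * x) = n * g x := by
    intro n x hx
    induction n with
    | zero => simp [h0]
    | succ n ih =>
      push_cast
      rw [add_mul, one_mul, hg _ _ (by positivity) hx, ih]; ring
  obtain ⟨C, hC⟩ := (isCompact_Icc (a := (0 : ℝ)) (b := 1)).exists_bound_of_continuousOn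
    hc.continuousOn
  have key : ∀ n : ℕ, n * |g t - t * g 1| ≤ C + |g 1| := by
    intro n
    set m := ⌊n * t⌋₊
    have hm1 : (m : ℝ) ≤ n * t := Nat.floor_le (by positivity)
    have hm2 : n * t < m + 1 := Nat.lt_floor_add_one _
    have h1 : g (n * t) = m * g 1 + g (n * t - m) := by
      have := hg m (n * t - m) (by positivity) (by linarith)
      rw [add_sub_cancel] at this
      rw [this]
      have := hn m 1 zero_le_one
      rw [mul_one] at this
      rw [this]
    rw [hn n t ht] at h1
    have h2 : n * (g t - t * g 1) = g (n * t - m) - (n * t - m) * g 1 := by linarith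
    have h3 := hC (n * t - m) ⟨by linarith, by linarith⟩
    rw [Real.norm_eq_abs] at h3
    have h4 : |(n * t - m) * g 1| ≤ |g 1| := by
      rw [abs_mul, abs_of_nonneg (by linarith : 0 ≤ n * t - m)]
      exact mul_le_of_le_one_left (abs_nonneg _) (by linarith)
    calc n * |g t - t * g 1| = |n * (g t - t * g 1)| := by rw [abs_mul, Nat.abs_cast]
      _ ≤ |g (n * t - m)| + |(n * t - m) * g 1| := by rw [h2]; exact abs_sub _ _
      _ ≤ _ := by linarith
  by_contra hne
  have hpos : 0 < |g t - t * g 1| := abs_pos.2 (sub_ne_zero.2 hne)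
  obtain ⟨n, hn⟩ := exists_nat_gt ((C + |g 1|) / |g t - t * g 1|)
  rw [div_lt_iff₀ hpos] at hn
  linarith [key n]

theorem tri_degenerate {p q r : ℂ} (h : om (q - p) (r - p) = 0) :
    ∃ p' q', tri p q r = segB p' q' := by
  have main : ∀ a : ℂ, a ≠ 0 → om (q - p) a = 0 → om (r - p) a = 0 →
      ∃ p' q', tri p q r = segB p' q' := by
    intro a ha h1 h2
    have hl : omL a ≠ 0 := by
      intro h0
      apply ha
      have e1 : omL a 1 = 0 := by rw [h0]; rfl
      have e2 : omL a Complex.I = 0 := by rw [h0]; rfl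
      rw [omL_apply] at e1 e2
      simp [om] at e1 e2
      exact Complex.ext e2 e1
    obtain ⟨p', q', h⟩ := eq_segment_of_subset_line (tri p q r).convex (tri p q r).isCompact
      (tri p q r).nonempty hl (c := om p a) (by
        rintro x ⟨v, w, hv, hw, hvw, rfl⟩
        change omL a _ = _
        rw [omL_apply, om_add_left, om_add_left, om_smul_left, om_smul_left, h1, h2]; ring)
    exact ⟨p', q', ConvexBody.ext h⟩
  by_cases hq : q - p = 0
  · by_cases hr : r - p = 0
    · rw [sub_eq_zero] at hq hr
      exact ⟨p, p, by rw [hq, hr, tri_self_right]⟩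
    · exact main (r - p) hr h (om_self _)
  · exact main (q - p) hq (om_self _) (by rw [om_swap, h, neg_zero])

/-- To show that a translation invariant continuous valuation vanishes, it is enough to check
segments and positively oriented triangles. -/
theorem eq_zero_of_oriented {D : ConvexBody ℂ → ℝ} (hv : IsValuation D) (hc : Continuous D)
    (hT : IsTranslationInvariant D) (h1 : ∀ c, D (segB 0 c) = 0)
    (h2 : ∀ a b, 0 < om a b → D (tri 0 a (a + b)) = 0) (L : ConvexBody ℂ) : D L = 0 := by
  refine eq_zero_of_tri hv hc (fun p q r => ?_) L
  have e : tri p q r = (tri 0 (q - p) (r - p)).translate p := by rw [translate_tri]; simp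
  rcases lt_trichotomy (om (q - p) (r - p)) 0 with h | h | h
  · rw [e, tri_swap, hT]
    have := h2 (r - p) (q - p - (r - p)) (by rw [om_sub_right, om_self, om_swap]; linarith)
    simpa using this
  · obtain ⟨p', q', h'⟩ := tri_degenerate h
    rw [h', segB_self_translate, hT, h1]
  · rw [e, hT]
    have := h2 (q - p) (r - p - (q - p)) (by rw [om_sub_right, om_self]; linarith)
    simpa using this

section MixedArea

theorem hs_segB_zero (c a : ℂ) : hs (segB 0 c) a = max 0 (om c a) := by
  rw [hs_segB, om_zero_left]

theorem ConvexBody.add_smul_of_nonneg (K : ConvexBody ℂ) {s t : ℝ} (hs' : 0 ≤ s) (ht : 0 ≤ t) :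
    (s + t) • K = s • K + t • K := eq_of_hs_eq fun a => by
  rw [hs_add, hs_smul_body K hs', hs_smul_body K ht, hs_smul_body K (add_nonneg hs' ht), add_mul]

theorem smul_tri (t : ℝ) (p q r : ℂ) : t • tri p q r = tri (t • p) (t • q) (t • r) := by
  rw [ConvexBody.smul_eq_mapCLM, mapCLM_tri]; rfl

theorem smul_segB (t : ℝ) (p q : ℂ) : t • segB p q = segB (t • p) (t • q) := by
  rw [ConvexBody.smul_eq_mapCLM, mapCLM_segB]; rfl

theorem ConvexBody.smul_translate (t : ℝ) (K : ConvexBody ℂ) (x : ℂ) :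
    t • K.translate x = (t • K).translate (t • x) := by
  rw [ConvexBody.smul_eq_mapCLM, ConvexBody.mapCLM_translate, ConvexBody.smul_eq_mapCLM]; rfl

theorem vl_segB_zero (c : ℂ) : vl (segB 0 c) = 0 := by
  have h := vl_add_segB (segB 0 c) c
  have e : segB 0 c + segB 0 c = (2 : ℝ) • segB 0 c := by
    rw [show (2 : ℝ) = 1 + 1 by norm_num, ConvexBody.add_smul_of_nonneg _ zero_le_one zero_le_one,
      one_smul]
  rw [e, vl_smul, hs_segB_zero, hs_segB_zero, om_neg_right, om_self] at h
  simp at h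
  linarith

theorem vl_tri {a b : ℂ} (h : 0 < om a b) : vl (tri 0 a (a + b)) = om a b / 2 := by
  have h1 := diag_cut vl_isValuation h.ne'
  have e : tri 0 b (a + b) = ((-1 : ℝ) • tri 0 a (a + b)).translate (a + b) := by
    rw [smul_tri, translate_tri, tri_rotate (a + b + (-1 : ℝ) • (0 : ℂ)), tri_rotate, tri_swap]
    congr 1 <;> simp
    ring
  rw [e, vl_translate, vl_smul, vl_segB_zero, vl_add_segB, vl_segB_zero, hs_segB_zero,
    hs_segB_zero, om_neg_right, max_eq_right h.le, max_eq_left (by linarith)] at h1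
  linarith

/-- Twice the mixed area of two planar convex bodies. -/
def mv (M L : ConvexBody ℂ) : ℝ := vl (M + L) - vl M - vl L

theorem mv_comm (M L : ConvexBody ℂ) : mv M L = mv L M := by
  rw [mv, mv, add_comm]; ring

theorem mv_segB (M : ConvexBody ℂ) (c : ℂ) : mv M (segB 0 c) = hs M c + hs M (-c) := by
  rw [mv, vl_add_segB, vl_segB_zero]; ring

theorem mv_segB_add (M : ConvexBody ℂ) (a b : ℂ) :
    mv M (segB 0 a + segB 0 b) = mv M (segB 0 a) + mv M (segB 0 b) := by
  rw [mv_segB, mv_segB, mv, ← add_assoc, vl_add_segB, vl_add_segB, vl_add_segB, vl_segB_zero,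
    hs_add, hs_add]
  ring

/-- Continuous, translation invariant valuations in the plane that are homogeneous of degree 1. -/
structure IsLinVal (ψ : ConvexBody ℂ → ℝ) : Prop where
  val : IsValuation ψ
  cont : Continuous ψ
  inv : IsTranslationInvariant ψ
  hom : ∀ (t : ℝ) (L : ConvexBody ℂ), 0 < t → ψ (t • L) = t * ψ L

theorem mv_isValuation (M : ConvexBody ℂ) : IsValuation (mv M) := by
  have := ((vl_isValuation.comp_add M).sub (isValuation_const (vl M))).sub vl_isValuation
  intro K L hU hI
  have := this K L hU hI
  simp only [mv, add_comm M]
  exact this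

theorem continuous_mv (M : ConvexBody ℂ) : Continuous (mv M) := by
  unfold mv
  exact ((continuous_vl.comp (by fun_prop)).sub continuous_const).sub continuous_vl

theorem mv_translate (M L : ConvexBody ℂ) (x : ℂ) : mv M (L.translate x) = mv M L := by
  rw [mv, mv, ← ConvexBody.add_translate, vl_translate, vl_translate]

theorem ConvexBody.zero_smul_eq (K : ConvexBody ℂ) : (0 : ℝ) • K = segB 0 0 :=
  eq_of_hs_eq fun a => by rw [hs_smul_body K le_rfl, hs_segB, om_zero_left, zero_mul, max_self]

theorem mv_smul_tri (M : ConvexBody ℂ) {a b : ℂ} (h : 0 < om a b) {t : ℝ} (ht : 0 ≤ t) :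
    mv M (t • tri 0 a (a + b)) = t * mv M (tri 0 a (a + b)) := by
  have := eq_mul_of_additive (g := fun t => mv M (t • tri 0 a (a + b))) (fun s t hs ht => by
      simp only [smul_tri, smul_zero]
      rw [staircase (mv_isValuation M) (mv_translate M) h.ne' hs ht, mv_segB_add]; ring)
    ((continuous_mv M).comp (ConvexBody.continuous_smul_left _)) ht
  simpa using this

theorem smul_clm_injective {V : Type*} [NormedAddCommGroup V] [NormedSpace ℝ V] {t : ℝ}
    (ht : t ≠ 0) : Function.Injective (t • ContinuousLinearMap.id ℝ V) := fun x y h => by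
  simpa [ht] using h

theorem mv_smul (M : ConvexBody ℂ) {t : ℝ} (ht : 0 ≤ t) (L : ConvexBody ℂ) :
    mv M (t • L) = t * mv M L := by
  rcases ht.eq_or_lt with rfl | ht
  · rw [ConvexBody.zero_smul_eq, mv_segB, neg_zero, hs_zero]; ring
  have := eq_zero_of_oriented (D := fun L => mv M (t • L) - t * mv M L) ?_ ?_ ?_ ?_ ?_ L
  · linarith
  · refine IsValuation.sub ?_ ((mv_isValuation M).const_mul t)
    simp_rw [ConvexBody.smul_eq_mapCLM]
    exact (mv_isValuation M).comp_mapCLM (smul_clm_injective ht.ne')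
  · exact ((continuous_mv M).comp (ConvexBody.continuous_smul_right t)).sub
      (continuous_const.mul (continuous_mv M))
  · intro L x
    simp only [ConvexBody.smul_translate, mv_translate]
  · intro c
    simp only [smul_segB, smul_zero, mv_segB]
    rw [← smul_neg, hs_smul M ht.le, hs_smul M ht.le]; ring
  · intro a b h
    simp only [mv_smul_tri M h ht.le, sub_self]

theorem isLinVal_mv (M : ConvexBody ℂ) : IsLinVal (mv M) :=
  ⟨mv_isValuation M, continuous_mv M, mv_translate M, fun _ L ht => mv_smul M ht.le L⟩

theorem mv_smul_left {t : ℝ} (ht : 0 ≤ t) (M L : ConvexBody ℂ) : mv (t • M) L = t * mv M L := by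
  rw [mv_comm, mv_smul L ht, mv_comm]

theorem mv_mono (T : ConvexBody ℂ) {M M' : ConvexBody ℂ} (h : (M : Set ℂ) ⊆ M') :
    mv T M ≤ mv T M' := by
  by_contra! hlt
  have key : ∀ t : ℝ, 0 ≤ t → t * (mv T M - mv T M') ≤ vl M' - vl M := by
    intro t ht
    have h1 : vl (t • T + M) ≤ vl (t • T + M') := vl_mono (by
      rw [ConvexBody.coe_add, ConvexBody.coe_add]; exact Set.add_subset_add_left h)
    have h2 := mv_smul_left ht T M
    have h3 := mv_smul_left ht T M'
    rw [mv] at h2 h3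
    linarith
  have hpos : 0 < mv T M - mv T M' := by linarith
  have h1 := key ((vl M' - vl M + 1) / (mv T M - mv T M'))
    (div_nonneg (by linarith [vl_mono h]) hpos.le)
  rw [div_mul_cancel₀ _ hpos.ne'] at h1
  linarith

theorem mv_self (T : ConvexBody ℂ) : mv T T = 2 * vl T := by
  have e : T + T = (2 : ℝ) • T := by
    rw [show (2 : ℝ) = 1 + 1 by norm_num, ConvexBody.add_smul_of_nonneg _ zero_le_one zero_le_one,
      one_smul]
  rw [mv, e, vl_smul]; ring

theorem mem_tri_of {a b : ℂ} (h : 0 < om a b) {r : ℝ} (hr : 0 ≤ r) {x : ℂ} (h1 : om x a ≤ 0)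
    (h2 : om x b ≤ r * om a b) (h3 : 0 ≤ om x a + om x b) :
    x ∈ ((r • tri 0 a (a + b) : ConvexBody ℂ) : Set ℂ) := by
  have e : r • tri 0 a (a + b) = (tri 0 (r • (1 : ℂ)) (r • (1 + Complex.I))).mapCLM (pmap a b) := by
    rw [mapCLM_tri, map_smul, map_smul, map_zero, smul_tri, smul_zero]
    simp [pmap_apply]
  rw [e, ConvexBody.coe_mapCLM]
  refine ⟨⟨om x b / om a b, -om x a / om a b⟩, ?_, ?_⟩
  · rw [mem_unit_tri hr]
    refine ⟨by apply div_nonneg <;> linarith, ?_, ?_⟩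
    · exact div_le_div_of_nonneg_right (by linarith) h.le
    · rw [div_le_iff₀ h]; exact h2
  · rw [pmap_apply]
    apply smul_right_injective ℂ h.ne'
    simp only [smul_add, smul_smul, mul_div_cancel₀ _ h.ne']
    apply Complex.ext <;> simp [om] <;> ring

/-- The sum of the support numbers in the edge directions of a triangle. -/
def edgeSum (a b : ℂ) (M : ConvexBody ℂ) : ℝ := hs M a + hs M b + hs M (-a - b)

theorem edgeSum_translate (a b : ℂ) (M : ConvexBody ℂ) (x : ℂ) :
    edgeSum a b (M.translate x) = edgeSum a b M := by
  simp only [edgeSum, hs_translate, om_sub_right, om_neg_right]; ring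

theorem edgeSum_smul (a b : ℂ) {t : ℝ} (ht : 0 ≤ t) (M : ConvexBody ℂ) :
    edgeSum a b (t • M) = t * edgeSum a b M := by
  simp only [edgeSum, hs_smul_body M ht]; ring

theorem edgeSum_isValuation (a b : ℂ) : IsValuation (edgeSum a b) :=
  ((hs_isValuation a).add (hs_isValuation b)).add (hs_isValuation _)

theorem continuous_edgeSum (a b : ℂ) : Continuous (edgeSum a b) :=
  ((continuous_hs a).add (continuous_hs b)).add (continuous_hs _)

theorem edgeSum_nonneg (a b : ℂ) (M : ConvexBody ℂ) : 0 ≤ edgeSum a b M := by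
  obtain ⟨x, hx⟩ := M.nonempty
  have h1 := om_le_hs M hx a
  have h2 := om_le_hs M hx b
  have h3 := om_le_hs M hx (-a - b)
  rw [om_sub_right, om_neg_right] at h3
  unfold edgeSum
  linarith

theorem edgeSum_tri {a b : ℂ} (h : 0 < om a b) : edgeSum a b (tri 0 a (a + b)) = om a b := by
  simp only [edgeSum, hs_tri, om_zero_left, om_add_left, om_self, om_sub_right, om_neg_right,
    om_swap a b]
  rw [max_eq_left (by rw [max_le_iff]; constructor <;> linarith),
    max_eq_right (by rw [le_max_iff]; left; linarith), max_eq_left (by linarith),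
    max_eq_left (by rw [max_le_iff]; constructor <;> linarith)]
  ring

theorem exists_subset_tri {a b : ℂ} (h : 0 < om a b) (M : ConvexBody ℂ) :
    ∃ p, (M : Set ℂ) ⊆ ((edgeSum a b M / om a b) • tri 0 a (a + b)).translate p := by
  obtain ⟨p, hp1, hp2⟩ : ∃ p, om p a = hs M a ∧ om p (-a - b) = hs M (-a - b) := by
    refine ⟨(-hs M a / om a b - hs M (-a - b) / om a b) • a + (-hs M a / om a b) • b, ?_, ?_⟩
    · rw [om_add_left, om_smul_left, om_smul_left, om_self, om_swap a b]
      field_simp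
      ring
    · rw [om_add_left, om_smul_left, om_smul_left, om_sub_right, om_sub_right, om_neg_right,
        om_neg_right, om_self, om_self, om_swap a b]
      field_simp
      ring
  refine ⟨p, fun x hx => ?_⟩
  rw [ConvexBody.mem_translate]
  have h1 := om_le_hs M hx a
  have h2 := om_le_hs M hx b
  have h3 := om_le_hs M hx (-a - b)
  rw [om_sub_right, om_neg_right] at h3 hp2
  apply mem_tri_of h (div_nonneg (edgeSum_nonneg a b M) h.le)
  · rw [om_sub_left]; linarith
  · rw [om_sub_left, div_mul_cancel₀ _ h.ne', edgeSum]; linarith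
  · rw [om_sub_left, om_sub_left]; linarith

theorem mv_tri_segB (a b x : ℂ) :
    mv (tri 0 a (a + b)) (segB 0 x) = edgeSum a b (segB 0 x) := by
  rw [mv_segB]
  simp only [edgeSum, hs_tri, hs_segB_zero, om_zero_left, om_add_left, om_sub_right, om_neg_right]
  rw [om_swap x a, om_swap x b]
  rcases max_cases 0 (om x a) with ⟨h1, h1'⟩ | ⟨h1, h1'⟩ <;>
  rcases max_cases 0 (om x b) with ⟨h2, h2'⟩ | ⟨h2, h2'⟩ <;>
  rcases max_cases 0 (-om x a - om x b) with ⟨h3, h3'⟩ | ⟨h3, h3'⟩ <;>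
  rw [h1, h2, h3] <;> simp only [max_def] <;> split_ifs <;> linarith

theorem polyh_induction_zero {d : ConvexBody ℂ → ℝ} (hv : IsValuation d) (h0 : ∀ M, 0 ≤ d M)
    (hs : ∀ p q, d (segB p q) = 0) (T : ConvexBody ℂ) (hT : d T = 0)
    (P : List ((ℂ →L[ℝ] ℝ) × ℝ)) : bext d ((T : Set ℂ) ∩ polyh P) = 0 := by
  have hb : ∀ S, 0 ≤ bext d S := by
    intro S
    unfold bext
    split_ifs
    · exact h0 _
    · exact le_rfl
  induction P with
  | nil => rw [polyh_nil, Set.inter_univ, bext_coe, hT]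
  | cons lc P ih =>
    obtain ⟨l, c⟩ := lc
    have e : (T : Set ℂ) ∩ polyh ((l, c) :: P) = (T : Set ℂ) ∩ polyh P ∩ {x | l x ≤ c} := by
      rw [polyh_cons]; ext x; simp only [Set.mem_inter_iff]; tauto
    have hS1 := T.convex.inter (convex_polyh P)
    have hS2 := T.isCompact.inter_right (isClosed_polyh P)
    have hcut := bext_cut hv hS1 hS2 l c
    rw [e]
    by_cases hl : l = 0
    · subst hl
      by_cases hc : 0 ≤ c
      · convert ih using 2
        ext x; simp [hc]
      · rw [show (T : Set ℂ) ∩ polyh P ∩ {x | (0 : ℂ →L[ℝ] ℝ) x ≤ c} = ∅ by ext x; simp [hc],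
          bext_empty]
    · have h3 : bext d ((T : Set ℂ) ∩ polyh P ∩ {x | l x = c}) = 0 := by
        by_cases hne : ((T : Set ℂ) ∩ polyh P ∩ {x | l x = c}).Nonempty
        · obtain ⟨p, q, hpq⟩ := eq_segment_of_subset_line
            (hS1.inter (convex_hyperplane l.toLinearMap.isLinear c))
            (hS2.inter_right (isClosed_eq l.continuous continuous_const)) hne hl
            (c := c) Set.inter_subset_right
          have hpq' : (T : Set ℂ) ∩ polyh P ∩ {x | l x = c} = segment ℝ p q := hpq
          rw [hpq', ← coe_segB, bext_coe, hs]
        · rw [Set.not_nonempty_iff_eq_empty.1 hne, bext_empty]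
      linarith [hb ((T : Set ℂ) ∩ polyh P ∩ {x | l x ≤ c}),
        hb ((T : Set ℂ) ∩ polyh P ∩ {x | c ≤ l x})]

theorem mv_tri {a b : ℂ} (h : 0 < om a b) (M : ConvexBody ℂ) :
    mv (tri 0 a (a + b)) M = edgeSum a b M := by
  set T := tri 0 a (a + b) with hT
  set d : ConvexBody ℂ → ℝ := fun M => edgeSum a b M - mv T M with hd
  have hTT : mv T T = om a b := by rw [mv_self, vl_tri h]; ring
  have hdv : IsValuation d := (edgeSum_isValuation a b).sub (mv_isValuation T)
  have hdc : Continuous d := (continuous_edgeSum a b).sub (continuous_mv T)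
  have h0 : ∀ M, 0 ≤ d M := fun M => by
    obtain ⟨p, hp⟩ := exists_subset_tri h M
    have := mv_mono T hp
    rw [mv_translate, mv_smul T (div_nonneg (edgeSum_nonneg a b M) h.le), hTT,
      div_mul_cancel₀ _ h.ne'] at this
    exact sub_nonneg.2 this
  obtain ⟨p, hp⟩ := exists_subset_tri h M
  have := eq_zero_of_bext_polyh hdc hp (polyh_induction_zero hdv h0 (fun p q => by
      simp only [hd]
      rw [segB_self_translate, mv_translate, edgeSum_translate, mv_tri_segB, sub_self]) _ (by
      have hr := div_nonneg (edgeSum_nonneg a b M) h.le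
      simp only [hd]
      rw [mv_translate, edgeSum_translate, mv_smul T hr, edgeSum_smul a b hr, hTT,
        edgeSum_tri h, sub_self]))
  simp only [hd] at this
  linarith

theorem IsLinVal.sub {φ ψ : ConvexBody ℂ → ℝ} (hφ : IsLinVal φ) (hψ : IsLinVal ψ) :
    IsLinVal fun K => φ K - ψ K :=
  ⟨hφ.val.sub hψ.val, hφ.cont.sub hψ.cont, fun K x => by simp only [hφ.inv K x, hψ.inv K x],
    fun t L ht => by simp only [hφ.hom t L ht, hψ.hom t L ht]; ring⟩

theorem IsLinVal.add {φ ψ : ConvexBody ℂ → ℝ} (hφ : IsLinVal φ) (hψ : IsLinVal ψ) :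
    IsLinVal fun K => φ K + ψ K :=
  ⟨hφ.val.add hψ.val, hφ.cont.add hψ.cont, fun K x => by simp only [hφ.inv K x, hψ.inv K x],
    fun t L ht => by simp only [hφ.hom t L ht, hψ.hom t L ht]; ring⟩

theorem IsLinVal.eq_of_oriented {φ ψ : ConvexBody ℂ → ℝ} (hφ : IsLinVal φ) (hψ : IsLinVal ψ)
    (h1 : ∀ c, φ (segB 0 c) = ψ (segB 0 c))
    (h2 : ∀ a b, 0 < om a b → φ (tri 0 a (a + b)) = ψ (tri 0 a (a + b))) (L : ConvexBody ℂ) :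
    φ L = ψ L := by
  have h := hφ.sub hψ
  have := eq_zero_of_oriented h.val h.cont h.inv (fun c => sub_eq_zero.2 (h1 c))
    (fun a b hab => sub_eq_zero.2 (h2 a b hab)) L
  linarith

/-- The mixed area is additive. -/
theorem mv_add_left (M₁ M₂ L : ConvexBody ℂ) : mv (M₁ + M₂) L = mv M₁ L + mv M₂ L := by
  refine (isLinVal_mv _).eq_of_oriented ((isLinVal_mv M₁).add (isLinVal_mv M₂)) ?_ ?_ L
  · intro c
    rw [mv_segB, mv_segB, mv_segB, hs_add, hs_add]; ring
  · intro a b h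
    rw [mv_comm, mv_comm M₁, mv_comm M₂, mv_tri h, mv_tri h, mv_tri h, edgeSum, edgeSum, edgeSum,
      hs_add, hs_add, hs_add]
    ring

theorem mv_add (M L₁ L₂ : ConvexBody ℂ) : mv M (L₁ + L₂) = mv M L₁ + mv M L₂ := by
  rw [mv_comm, mv_add_left, mv_comm L₁, mv_comm L₂]

end MixedArea

section Planar

theorem tri_split {ψ : ConvexBody ℂ → ℝ} (hv : IsValuation ψ) {p q r : ℂ}
    (h : om (q - p) (r - p) ≠ 0) {t : ℝ} (ht : 0 < t) (ht1 : t < 1) :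
    ψ (tri p q r) + ψ (segB p (q + t • (r - q))) =
      ψ (tri p q (q + t • (r - q))) + ψ (tri p (q + t • (r - q)) r) := by
  set m := q + t • (r - q) with hm
  have ht1' : 0 < 1 - t := by linarith
  have hmem : m ∈ triSet p q r := ⟨1 - t, t, ht1'.le, ht.le, by linarith, by
    rw [hm]; simp only [smul_sub, sub_smul, one_smul]; ring⟩
  have hmp : m - p = (1 - t) • (q - p) + t • (r - p) := by
    rw [hm]; simp only [smul_sub, sub_smul, one_smul]; ring
  apply hv.of_eq
  · apply Set.Subset.antisymm
    · rintro x ⟨v, w, hv, hw, hvw, rfl⟩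
      rcases le_total (w * (1 - t)) (v * t) with hle | hle
      · left
        refine ⟨v - w * (1 - t) / t, w / t, ?_, by positivity, ?_, ?_⟩
        · rw [sub_nonneg, div_le_iff₀ ht]; exact hle
        · have : v - w * (1 - t) / t + w / t = v + w := by field_simp; ring
          linarith
        · rw [hmp, smul_add, smul_smul, smul_smul, div_mul_cancel₀ _ ht.ne', sub_smul,
            div_mul_eq_mul_div]
          abel
      · right
        refine ⟨v / (1 - t), w - v * t / (1 - t), by positivity, ?_, ?_, ?_⟩
        · rw [sub_nonneg, div_le_iff₀ ht1']; exact hle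
        · have : v / (1 - t) + (w - v * t / (1 - t)) = v + w := by field_simp; ring
          linarith
        · rw [hmp, smul_add, smul_smul, smul_smul, div_mul_cancel₀ _ ht1'.ne', sub_smul,
            div_mul_eq_mul_div]
          abel
    · apply Set.union_subset
      · exact triSet_subset (convex_triSet _ _ _) (left_mem_triSet _ _ _) (mid_mem_triSet _ _ _)
          hmem
      · exact triSet_subset (convex_triSet _ _ _) (left_mem_triSet _ _ _) hmem
          (right_mem_triSet _ _ _)
  · apply Set.Subset.antisymm
    · apply Set.subset_inter
      · exact (convex_triSet _ _ _).segment_subset (left_mem_triSet _ _ _) (right_mem_triSet _ _ _)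
      · exact (convex_triSet _ _ _).segment_subset (left_mem_triSet _ _ _) (mid_mem_triSet _ _ _)
    · rintro x ⟨⟨v, w, hv, hw, hvw, hx⟩, ⟨v', w', hv', hw', hvw', hx'⟩⟩
      have e : om (x - p) (m - p) = v * (t * om (q - p) (r - p)) := by
        rw [hx, add_sub_right_comm, om_add_left, add_sub_right_comm, sub_self, zero_add,
          om_smul_left, om_smul_left, om_self, hmp, om_add_right, om_smul_right, om_self,
          om_smul_right]
        ring
      have e' : om (x - p) (m - p) = - (w' * ((1 - t) * om (q - p) (r - p))) := by
        rw [hx', add_sub_right_comm, om_add_left, add_sub_right_comm, sub_self, zero_add,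
          om_smul_left, om_smul_left, om_self, hmp, om_add_right, om_smul_right,
          om_smul_right _ (r - p), om_self, om_swap (q - p)]
        ring
      have e2 : (v * t + w' * (1 - t)) * om (q - p) (r - p) = 0 := by linarith
      have e3 := (mul_eq_zero.1 e2).resolve_right h
      have e4 : v * t = 0 := by
        have := mul_nonneg hv ht.le
        have := mul_nonneg hw' ht1'.le
        linarith
      have e5 := (mul_eq_zero.1 e4).resolve_right ht.ne'
      rw [e5, zero_smul, add_zero] at hx
      exact ⟨1 - w, w, by linarith, hw, by ring, by
        rw [hx]; simp only [smul_sub, sub_smul, one_smul]; abel⟩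

variable {ψ : ConvexBody ℂ → ℝ}

/-- The value of a valuation on segments. -/
def sg (ψ : ConvexBody ℂ → ℝ) (a : ℂ) : ℝ := ψ (segB 0 a)

theorem IsLinVal.segB_eq (h : IsLinVal ψ) (p q : ℂ) : ψ (segB p q) = sg ψ (q - p) := by
  rw [segB_self_translate, h.inv]; rfl

theorem IsLinVal.sg_zero (h : IsLinVal ψ) : sg ψ 0 = 0 := by
  have := h.hom 2 (segB 0 0) (by norm_num)
  rw [smul_segB, smul_zero] at this
  unfold sg
  linarith

theorem IsLinVal.sg_smul (h : IsLinVal ψ) {t : ℝ} (ht : 0 ≤ t) (a : ℂ) :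
    sg ψ (t • a) = t * sg ψ a := by
  rcases ht.eq_or_lt with rfl | ht
  · rw [zero_smul, h.sg_zero, zero_mul]
  · have := h.hom t (segB 0 a) ht
    rwa [smul_segB, smul_zero] at this

theorem IsLinVal.sg_neg (h : IsLinVal ψ) (a : ℂ) : sg ψ (-a) = sg ψ a := by
  have h1 := h.segB_eq a 0
  rw [segB_comm, h.segB_eq, zero_sub, sub_zero] at h1
  exact h1.symm

theorem IsLinVal.sg_smul_abs (h : IsLinVal ψ) (t : ℝ) (a : ℂ) : sg ψ (t • a) = |t| * sg ψ a := by
  rcases le_total 0 t with ht | ht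
  · rw [h.sg_smul ht, abs_of_nonneg ht]
  · rw [← neg_neg t, neg_smul, h.sg_neg, h.sg_smul (by linarith), abs_neg, abs_of_nonneg (by
    linarith)]

theorem IsLinVal.par (h : IsLinVal ψ) {a b : ℂ} (hab : om a b ≠ 0) :
    ψ (segB 0 a + segB 0 b) = sg ψ a + sg ψ b := by
  have h1 := staircase h.val h.inv hab (s := 1 / 2) (t := 1 / 2) (by norm_num) (by norm_num)
  have e : ∀ c : ℂ, segB 0 ((1 / 2 : ℝ) • c) = (1 / 2 : ℝ) • segB 0 c := fun c => by
    rw [smul_segB, smul_zero]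
  have e2 : tri 0 ((1 / 2 : ℝ) • a) ((1 / 2 : ℝ) • (a + b)) = (1 / 2 : ℝ) • tri 0 a (a + b) := by
    rw [smul_tri, smul_zero]
  rw [e, e, ← smul_add, e2, h.hom _ _ (by norm_num), h.hom _ _ (by norm_num),
    h.hom _ _ (by norm_num), h.hom _ _ (by norm_num), show (1 / 2 + 1 / 2 : ℝ) = 1 by norm_num,
    one_smul, one_smul] at h1
  unfold sg
  linarith

theorem IsLinVal.tri_add_tri (h : IsLinVal ψ) {a b : ℂ} (hab : om a b ≠ 0) :
    ψ (tri 0 a (a + b)) + ψ (tri 0 b (a + b)) = sg ψ a + sg ψ b + sg ψ (a + b) := by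
  rw [← diag_cut h.val hab, h.par hab]; rfl

/-- The oriented, symmetrized value of a valuation on a triangle. -/
def orTri (ψ : ConvexBody ℂ → ℝ) (p q r : ℂ) : ℝ :=
  Real.sign (om (q - p) (r - p)) *
    (ψ (tri p q r) - (sg ψ (q - p) + sg ψ (r - q) + sg ψ (p - r)) / 2)

theorem orTri_of_collinear {p q r : ℂ} (h : om (q - p) (r - p) = 0) : orTri ψ p q r = 0 := by
  rw [orTri, h, Real.sign_zero, zero_mul]

theorem IsLinVal.orTri_swap (h : IsLinVal ψ) (p q r : ℂ) : orTri ψ p r q = -orTri ψ p q r := by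
  rw [orTri, orTri, om_swap, Real.sign_neg, tri_swap, ← h.sg_neg (r - p), ← h.sg_neg (q - r),
    ← h.sg_neg (p - q), neg_sub, neg_sub, neg_sub]
  ring

theorem orTri_rotate (p q r : ℂ) : orTri ψ q r p = orTri ψ p q r := by
  rw [orTri, orTri, tri_rotate p q r, show om (r - q) (p - q) = om (q - p) (r - p) by
    simp [om]; ring]
  ring

theorem IsLinVal.orTri_translate (h : IsLinVal ψ) (p q r x : ℂ) :
    orTri ψ (x + p) (x + q) (x + r) = orTri ψ p q r := by
  simp only [orTri, ← translate_tri, h.inv _ _, add_sub_add_left_eq_sub]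

theorem IsLinVal.orTri_smul (h : IsLinVal ψ) {t : ℝ} (ht : 0 < t) (p q r : ℂ) :
    orTri ψ (t • p) (t • q) (t • r) = t * orTri ψ p q r := by
  have hs : ∀ x : ℝ, Real.sign (t * (t * x)) = Real.sign x := by
    intro x
    rcases lt_trichotomy x 0 with hx | hx | hx
    · rw [Real.sign_of_neg hx, Real.sign_of_neg (by nlinarith [mul_neg_of_pos_of_neg ht hx])]
    · rw [hx, mul_zero, mul_zero]
    · rw [Real.sign_of_pos hx, Real.sign_of_pos (by positivity)]
  simp only [orTri, ← smul_sub, om_smul_left, om_smul_right, hs, ← smul_tri, h.hom _ _ ht,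
    h.sg_smul ht.le]
  ring

theorem IsLinVal.orTri_split (h : IsLinVal ψ) (p q r : ℂ) {t : ℝ} (ht : 0 ≤ t) (ht1 : t ≤ 1) :
    orTri ψ p q r = orTri ψ p q (q + t • (r - q)) + orTri ψ p (q + t • (r - q)) r := by
  have e1 : om (q - p) (q + t • (r - q) - p) = t * om (q - p) (r - p) := by
    simp [om]; ring
  have e2 : om (q + t • (r - q) - p) (r - p) = (1 - t) * om (q - p) (r - p) := by
    simp [om]; ring
  have hs : ∀ c x : ℝ, 0 < c → Real.sign (c * x) = Real.sign x := by
    intro c x hc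
    rcases lt_trichotomy x 0 with hx | hx | hx
    · rw [Real.sign_of_neg hx, Real.sign_of_neg (mul_neg_of_pos_of_neg hc hx)]
    · rw [hx, mul_zero]
    · rw [Real.sign_of_pos hx, Real.sign_of_pos (by positivity)]
  by_cases hcol : om (q - p) (r - p) = 0
  · rw [orTri_of_collinear hcol, orTri_of_collinear (by rw [e1, hcol, mul_zero]),
      orTri_of_collinear (by rw [e2, hcol, mul_zero]), add_zero]
  rcases ht.eq_or_lt with rfl | ht
  · rw [zero_smul, add_zero, orTri_of_collinear (om_self _), zero_add]
  rcases ht1.eq_or_lt with rfl | ht1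
  · rw [one_smul, add_sub_cancel, orTri_of_collinear (p := p) (q := r) (om_self _), add_zero]
  have hcut := tri_split h.val hcol ht ht1
  rw [h.segB_eq] at hcut
  rw [orTri, orTri, orTri, e1, e2, hs _ _ ht, hs _ _ (by linarith), ← mul_add]
  congr 1
  have e3 : sg ψ (q + t • (r - q) - q) = t * sg ψ (r - q) := by
    rw [add_sub_cancel_left, h.sg_smul ht.le]
  have e4 : sg ψ (r - (q + t • (r - q))) = (1 - t) * sg ψ (r - q) := by
    rw [← h.sg_smul (by linarith), sub_smul, one_smul, sub_sub]
  have e5 : sg ψ (p - (q + t • (r - q))) = sg ψ (q + t • (r - q) - p) := by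
    rw [← h.sg_neg, neg_sub]
  rw [e3, e4, e5]
  linarith

theorem exists_smul_of_om_eq_zero {a b : ℂ} (ha : a ≠ 0) (h : om a b = 0) : ∃ t : ℝ, b = t • a := by
  have hn : a.re ^ 2 + a.im ^ 2 ≠ 0 := by
    intro h0
    apply ha
    have h1 : a.re = 0 := by nlinarith [sq_nonneg a.re, sq_nonneg a.im]
    have h2 : a.im = 0 := by nlinarith [sq_nonneg a.re, sq_nonneg a.im]
    exact Complex.ext h1 h2
  refine ⟨(a.re * b.re + a.im * b.im) / (a.re ^ 2 + a.im ^ 2), ?_⟩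
  unfold om at h
  apply Complex.ext
  · rw [Complex.smul_re, smul_eq_mul]; field_simp; linear_combination (-a.im) * h
  · rw [Complex.smul_im, smul_eq_mul]; field_simp; linear_combination a.re * h

theorem IsLinVal.orTri_line (h : IsLinVal ψ) (p : ℂ) {q r m : ℂ} (hc : om (r - q) (m - q) = 0) :
    orTri ψ p q r + orTri ψ p r m = orTri ψ p q m := by
  by_cases hqr : r - q = 0
  · rw [sub_eq_zero] at hqr
    rw [hqr, orTri_of_collinear (om_self _), zero_add]
  obtain ⟨t, ht⟩ := exists_smul_of_om_eq_zero hqr hc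
  rcases le_or_gt t 0 with h0 | h0
  · have := h.orTri_split p m r (t := -t / (1 - t)) (div_nonneg (by linarith) (by linarith))
      (by rw [div_le_one] <;> linarith)
    have e : m + (-t / (1 - t)) • (r - m) = q := by
      have h1 : r - m = (1 - t) • (r - q) := by rw [sub_smul, one_smul, ← ht]; ring
      rw [h1, smul_smul, div_mul_cancel₀ _ (by linarith), neg_smul, ← ht]; ring
    rw [e] at this
    rw [h.orTri_swap p m r, h.orTri_swap p m q]
    linarith
  rcases le_or_gt t 1 with h1 | h1
  · have := h.orTri_split p q r h0.le h1
    rw [← ht, add_sub_cancel] at this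
    rw [h.orTri_swap p m r]
    linarith
  · have := h.orTri_split p q m (t := 1 / t) (by positivity) (by rw [div_le_one] <;> linarith)
    have e : q + (1 / t) • (m - q) = r := by
      rw [ht, smul_smul, one_div_mul_cancel (by linarith), one_smul]; ring
    rw [e] at this
    linarith

theorem IsLinVal.cocycle_of_inter (h : IsLinVal ψ) {p q r s m : ℂ} (h1 : om (q - p) (m - p) = 0)
    (h2 : om (s - r) (m - r) = 0) :
    orTri ψ q r s - orTri ψ p r s + orTri ψ p q s - orTri ψ p q r = 0 := by
  have a1 := h.orTri_line q h2
  have a2 := h.orTri_line p h2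
  have a3 := h.orTri_line s h1
  have a4 := h.orTri_line r h1
  have b1 := h.orTri_swap q s m
  have b2 := h.orTri_swap p s m
  have c1 := orTri_rotate (ψ := ψ) s p q
  have c2 := orTri_rotate (ψ := ψ) r p q
  have d1 := orTri_rotate (ψ := ψ) q s m
  have d1' := orTri_rotate (ψ := ψ) s m q
  have d2 := h.orTri_swap s q m
  have d3 := orTri_rotate (ψ := ψ) s p m
  have d4 := h.orTri_swap p s m
  have d5 := orTri_rotate (ψ := ψ) q r m
  have d6 := h.orTri_swap r q m
  have d7 := orTri_rotate (ψ := ψ) r p m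
  have d8 := h.orTri_swap p r m
  linarith

theorem IsLinVal.cocycle (h : IsLinVal ψ) (p q r s : ℂ) :
    orTri ψ q r s - orTri ψ p r s + orTri ψ p q s - orTri ψ p q r = 0 := by
  have key : ∀ p q r s : ℂ, om (q - p) (s - r) ≠ 0 →
      orTri ψ q r s - orTri ψ p r s + orTri ψ p q s - orTri ψ p q r = 0 := by
    intro p q r s hne
    refine h.cocycle_of_inter (m := p + (om (r - p) (s - r) / om (q - p) (s - r)) • (q - p)) ?_ ?_
    · rw [add_sub_cancel_left, om_smul_right, om_self, mul_zero]
    · rw [add_sub_right_comm, om_add_right, om_smul_right, om_swap (q - p), om_swap (p - r)]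
      field_simp
      rw [← neg_sub p r, om_neg_left]; ring
  by_cases h1 : om (q - p) (s - r) = 0
  · by_cases h2 : om (r - p) (s - q) = 0
    · by_cases h3 : om (s - p) (r - q) = 0
      · simp only [om, Complex.sub_re, Complex.sub_im] at h1 h2 h3
        rw [orTri_of_collinear (p := q), orTri_of_collinear (p := p),
          orTri_of_collinear (p := p), orTri_of_collinear (p := p)]
        · ring
        all_goals simp only [om, Complex.sub_re, Complex.sub_im]; linarith
      · have := key p s q r h3
        have e1 := orTri_rotate (ψ := ψ) s q r
        have e2 := h.orTri_swap p q s
        have e3 := h.orTri_swap p r s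
        linarith
    · have := key p r q s h2
      have e1 := h.orTri_swap q r s
      have e2 := h.orTri_swap p q r
      have e3 := orTri_rotate (ψ := ψ) q r s
      have e4 := h.orTri_swap r q s
      linarith
  · exact key p q r s h1

end Planar

section PlanarRepresentation

variable {ψ : ConvexBody ℂ → ℝ}

/-- The oriented value on the triangle spanned by two successive edge vectors. -/
def orEdge (ψ : ConvexBody ℂ → ℝ) (a b : ℂ) : ℝ := orTri ψ 0 a (a + b)

theorem orEdge_of_collinear {a b : ℂ} (h : om a b = 0) : orEdge ψ a b = 0 :=
  orTri_of_collinear (by rw [sub_zero, sub_zero, om_add_right, om_self, h, add_zero])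

theorem IsLinVal.orEdge_smul (h : IsLinVal ψ) {t : ℝ} (ht : 0 < t) (a b : ℂ) :
    orEdge ψ (t • a) (t • b) = t * orEdge ψ a b := by
  have := h.orTri_smul ht 0 a (a + b)
  rwa [smul_zero, smul_add] at this

theorem orEdge_of_pos {a b : ℂ} (hab : 0 < om a b) : orEdge ψ a b =
    ψ (tri 0 a (a + b)) - (sg ψ a + sg ψ b + sg ψ (-(a + b))) / 2 := by
  rw [orEdge, orTri, sub_zero, sub_zero, om_add_right, om_self, zero_add, Real.sign_of_pos hab,
    one_mul, add_sub_cancel_left, zero_sub]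

theorem IsLinVal.orEdge_comm (h : IsLinVal ψ) (a b : ℂ) : orEdge ψ a b = orEdge ψ b a := by
  have key : ∀ a b : ℂ, 0 < om a b → orEdge ψ a b = orEdge ψ b a := by
    intro a b hab
    have h1 := h.tri_add_tri hab.ne'
    rw [orEdge_of_pos hab, orEdge, orTri, sub_zero, sub_zero, om_add_right, om_self, zero_add,
      Real.sign_of_neg (by rw [om_swap]; linarith), add_sub_cancel_left, zero_sub, add_comm b a,
      h.sg_neg]
    linarith
  rcases lt_trichotomy (om a b) 0 with h0 | h0 | h0
  · exact (key b a (by rw [om_swap]; linarith)).symm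
  · rw [orEdge_of_collinear h0, orEdge_of_collinear (by rw [om_swap, h0, neg_zero])]
  · exact key a b h0

theorem IsLinVal.orEdge_neg (h : IsLinVal ψ) (a b : ℂ) : orEdge ψ (-a) (-b) = -orEdge ψ a b := by
  rw [h.orEdge_comm a b, orEdge, orEdge, ← h.orTri_translate 0 (-a) (-a + -b) (a + b),
    ← h.orTri_swap, ← orTri_rotate (a + b + 0), ← orTri_rotate]
  congr 1 <;> ring

theorem IsLinVal.orEdge_cocycle (h : IsLinVal ψ) (x y z : ℂ) :
    orEdge ψ x y + orEdge ψ (x + y) z = orEdge ψ y z + orEdge ψ x (y + z) := by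
  have h1 := h.cocycle 0 x (x + y) (x + y + z)
  have h2 := h.orTri_translate 0 y (y + z) x
  rw [add_zero, ← add_assoc] at h2
  unfold orEdge
  rw [← add_assoc x y z]
  linarith

/-- A primitive of the cocycle `orEdge`. -/
def prim (ψ : ConvexBody ℂ → ℝ) (x : ℂ) : ℝ := -orEdge ψ (x.re • (1 : ℂ)) (x.im • Complex.I)

theorem IsLinVal.orEdge_eq (h : IsLinVal ψ) (a b : ℂ) :
    orEdge ψ a b = prim ψ a + prim ψ b - prim ψ (a + b) := by
  have hd : ∀ x : ℂ, x.re • (1 : ℂ) + x.im • Complex.I = x := fun x => by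
    apply Complex.ext <;> simp
  have h1 := h.orEdge_cocycle (a.re • (1 : ℂ)) (a.im • Complex.I) b
  have h2 := h.orEdge_cocycle (b.re • (1 : ℂ)) (b.im • Complex.I) (a.im • Complex.I)
  have h3 := h.orEdge_cocycle (a.re • (1 : ℂ)) (b.re • (1 : ℂ))
    (a.im • Complex.I + b.im • Complex.I)
  rw [hd] at h1 h2
  rw [orEdge_of_collinear (a := b.im • Complex.I)
    (by rw [om_smul_left, om_smul_right, om_self]; ring), h.orEdge_comm b, zero_add,
    add_comm (b.im • Complex.I)] at h2
  rw [orEdge_of_collinear (a := a.re • (1 : ℂ))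
    (by rw [om_smul_left, om_smul_right, om_self]; ring), zero_add,
    show b.re • (1 : ℂ) + (a.im • Complex.I + b.im • Complex.I) = a.im • Complex.I + b by
      nth_rewrite 3 [← hd b]; abel, ← add_smul, ← add_smul] at h3
  rw [← add_smul] at h2
  unfold prim
  rw [Complex.add_re, Complex.add_im]
  linarith

theorem IsLinVal.prim_smul (h : IsLinVal ψ) {t : ℝ} (ht : 0 < t) (a : ℂ) :
    prim ψ (t • a) = t * prim ψ a := by
  rw [prim, Complex.smul_re, Complex.smul_im, smul_eq_mul, smul_eq_mul, mul_smul, mul_smul,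
    h.orEdge_smul ht, prim]
  ring

theorem IsLinVal.prim_neg (h : IsLinVal ψ) (a : ℂ) : prim ψ (-a) = -prim ψ a := by
  rw [prim, Complex.neg_re, Complex.neg_im, neg_smul, neg_smul, h.orEdge_neg, prim]

theorem exists_convexBody_of_sublinear {g : ℂ → ℝ} (h1 : ∀ t : ℝ, 0 < t → ∀ a, g (t • a) = t * g a)
    (h2 : ∀ a b, g (a + b) ≤ g a + g b) : ∃ M : ConvexBody ℂ, ∀ a, hs M a = g a := by
  have h0 : g 0 = 0 := by have := h1 2 (by norm_num) 0; rw [smul_zero] at this; linarith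
  have hex : ∀ a, a ≠ 0 → ∃ x : ℂ, om x a = g a ∧ ∀ c, om x c ≤ g c := by
    intro a ha
    obtain ⟨f, hf1, hf2⟩ := exists_extension_of_le_sublinear
      (LinearPMap.mkSpanSingleton (K := ℝ) a (g a) ha) g h1 h2 (by
        rintro ⟨x, hx⟩
        obtain ⟨t, rfl⟩ := Submodule.mem_span_singleton.1 hx
        have e : (LinearPMap.mkSpanSingleton (K := ℝ) a (g a) ha) ⟨t • a, hx⟩ = t * g a :=
          LinearPMap.mkSpanSingleton'_apply _ _ _ _ _
        rw [e]
        change _ ≤ g (t • a)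
        rcases lt_trichotomy t 0 with ht | rfl | ht
        · have e1 : g (t • a) = -t * g (-a) := by
            rw [← h1 (-t) (by linarith)]; simp
          have e2 := h2 a (-a)
          rw [add_neg_cancel, h0] at e2
          rw [e1]; nlinarith
        · rw [zero_smul, h0, zero_mul]
        · rw [h1 t ht])
    have hfo : ∀ c, f c = om ⟨f Complex.I, -f 1⟩ c := by
      intro c
      have : c = c.re • (1 : ℂ) + c.im • Complex.I := by apply Complex.ext <;> simp
      conv_lhs => rw [this]
      rw [map_add, map_smul, map_smul]
      simp [om]; ring
    refine ⟨⟨f Complex.I, -f 1⟩, ?_, fun c => by rw [← hfo]; exact hf2 c⟩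
    rw [← hfo]
    have := hf1 ⟨a, Submodule.mem_span_singleton_self a⟩
    rw [this]
    exact LinearPMap.mkSpanSingleton'_apply_self _ _ _ _
  have hset : {x : ℂ | ∀ c, om x c ≤ g c} = ⋂ c, {x | omL c x ≤ g c} := by
    ext x; simp [omL_apply]
  have hcl : IsClosed {x : ℂ | ∀ c, om x c ≤ g c} := by
    rw [hset]; exact isClosed_iInter fun c => isClosed_le_clm _ _
  refine ⟨⟨{x : ℂ | ∀ c, om x c ≤ g c}, ?_, ?_, ?_⟩, fun a => ?_⟩
  · rw [hset]; exact convex_iInter fun c => convex_le_clm _ _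
  · refine (Metric.isCompact_of_isClosed_isBounded hcl ?_)
    refine (Metric.isBounded_closedBall (x := (0 : ℂ))
      (r := |g 1| + |g (-1)| + (|g Complex.I| + |g (-Complex.I)|))).subset fun x hx => ?_
    have a1 := hx 1
    have a2 := hx (-1)
    have a3 := hx Complex.I
    have a4 := hx (-Complex.I)
    simp [om] at a1 a2 a3 a4
    rw [mem_closedBall_zero_iff]
    refine (Complex.norm_le_abs_re_add_abs_im x).trans ?_
    have b1 : |x.re| ≤ |g Complex.I| + |g (-Complex.I)| := abs_le.2
      ⟨by linarith [le_abs_self (g (-Complex.I)), abs_nonneg (g Complex.I)],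
        by linarith [le_abs_self (g Complex.I), abs_nonneg (g (-Complex.I))]⟩
    have b2 : |x.im| ≤ |g 1| + |g (-1)| := abs_le.2
      ⟨by linarith [le_abs_self (g 1), abs_nonneg (g (-1))],
        by linarith [le_abs_self (g (-1)), abs_nonneg (g 1)]⟩
    linarith
  · obtain ⟨x, -, hx⟩ := hex 1 one_ne_zero
    exact ⟨x, hx⟩
  · by_cases ha : a = 0
    · rw [ha, hs_zero, h0]
    apply le_antisymm
    · exact hs_le _ fun x hx => hx a
    · obtain ⟨x, hx1, hx2⟩ := hex a ha
      rw [← hx1]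
      refine om_le_hs _ ?_ a
      exact hx2

/-- A linear valuation satisfying the natural inequalities on segments and triangles is a mixed
area. -/
theorem IsLinVal.exists_eq_mv (h : IsLinVal ψ) (h1 : ∀ a, 0 ≤ sg ψ a)
    (h2 : ∀ a b, 0 < om a b → ψ (tri 0 b (a + b)) ≤ sg ψ a + sg ψ b) :
    ∃ M : ConvexBody ℂ, ∀ L, ψ L = mv M L := by
  set g : ℂ → ℝ := fun a => sg ψ a / 2 + prim ψ a with hg
  have hgn : ∀ a, g a + g (-a) = sg ψ a := fun a => by
    simp only [hg, h.sg_neg, h.prim_neg]; ring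
  have htri : ∀ a b, 0 < om a b → ψ (tri 0 a (a + b)) = g a + g b + g (-a - b) := by
    intro a b hab
    have e1 := orEdge_of_pos (ψ := ψ) hab
    rw [h.orEdge_eq] at e1
    simp only [hg]
    rw [show -a - b = -(a + b) by ring, h.prim_neg]
    linarith
  have hpos : ∀ a b, 0 < om a b → g (a + b) ≤ g a + g b := by
    intro a b hab
    have e1 := h.tri_add_tri hab.ne'
    have e2 := htri a b hab
    have e3 := h2 a b hab
    have e4 := hgn (a + b)
    rw [show -a - b = -(a + b) by ring] at e2
    linarith
  obtain ⟨M, hM⟩ := exists_convexBody_of_sublinear (g := g)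
    (fun t ht a => by simp only [hg, h.prim_smul ht, h.sg_smul ht.le]; ring)
    (fun a b => by
      rcases lt_trichotomy (om a b) 0 with h0 | h0 | h0
      · rw [add_comm a, add_comm (g a)]; exact hpos b a (by rw [om_swap]; linarith)
      · have e1 := h.orEdge_eq a b
        rw [orEdge_of_collinear h0] at e1
        have e2 : sg ψ (a + b) ≤ sg ψ a + sg ψ b := by
          by_cases ha : a = 0
          · rw [ha, zero_add, h.sg_zero, zero_add]
          · obtain ⟨t, rfl⟩ := exists_smul_of_om_eq_zero ha h0
            have : a + t • a = (1 + t) • a := by rw [add_smul, one_smul]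
            rw [this, h.sg_smul_abs, h.sg_smul_abs]
            have h3 : |1 + t| ≤ 1 + |t| := by
              have := abs_add_le 1 t
              rwa [abs_one] at this
            nlinarith [h1 a]
        simp only [hg]
        linarith
      · exact hpos a b h0)
  refine ⟨M, h.eq_of_oriented (isLinVal_mv M) (fun c => ?_) fun a b hab => ?_⟩
  · rw [mv_segB, hM, hM, hgn]; rfl
  · rw [mv_comm, mv_tri hab, edgeSum, hM, hM, hM, htri a b hab]

/-- A planar convex body is determined up to translation by its mixed areas. -/
theorem exists_translate_of_mv_eq {M M' : ConvexBody ℂ} (h : ∀ L, mv M' L = mv M L) :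
    ∃ x, M' = M.translate x := by
  set f : ℂ → ℝ := fun a => hs M' a - hs M a with hf
  have hneg : ∀ a, f (-a) = -f a := by
    intro a
    have := h (segB 0 a)
    rw [mv_segB, mv_segB] at this
    simp only [hf]
    linarith
  have hpos : ∀ a b, 0 < om a b → f (a + b) = f a + f b := by
    intro a b hab
    have := h (tri 0 a (a + b))
    rw [mv_comm, mv_tri hab, mv_comm, mv_tri hab, edgeSum, edgeSum] at this
    have e := hneg (a + b)
    rw [show -(a + b) = -a - b by ring] at e
    simp only [hf] at e ⊢
    linarith
  have hne : ∀ a b, om a b ≠ 0 → f (a + b) = f a + f b := by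
    intro a b hab
    rcases lt_or_gt_of_ne hab with h0 | h0
    · rw [add_comm a, add_comm (f a)]; exact hpos b a (by rw [om_swap]; linarith)
    · exact hpos a b h0
  have hsm0 : ∀ t : ℝ, 0 ≤ t → ∀ a, f (t • a) = t * f a := fun t ht a => by
    simp only [hf, hs_smul _ ht]; ring
  have hsm : ∀ (t : ℝ) a, f (t • a) = t * f a := by
    intro t a
    rcases le_total 0 t with ht | ht
    · exact hsm0 t ht a
    · rw [← neg_neg t, neg_smul, hneg, hsm0 _ (by linarith)]; ring
  have hlin : ∀ a, f a = om ⟨f Complex.I, -f 1⟩ a := by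
    intro a
    have e : a = a.re • (1 : ℂ) + a.im • Complex.I := by apply Complex.ext <;> simp
    have e2 : f (a.re • (1 : ℂ) + a.im • Complex.I) =
        f (a.re • (1 : ℂ)) + f (a.im • Complex.I) := by
      by_cases h0 : om (a.re • (1 : ℂ)) (a.im • Complex.I) = 0
      · have f0 : f 0 = 0 := by have := hsm 0 0; simpa using this
        have : a.re = 0 ∨ a.im = 0 := by
          rw [om_smul_left, om_smul_right] at h0
          simpa [om] using h0
        rcases this with h' | h' <;> rw [h', zero_smul, f0] <;> simp
      · exact hne _ _ h0
    rw [← e, hsm, hsm] at e2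
    rw [e2]
    simp [om]; ring
  refine ⟨⟨f Complex.I, -f 1⟩, eq_of_hs_eq fun a => ?_⟩
  rw [hs_translate, ← hlin]
  simp only [hf]
  ring

end PlanarRepresentation

section SurfaceArea

open CompactlySupported

theorem mixedVol_pair (M L : ConvexBody ℂ) : mixedVol volume ![M, L] = mv M L / 2 := by
  have e : (Finset.univ : Finset (Finset (Fin 2))) = {∅, {0}, {1}, {0, 1}} := by decide
  have h0 : volume (0 : Set ℂ) = 0 := by
    rw [← Set.singleton_zero]; exact measure_singleton _
  rw [mixedVol, e, Finset.sum_insert (by decide), Finset.sum_insert (by decide),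
    Finset.sum_insert (by decide)]
  have h2 : (∑ i ∈ ({0, 1} : Finset (Fin 2)), ((![M, L] i : ConvexBody ℂ) : Set ℂ)) =
      (M : Set ℂ) + L := by
    rw [Finset.sum_insert (by decide), Finset.sum_singleton]; rfl
  simp only [Finset.sum_empty, Finset.sum_singleton, h2, h0, Finset.card_empty,
    Finset.card_singleton,
    show ({0, 1} : Finset (Fin 2)).card = 2 from rfl, mv, vl, measureReal_def]
  simp
  ring

theorem hSupp_re_mul_conj (L : ConvexBody ℂ) (α : ℂ) :
    hSupp L (fun c => (c * (starRingEnd ℂ) α).re) = hs L (Complex.I * α) := by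
  rw [hs]
  congr 1
  funext c
  rw [omL_apply]
  simp [om]

theorem hs_le_mul_norm {M : ConvexBody ℂ} {R : ℝ} (hR : ∀ x ∈ (M : Set ℂ), ‖x‖ ≤ R) (a : ℂ) :
    hs M a ≤ R * ‖a‖ := by
  refine hs_le M fun x hx => ?_
  have h1 : om x a = ((starRingEnd ℂ) x * a).im := by simp [om]; ring
  have h2 := (le_abs_self _).trans (Complex.abs_im_le_norm ((starRingEnd ℂ) x * a))
  calc om x a ≤ ‖(starRingEnd ℂ) x * a‖ := by rw [h1]; exact h2
    _ = ‖x‖ * ‖a‖ := by rw [norm_mul, RCLike.norm_conj]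
    _ ≤ R * ‖a‖ := by gcongr; exact hR x hx

theorem continuous_hs_right (M : ConvexBody ℂ) : Continuous (hs M) := by
  obtain ⟨R, hR0, hR⟩ := M.exists_norm_le
  refine (LipschitzWith.of_dist_le_mul (K := ⟨R, hR0⟩) fun a b => ?_).continuous
  have h1 := hs_add_le M (a - b) b
  have h2 := hs_add_le M (b - a) a
  have h3 := hs_le_mul_norm hR (a - b)
  have h4 := hs_le_mul_norm hR (b - a)
  rw [sub_add_cancel] at h1 h2
  rw [norm_sub_rev] at h4
  rw [Real.dist_eq, dist_eq_norm, abs_le]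
  change _ ∧ _ ≤ R * _
  change -(R * _) ≤ _ ∧ _
  constructor <;> linarith

/-- The support function of a planar convex body on the unit circle. -/
def circleSupp (K : ConvexBody ℂ) : C_c(Metric.sphere (0 : ℂ) 1, ℝ) where
  toFun x := hs K (Complex.I * x)
  continuous_toFun := (continuous_hs_right K).comp (by fun_prop)
  hasCompactSupport' := HasCompactSupport.of_compactSpace _

theorem circleSupp_apply (K : ConvexBody ℂ) (x : Metric.sphere (0 : ℂ) 1) :
    circleSupp K x = hs K (Complex.I * x) := rfl

theorem circleSupp_add (K L : ConvexBody ℂ) :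
    circleSupp (K + L) = circleSupp K + circleSupp L := by
  ext x; exact hs_add K L _

theorem circleSupp_smul {t : ℝ} (ht : 0 ≤ t) (K : ConvexBody ℂ) :
    circleSupp (t • K) = t • circleSupp K := by
  ext x; exact hs_smul_body K ht _

theorem subset_of_circleSupp_le {K L : ConvexBody ℂ}
    (h : ∀ x, circleSupp K x ≤ circleSupp L x) : (K : Set ℂ) ⊆ L := by
  refine subset_of_hs_le fun a => ?_
  rcases eq_or_ne a 0 with rfl | ha
  · rw [hs_zero, hs_zero]
  have hn : (‖a‖ : ℝ) ≠ 0 := by simpa using ha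
  have hmem : -Complex.I * (‖a‖⁻¹ • a) ∈ Metric.sphere (0 : ℂ) 1 := by
    simp [hn]
  have e : a = ‖a‖ • (Complex.I * (-Complex.I * (‖a‖⁻¹ • a))) := by
    rw [← mul_assoc, mul_neg, Complex.I_mul_I, neg_neg, one_mul, smul_inv_smul₀ hn]
  have := h ⟨_, hmem⟩
  rw [circleSupp_apply, circleSupp_apply] at this
  rw [e, hs_smul _ (norm_nonneg a), hs_smul _ (norm_nonneg a)]
  gcongr

theorem mv_le_of_circleSupp_le (M : ConvexBody ℂ) {K L K' L' : ConvexBody ℂ}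
    (h : ∀ x, (circleSupp K - circleSupp L) x ≤ (circleSupp K' - circleSupp L') x) :
    mv M K - mv M L ≤ mv M K' - mv M L' := by
  have : ((K + L' : ConvexBody ℂ) : Set ℂ) ⊆ (K' + L : ConvexBody ℂ) := by
    refine subset_of_circleSupp_le fun x => ?_
    have := h x
    rw [circleSupp_add, circleSupp_add]
    simp only [CompactlySupportedContinuousMap.coe_add, CompactlySupportedContinuousMap.coe_sub,
      Pi.add_apply, Pi.sub_apply] at this ⊢
    linarith
  have := mv_mono M this
  rw [mv_add, mv_add] at this
  linarith

/-- Differences of support functions on the unit circle. -/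
def circleDiff : Submodule ℝ C_c(Metric.sphere (0 : ℂ) 1, ℝ) where
  carrier := {f | ∃ p : ConvexBody ℂ × ConvexBody ℂ, f = circleSupp p.1 - circleSupp p.2}
  add_mem' := by
    rintro _ _ ⟨p, rfl⟩ ⟨q, rfl⟩
    exact ⟨p + q, by rw [Prod.fst_add, Prod.snd_add, circleSupp_add, circleSupp_add]; abel⟩
  zero_mem' := ⟨(segB 0 0, segB 0 0), by simp⟩
  smul_mem' := by
    rintro c _ ⟨p, rfl⟩
    rcases le_total 0 c with hc | hc
    · exact ⟨(c • p.1, c • p.2), by rw [circleSupp_smul hc, circleSupp_smul hc, smul_sub]⟩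
    · refine ⟨((-c) • p.2, (-c) • p.1), ?_⟩
      rw [circleSupp_smul (neg_nonneg.2 hc), circleSupp_smul (neg_nonneg.2 hc)]
      module

theorem exists_of_mem_circleDiff (f : circleDiff) : ∃ p : ConvexBody ℂ × ConvexBody ℂ,
    (f : C_c(Metric.sphere (0 : ℂ) 1, ℝ)) = circleSupp p.1 - circleSupp p.2 := f.2

theorem sub_mem_circleDiff (K L : ConvexBody ℂ) : circleSupp K - circleSupp L ∈ circleDiff :=
  ⟨(K, L), rfl⟩

/-- The mixed area with `M` on differences of support functions. -/
def circleFun (M : ConvexBody ℂ) (f : circleDiff) : ℝ :=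
  mv M (exists_of_mem_circleDiff f).choose.1 - mv M (exists_of_mem_circleDiff f).choose.2

theorem circleFun_eq (M : ConvexBody ℂ) (f : circleDiff) {K L : ConvexBody ℂ}
    (h : (f : C_c(Metric.sphere (0 : ℂ) 1, ℝ)) = circleSupp K - circleSupp L) :
    circleFun M f = mv M K - mv M L := by
  have h' := h.symm.trans (exists_of_mem_circleDiff f).choose_spec
  refine le_antisymm (mv_le_of_circleSupp_le M fun x => ?_) (mv_le_of_circleSupp_le M fun x => ?_)
  · rw [← h']
  · rw [h']

/-- The mixed area with `M` as a partially defined linear functional. -/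
def circlePMap (M : ConvexBody ℂ) : C_c(Metric.sphere (0 : ℂ) 1, ℝ) →ₗ.[ℝ] ℝ where
  domain := circleDiff
  toFun :=
    { toFun := circleFun M
      map_add' := fun f g => by
        obtain ⟨p, hf⟩ := exists_of_mem_circleDiff f
        obtain ⟨q, hg⟩ := exists_of_mem_circleDiff g
        rw [circleFun_eq M f hf, circleFun_eq M g hg,
          circleFun_eq M (f + g) (K := p.1 + q.1) (L := p.2 + q.2), mv_add, mv_add]
        · ring
        · rw [Submodule.coe_add, hf, hg, circleSupp_add, circleSupp_add]; abel
      map_smul' := fun c f => by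
        obtain ⟨p, hf⟩ := exists_of_mem_circleDiff f
        rw [circleFun_eq M f hf, RingHom.id_apply, smul_eq_mul]
        rcases le_total 0 c with hc | hc
        · rw [circleFun_eq M (c • f) (K := c • p.1) (L := c • p.2), mv_smul _ hc, mv_smul _ hc]
          · ring
          · rw [Submodule.coe_smul, hf, circleSupp_smul hc, circleSupp_smul hc, smul_sub]
        · rw [circleFun_eq M (c • f) (K := (-c) • p.2) (L := (-c) • p.1),
            mv_smul _ (neg_nonneg.2 hc), mv_smul _ (neg_nonneg.2 hc)]
          · ring
          · rw [Submodule.coe_smul, hf, circleSupp_smul (neg_nonneg.2 hc),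
              circleSupp_smul (neg_nonneg.2 hc)]
            module }

/-- The cone of nonnegative functions on the unit circle. -/
def circleCone : PointedCone ℝ C_c(Metric.sphere (0 : ℂ) 1, ℝ) where
  carrier := {f | ∀ x, 0 ≤ f x}
  add_mem' := fun hf hg x => add_nonneg (hf x) (hg x)
  zero_mem' := fun _ => le_rfl
  smul_mem' := fun c _ hf x => mul_nonneg c.2 (hf x)

theorem exists_isSurfaceAreaMeasure (M : ConvexBody ℂ) : ∃ σ, IsSurfaceAreaMeasure M σ := by
  obtain ⟨g, hg, hpos⟩ := riesz_extension circleCone (circlePMap M) (by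
    intro f hx
    obtain ⟨p, hf⟩ := exists_of_mem_circleDiff f
    change 0 ≤ circleFun M f
    rw [circleFun_eq M f hf]
    have := mv_le_of_circleSupp_le M (K := segB 0 0) (L := segB 0 0) (K' := p.1) (L' := p.2)
      fun x => by
        rw [← hf, sub_self]
        exact hx x
    linarith) (by
    intro y
    obtain ⟨R, hR⟩ := isCompact_univ.exists_bound_of_continuousOn (f := y)
      y.continuous_toFun.continuousOn
    let D : ConvexBody ℂ := ⟨Metric.closedBall 0 1, convex_closedBall _ _,
      isCompact_closedBall _ _, ⟨0, by simp⟩⟩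
    let K : ConvexBody ℂ := (max R 0) • D
    refine ⟨⟨_, sub_mem_circleDiff K (segB 0 0)⟩, fun x => ?_⟩
    have h1 : 1 ≤ hs D (Complex.I * x) := by
      have := om_le_hs D (x := x) (Metric.sphere_subset_closedBall x.2) (Complex.I * x)
      have h2 : om x (Complex.I * x) = 1 := by
        have h3 : ‖(x : ℂ)‖ ^ 2 = 1 := by
          have := x.2
          rw [mem_sphere_zero_iff_norm] at this
          rw [this]; norm_num
        rw [← Complex.normSq_eq_norm_sq, Complex.normSq_apply] at h3
        simp [om]; linarith
      linarith
    have h2 : circleSupp K x = max R 0 * hs D (Complex.I * x) := by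
      rw [circleSupp_apply, hs_smul_body _ (le_max_right _ _)]
    have h3 : circleSupp (segB 0 0) x = 0 := by
      rw [circleSupp_apply, hs_segB_zero]; simp [om]
    have h4 := hR x trivial
    simp only [CompactlySupportedContinuousMap.coe_add, CompactlySupportedContinuousMap.coe_sub,
      Pi.add_apply, Pi.sub_apply, h2, h3]
    have h5 : max R 0 * 1 ≤ max R 0 * hs D (Complex.I * x) := by gcongr
    rw [Real.norm_eq_abs] at h4
    have := neg_abs_le (y x)
    have := le_max_left R 0
    linarith)
  let Λ : C_c(Metric.sphere (0 : ℂ) 1, ℝ) →ₚ[ℝ] ℝ := PositiveLinearMap.mk₀ g fun x hx => hpos x hx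
  have hemb : MeasurableEmbedding ((↑) : Metric.sphere (0 : ℂ) 1 → ℂ) :=
    MeasurableEmbedding.subtype_coe Metric.isClosed_sphere.measurableSet
  refine ⟨(RealRMK.rieszMeasure Λ).map (↑), inferInstance, ?_, fun L => ?_⟩
  · rw [hemb.map_apply, Set.preimage_compl, Subtype.coe_preimage_self, Set.compl_univ,
      measure_empty]
  · rw [hemb.integral_map, mixedVol_pair]
    simp only [hSupp_re_mul_conj]
    have h1 := RealRMK.integral_rieszMeasure Λ (circleSupp L)
    simp only [circleSupp_apply] at h1
    rw [h1]
    have h2 := hg ⟨_, sub_mem_circleDiff L (segB 0 0)⟩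
    have h3 : circleSupp (segB 0 0) = 0 := by
      ext x
      rw [circleSupp_apply, hs_segB_zero]; simp [om]
    change g (circleSupp L - circleSupp (segB 0 0)) =
      circleFun M ⟨_, sub_mem_circleDiff L (segB 0 0)⟩ at h2
    rw [circleFun_eq M ⟨_, sub_mem_circleDiff L (segB 0 0)⟩ rfl, h3, sub_zero, mv_segB, neg_zero,
      hs_zero] at h2
    change g (circleSupp L) = _
    rw [h2]; ring

end SurfaceArea

section Contravariant

/-- The complex `2 × 2` matrix with the given entries as a real-linear map of `ℂ × ℂ`. -/
def matC (a b c d : ℂ) : ℂ × ℂ →L[ℝ] ℂ × ℂ :=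
  ((mulC a).comp (ContinuousLinearMap.fst ℝ ℂ ℂ) +
      (mulC b).comp (ContinuousLinearMap.snd ℝ ℂ ℂ)).prod
    ((mulC c).comp (ContinuousLinearMap.fst ℝ ℂ ℂ) +
      (mulC d).comp (ContinuousLinearMap.snd ℝ ℂ ℂ))

theorem matC_apply (a b c d : ℂ) (x : ℂ × ℂ) :
    matC a b c d x = (a * x.1 + b * x.2, c * x.1 + d * x.2) := rfl

/-- The determinant pairing with `w` on `ℂ × ℂ`. -/
def detC (w : ℂ × ℂ) : ℂ × ℂ →L[ℝ] ℂ :=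
  (mulC w.2).comp (ContinuousLinearMap.fst ℝ ℂ ℂ) -
    (mulC w.1).comp (ContinuousLinearMap.snd ℝ ℂ ℂ)

theorem detC_apply (w x : ℂ × ℂ) : detC w x = w.2 * x.1 - w.1 * x.2 := rfl

/-- The properties, in coordinates, of the support functions `φ w K = h(Z K, w)` of a
contravariant Minkowski valuation that is homogeneous of degree `k`. -/
structure IsContra (k : ℕ) (φ : ℂ × ℂ → ConvexBody (ℂ × ℂ) → ℝ) : Prop where
  val : ∀ w, IsValuation (φ w)
  cont : ∀ w, Continuous (φ w)
  inv : ∀ w, IsTranslationInvariant (φ w)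
  hom : ∀ w (t : ℝ) K, 0 < t → φ w (t • K) = t ^ k * φ w K
  smul : ∀ w (t : ℝ) K, 0 ≤ t → φ (t • w) K = t * φ w K
  sub : ∀ w w' K, φ (w + w') K ≤ φ w K + φ w' K
  sl : ∀ a b c d w K, a * d - b * c = 1 →
    φ (matC a b c d w) (K.mapCLM (matC a b c d)) = φ w K

variable {k : ℕ} {φ : ℂ × ℂ → ConvexBody (ℂ × ℂ) → ℝ}

theorem IsContra.zero (h : IsContra k φ) (K) : φ 0 K = 0 := by
  have := h.smul 0 0 K le_rfl
  simpa using this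

/-- The action of diagonal matrices. -/
theorem IsContra.diag (h : IsContra (k + 1) φ) {s : ℝ} (hs : 0 < s) (K : ConvexBody (ℂ × ℂ)) :
    φ (0, 1) (K.mapCLM (matC 1 0 0 ((s ^ 2)⁻¹ : ℝ))) = (s ^ k)⁻¹ * φ (0, 1) K := by
  have hs' : (s : ℂ) ≠ 0 := by exact_mod_cast hs.ne'
  have h1 := h.sl s 0 0 (s⁻¹ : ℝ) (0, 1) K (by push_cast; field_simp; simp)
  have h2 : matC s 0 0 (s⁻¹ : ℝ) (0, 1) = s⁻¹ • ((0, 1) : ℂ × ℂ) := by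
    rw [matC_apply]; simp
  rw [h2, h.smul _ _ _ (inv_nonneg.2 hs.le)] at h1
  have h3 : K.mapCLM (matC s 0 0 (s⁻¹ : ℝ)) = s • K.mapCLM (matC 1 0 0 ((s ^ 2)⁻¹ : ℝ)) := by
    rw [ConvexBody.smul_eq_mapCLM, ConvexBody.mapCLM_mapCLM]
    congr 1
    refine ContinuousLinearMap.ext fun x => ?_
    change _ = s • matC 1 0 0 ((s ^ 2)⁻¹ : ℝ) x
    rw [matC_apply, matC_apply]
    ext1
    · simp
    · simp
      field_simp
  rw [h3, h.hom _ _ _ hs] at h1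
  have h4 : s ≠ 0 := hs.ne'
  generalize φ (0, 1) (K.mapCLM (matC 1 0 0 ((s ^ 2)⁻¹ : ℝ))) = y at h1 ⊢
  rw [← h1]
  field_simp
  ring

theorem IsContra.eq_detC (h : IsContra k φ) (ψ : ConvexBody (ℂ × ℂ) → ℝ)
    (hψ : ∀ K, φ (0, 1) K = ψ K) {w : ℂ × ℂ} {a c : ℂ} (hac : a * w.2 - w.1 * c = 1) (K) :
    φ w K = ψ (K.mapCLM (matC w.2 (-w.1) (-c) a)) := by
  rw [← hψ, ← h.sl w.2 (-w.1) (-c) a w K (by rw [← hac]; ring)]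
  congr 1
  rw [matC_apply]
  ext1
  · simp; ring
  · simp; linear_combination hac

theorem exists_det_eq_one {w : ℂ × ℂ} (hw : w ≠ 0) : ∃ a c, a * w.2 - w.1 * c = 1 := by
  by_cases h2 : w.2 = 0
  · have h1 : w.1 ≠ 0 := fun h1 => hw (Prod.ext h1 h2)
    exact ⟨0, -(w.1)⁻¹, by field_simp; simp⟩
  · exact ⟨(w.2)⁻¹, 0, by field_simp; simp⟩

/-- Vectors in the first coordinate line. -/
def inlC : ℂ →L[ℝ] ℂ × ℂ := ContinuousLinearMap.inl ℝ ℂ ℂ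

theorem inlC_injective : Function.Injective inlC := fun _ _ h => congrArg Prod.fst h

theorem IsContra.eq_fst (h : IsContra 1 φ) (K : ConvexBody (ℂ × ℂ)) :
    φ (0, 1) K = φ (0, 1) ((K.mapCLM (ContinuousLinearMap.fst ℝ ℂ ℂ)).mapCLM inlC) := by
  have hc : Continuous fun t : ℝ => φ (0, 1) (K.mapCLM (matC 1 0 0 t)) := by
    refine (h.cont _).comp (K.continuous_mapCLM_apply.comp ?_)
    have : (fun t : ℝ => matC 1 0 0 t) = fun t : ℝ => matC 1 0 0 0 + t • matC 0 0 0 1 := by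
      funext t
      refine ContinuousLinearMap.ext fun x => ?_
      change matC 1 0 0 t x = matC 1 0 0 0 x + t • matC 0 0 0 1 x
      simp only [matC_apply]
      ext1 <;> simp
    rw [this]
    fun_prop
  have h1 : ∀ n : ℕ, φ (0, 1) (K.mapCLM (matC 1 0 0 ((((n : ℝ) + 1) ^ 2)⁻¹ : ℝ))) =
      φ (0, 1) K := fun n => by
    rw [IsContra.diag (k := 0) h (by positivity) K]; simp
  have ht : Filter.Tendsto (fun n : ℕ => (((n : ℝ) + 1) ^ 2)⁻¹) Filter.atTop (nhds 0) := by
    have := (tendsto_one_div_add_atTop_nhds_zero_nat (𝕜 := ℝ)).pow 2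
    simpa using this
  have h2 := (hc.tendsto 0).comp ht
  have h3 : (fun t : ℝ => φ (0, 1) (K.mapCLM (matC 1 0 0 t))) ∘
      (fun n : ℕ => (((n : ℝ) + 1) ^ 2)⁻¹) = fun _ => φ (0, 1) K := funext h1
  rw [h3] at h2
  have h4 := tendsto_nhds_unique tendsto_const_nhds h2
  rw [h4, ConvexBody.mapCLM_mapCLM]
  congr 2
  refine ContinuousLinearMap.ext fun x => ?_
  change matC 1 0 0 ((0 : ℝ) : ℂ) x = (x.1, 0)
  rw [matC_apply]; simp

/-- A degree one contravariant valuation is a mixed area of the images under `det(·, w)`. -/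
theorem IsContra.exists_mv_of_degree_one (h : IsContra 1 φ) :
    ∃ M, ∀ w K, φ w K = mv M (K.mapCLM (detC w)) := by
  set ψ : ConvexBody ℂ → ℝ := fun L => φ (0, 1) (L.mapCLM inlC) with hψ
  have hlin : IsLinVal ψ := by
    refine ⟨(h.val _).comp_mapCLM inlC_injective, (h.cont _).comp (ConvexBody.continuous_mapCLM _),
      fun L x => ?_, fun t L ht => ?_⟩
    · simp only [hψ]
      rw [ConvexBody.mapCLM_translate, h.inv]
    · simp only [hψ]
      rw [← pow_one t, ← h.hom _ _ _ ht, pow_one, ConvexBody.smul_eq_mapCLM,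
        ConvexBody.smul_eq_mapCLM, ConvexBody.mapCLM_mapCLM, ConvexBody.mapCLM_mapCLM]
      congr 2
      refine ContinuousLinearMap.ext fun x => ?_
      change inlC (t • x) = t • inlC x
      rw [map_smul]
  have hdet : ∀ w K, φ w K = ψ (K.mapCLM (detC w)) := by
    intro w K
    rcases eq_or_ne w 0 with rfl | hw
    · rw [h.zero]
      have h0 := hlin.hom 2 (K.mapCLM (detC 0)) two_pos
      have h1 : (2 : ℝ) • K.mapCLM (detC 0) = K.mapCLM (detC 0) := by
        rw [ConvexBody.smul_eq_mapCLM, ConvexBody.mapCLM_mapCLM]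
        congr 1
        refine ContinuousLinearMap.ext fun x => ?_
        change (2 : ℝ) • detC 0 x = detC 0 x
        simp [detC_apply]
      rw [h1] at h0
      linarith
    · obtain ⟨a, c, hac⟩ := exists_det_eq_one hw
      rw [h.eq_detC _ (fun K => h.eq_fst K) hac]
      refine congrArg ψ ?_
      rw [ConvexBody.mapCLM_mapCLM]
      congr 1
      refine ContinuousLinearMap.ext fun x => ?_
      change (matC w.2 (-w.1) (-c) a x).1 = _
      rw [matC_apply, detC_apply]
      ring
  have hsub : ∀ K : ConvexBody (ℂ × ℂ), ψ (K.mapCLM (detC (-1, 1))) ≤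
      ψ (K.mapCLM (detC (0, 1))) + ψ (K.mapCLM (detC (-1, 0))) := fun K => by
    rw [← hdet, ← hdet, ← hdet]
    have := h.sub (0, 1) (-1, 0) K
    simpa using this
  obtain ⟨M, hM⟩ := hlin.exists_eq_mv (fun a => by
    have := hsub (segB 0 (a, -a))
    simp only [mapCLM_segB, detC_apply, map_zero] at this
    simp at this
    change sg ψ 0 ≤ sg ψ a + sg ψ (-a) at this
    rw [hlin.sg_zero, hlin.sg_neg] at this
    linarith) (fun a b _ => by
    have := hsub (tri 0 (0, b) (a, b))
    simp only [mapCLM_tri, detC_apply, map_zero] at this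
    simp at this
    rw [tri_rotate 0 0 a, tri_rotate 0 a 0, tri_self_right, tri_self_right, segB_comm] at this
    exact this)
  exact ⟨M, fun w K => by rw [hdet, hM]⟩

end Contravariant

section Slicing

theorem bext_eq_zero {V : Type*} [NormedAddCommGroup V] [NormedSpace ℝ V]
    {φ : ConvexBody V → ℝ} {S : Set V}
    (h : ∀ K : ConvexBody V, (K : Set V) = S → φ K = 0) : bext φ S = 0 := by
  rw [bext]
  split_ifs with h1
  · exact h _ rfl
  · rfl

theorem bext_strip_eq_sum {V : Type*} [NormedAddCommGroup V] [NormedSpace ℝ V]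
    {φ : ConvexBody V → ℝ} (hφ : IsValuation φ) {S : Set V} (hS : Convex ℝ S) (hc : IsCompact S)
    (l : V →L[ℝ] ℝ) (h0 : ∀ c, ∀ S' ⊆ S, bext φ (S' ∩ {x | l x = c}) = 0) (a : ℝ) {h : ℝ}
    (hh : 0 ≤ h) (N : ℕ) :
    bext φ (S ∩ {x | a ≤ l x} ∩ {x | l x ≤ a + N * h}) =
      ∑ i ∈ Finset.range N,
        bext φ (S ∩ {x | a + i * h ≤ l x} ∩ {x | l x ≤ a + (i + 1) * h}) := by
  induction N with
  | zero =>
    rw [Finset.sum_range_zero, ← h0 a S subset_rfl]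
    congr 1
    ext x
    simp only [Set.mem_inter_iff, Set.mem_ofPred_eq, Nat.cast_zero, zero_mul, add_zero]
    exact ⟨fun h => ⟨h.1.1, le_antisymm h.2 h.1.2⟩, fun h => ⟨⟨h.1, h.2.ge⟩, h.2.le⟩⟩
  | succ N ih =>
    rw [Finset.sum_range_succ, ← ih]
    have hcut := bext_cut hφ (S := S ∩ {x | a ≤ l x} ∩ {x | l x ≤ a + (N + 1 : ℕ) * h})
      ((hS.inter (convex_ge_clm l _)).inter (convex_le_clm l _))
      ((hc.inter_right (isClosed_ge_clm l _)).inter_right (isClosed_le_clm l _)) l (a + N * h)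
    rw [h0 _ _ (Set.inter_subset_left.trans Set.inter_subset_left), add_zero] at hcut
    rw [← hcut]
    have hN : (0 : ℝ) ≤ N * h := by positivity
    congr 2
    · ext x
      simp only [Set.mem_inter_iff, Set.mem_ofPred_eq]
      push_cast
      constructor
      · rintro ⟨⟨⟨h1, h2⟩, h3⟩, h4⟩; exact ⟨⟨h1, h2⟩, h4⟩
      · rintro ⟨⟨h1, h2⟩, h3⟩; exact ⟨⟨⟨h1, h2⟩, by linarith⟩, h3⟩
    · ext x
      simp only [Set.mem_inter_iff, Set.mem_ofPred_eq]
      push_cast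
      constructor
      · rintro ⟨⟨⟨h1, h2⟩, h3⟩, h4⟩; exact ⟨⟨h1, h4⟩, h3⟩
      · rintro ⟨⟨h1, h2⟩, h3⟩; exact ⟨⟨⟨h1, by linarith⟩, h3⟩, h2⟩

/-- A continuous translation invariant valuation on `ℂ × ℂ` that is homogeneous of degree two with
respect to dilations of the first factor. -/
structure IsBaseVal (Φ : ConvexBody (ℂ × ℂ) → ℝ) : Prop where
  val : IsValuation Φ
  cont : Continuous Φ
  inv : IsTranslationInvariant Φ
  base : ∀ (t : ℝ) K, 0 < t → Φ (K.mapCLM (matC t 0 0 1)) = t ^ 2 * Φ K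

/-- The dilation of the first factor with centre `c` and factor `h⁻¹`. -/
def zoom (c : ℂ) (h : ℝ) (K : ConvexBody (ℂ × ℂ)) : ConvexBody (ℂ × ℂ) :=
  (K.translate (-c, 0)).mapCLM (matC (h⁻¹ : ℝ) 0 0 1)

theorem mem_zoom {c : ℂ} {h : ℝ} (hh : h ≠ 0) {K : ConvexBody (ℂ × ℂ)} {x : ℂ × ℂ} :
    x ∈ (zoom c h K : Set (ℂ × ℂ)) ↔ (c + h * x.1, x.2) ∈ (K : Set (ℂ × ℂ)) := by
  have hh' : (h : ℂ) ≠ 0 := by exact_mod_cast hh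
  rw [zoom, ConvexBody.coe_mapCLM, ConvexBody.coe_translate, Set.image_image]
  constructor
  · rintro ⟨y, hy, rfl⟩
    simp only [matC_apply]
    convert hy
    · simp; field_simp; ring
    · simp
  · intro hx
    refine ⟨_, hx, ?_⟩
    simp only [matC_apply]
    ext1
    · simp; field_simp
    · simp

variable {Φ : ConvexBody (ℂ × ℂ) → ℝ}

theorem IsBaseVal.eq_zoom (hΦ : IsBaseVal Φ) (c : ℂ) {h : ℝ} (hh : 0 < h) (K : ConvexBody (ℂ × ℂ)) :
    Φ K = h ^ 2 * Φ (zoom c h K) := by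
  rw [zoom, hΦ.base _ _ (inv_pos.2 hh), hΦ.inv]
  field_simp

theorem IsBaseVal.exists_bound (hΦ : IsBaseVal Φ) (K : ConvexBody (ℂ × ℂ)) :
    ∃ C, 0 ≤ C ∧ ∀ (S : Set (ℂ × ℂ)) (c : ℂ) (h : ℝ), 0 < h → S ⊆ K →
      (∀ x ∈ S, ‖x.1 - c‖ ≤ h) → |bext Φ S| ≤ h ^ 2 * C := by
  obtain ⟨C, hC0, hC⟩ := ConvexBody.exists_bound hΦ.cont
    (B := Metric.closedBall (0 : ℂ) 1 ×ˢ (Prod.snd '' (K : Set (ℂ × ℂ))))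
    ((isCompact_closedBall _ _).prod (K.isCompact.image continuous_snd))
  refine ⟨C, hC0, fun S c h hh hS hx => ?_⟩
  by_cases hs : Convex ℝ S ∧ IsCompact S ∧ S.Nonempty
  swap
  · rw [bext, dif_neg hs, abs_zero]; positivity
  obtain ⟨T, rfl⟩ : ∃ T : ConvexBody (ℂ × ℂ), (T : Set (ℂ × ℂ)) = S :=
    ⟨⟨S, hs.1, hs.2.1, hs.2.2⟩, rfl⟩
  rw [bext_coe, hΦ.eq_zoom c hh, abs_mul, abs_of_pos (by positivity : 0 < h ^ 2), ← bext_coe Φ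
    (zoom c h T)]
  gcongr
  refine hC _ fun x hx' => ?_
  rw [mem_zoom hh.ne'] at hx'
  refine ⟨?_, _, hS hx', rfl⟩
  have := hx _ hx'
  simp only [add_sub_cancel_left, norm_mul, Complex.norm_real, Real.norm_eq_abs,
    abs_of_pos hh] at this
  rw [mem_closedBall_zero_iff]
  exact le_of_mul_le_mul_left (by linarith) hh

theorem IsBaseVal.eq_zero_of_point (hΦ : IsBaseVal Φ) {K : ConvexBody (ℂ × ℂ)} {p : ℂ}
    (h : ∀ x ∈ (K : Set (ℂ × ℂ)), x.1 = p) : Φ K = 0 := by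
  have h1 := hΦ.eq_zoom p two_pos K
  have h2 : zoom p 2 K = K.translate (-p, 0) := by
    apply ConvexBody.ext
    ext x
    change _ ∈ (zoom p 2 K : Set (ℂ × ℂ)) ↔ _
    rw [mem_zoom two_ne_zero, ConvexBody.mem_translate]
    constructor
    · intro hx
      have h3 := h _ hx
      have h4 : x.1 = 0 := by simpa using h3
      simpa [h4, Prod.sub_def] using hx
    · intro hx
      have h3 := h _ hx
      have h4 : x.1 = 0 := by simpa using h3
      simpa [h4, Prod.sub_def] using hx
  rw [h2, hΦ.inv] at h1
  linarith

theorem IsBaseVal.eq_zero_of_line (hΦ : IsBaseVal Φ) (l l' : ℂ →L[ℝ] ℝ)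
    (hl : ∀ x, ‖x‖ ≤ |l x| + |l' x|) {K : ConvexBody (ℂ × ℂ)} {c : ℝ}
    (h : ∀ x ∈ (K : Set (ℂ × ℂ)), l x.1 = c) : Φ K = 0 := by
  obtain ⟨C, hC0, hC⟩ := hΦ.exists_bound K
  set m : ℂ × ℂ →L[ℝ] ℝ := l'.comp (ContinuousLinearMap.fst ℝ ℂ ℂ) with hm
  obtain ⟨R₀, hR₀⟩ := K.isCompact.exists_bound_of_continuousOn (f := m) m.continuous.continuousOn
  set R := max R₀ 1 with hR
  have hR0 : 0 < R := lt_of_lt_of_le one_pos (le_max_right _ _)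
  have hbound : ∀ n : ℕ, |Φ K| ≤ (4 * R ^ 2 * C) * (1 / ((n : ℝ) + 1)) := by
    intro n
    have hpos : (0 : ℝ) < (n : ℝ) + 1 := by positivity
    have hs := bext_strip_eq_sum hΦ.val K.convex K.isCompact m (fun c' S' hS' => by
      refine bext_eq_zero fun T hT => ?_
      obtain ⟨y, hy⟩ := T.nonempty
      refine hΦ.eq_zero_of_point (p := y.1) fun x hx => ?_
      change y ∈ (T : Set _) at hy
      rw [hT] at hx hy
      have h1 := hl (x.1 - y.1)
      have h2 : m x = m y := by rw [show m x = c' from hx.2, show m y = c' from hy.2]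
      rw [map_sub, map_sub, h _ (hS' hx.1), h _ (hS' hy.1), sub_self, abs_zero, zero_add,
        show l' x.1 = l' y.1 from h2, sub_self, abs_zero] at h1
      exact sub_eq_zero.1 (norm_le_zero_iff.1 h1)) (-R) (h := 2 * R / (n + 1)) (by positivity)
      (n + 1)
    have hK : (K : Set (ℂ × ℂ)) ∩ {x | -R ≤ m x} ∩
        {x | m x ≤ -R + ((n + 1 : ℕ) : ℝ) * (2 * R / (n + 1))} = K := by
      refine Set.Subset.antisymm (Set.inter_subset_left.trans Set.inter_subset_left) fun x hx => ?_
      have h1 := hR₀ x hx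
      rw [Real.norm_eq_abs] at h1
      have h2 := abs_le.1 (h1.trans (le_max_left R₀ 1))
      refine ⟨⟨hx, h2.1⟩, ?_⟩
      change m x ≤ _
      push_cast
      rw [mul_div_cancel₀ _ hpos.ne']
      linarith [h2.2]
    rw [hK, bext_coe] at hs
    rw [hs]
    refine (Finset.abs_sum_le_sum_abs _ _).trans ?_
    have hterm : ∀ i ∈ Finset.range (n + 1), |bext Φ ((K : Set (ℂ × ℂ)) ∩
        {x | -R + i * (2 * R / (n + 1)) ≤ m x} ∩ {x | m x ≤ -R + (i + 1) * (2 * R / (n + 1))})|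
        ≤ (2 * R / (n + 1)) ^ 2 * C := by
      intro i _
      set S := (K : Set (ℂ × ℂ)) ∩
        {x | -R + i * (2 * R / (n + 1)) ≤ m x} ∩ {x | m x ≤ -R + (i + 1) * (2 * R / (n + 1))}
      rcases S.eq_empty_or_nonempty with hS | ⟨y, hy⟩
      · rw [hS, bext_empty, abs_zero]; positivity
      · refine hC S y.1 _ (by positivity) (Set.inter_subset_left.trans Set.inter_subset_left) ?_
        intro x hx
        have h1 := hl (x.1 - y.1)
        rw [map_sub, map_sub, h _ hx.1.1, h _ hy.1.1, sub_self, abs_zero, zero_add] at h1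
        refine h1.trans ?_
        have e1 : -R + i * (2 * R / (n + 1)) ≤ l' x.1 := hx.1.2
        have e2 : l' x.1 ≤ -R + (i + 1) * (2 * R / (n + 1)) := hx.2
        have e3 : -R + i * (2 * R / (n + 1)) ≤ l' y.1 := hy.1.2
        have e4 : l' y.1 ≤ -R + (i + 1) * (2 * R / (n + 1)) := hy.2
        rw [abs_le]
        constructor <;> linarith
    refine (Finset.sum_le_sum hterm).trans ?_
    rw [Finset.sum_const, Finset.card_range, nsmul_eq_mul]
    push_cast
    apply le_of_eq
    field_simp
    ring
  have hlim := (tendsto_one_div_add_atTop_nhds_zero_nat (𝕜 := ℝ)).const_mul (4 * R ^ 2 * C)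
  rw [mul_zero] at hlim
  have := ge_of_tendsto' hlim hbound
  exact abs_eq_zero.1 (le_antisymm this (abs_nonneg _))

/-- The real part of the first coordinate. -/
def reFst : ℂ × ℂ →L[ℝ] ℝ := Complex.reCLM.comp (ContinuousLinearMap.fst ℝ ℂ ℂ)

/-- The imaginary part of the first coordinate. -/
def imFst : ℂ × ℂ →L[ℝ] ℝ := Complex.imCLM.comp (ContinuousLinearMap.fst ℝ ℂ ℂ)

/-- The part of a set over a square in the first coordinate. -/
def overSq (S : Set (ℂ × ℂ)) (c : ℂ) (h : ℝ) : Set (ℂ × ℂ) :=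
  {x | x ∈ S ∧ c.re ≤ x.1.re ∧ x.1.re ≤ c.re + h ∧ c.im ≤ x.1.im ∧ x.1.im ≤ c.im + h}

theorem IsBaseVal.eq_sum (hΦ : IsBaseVal Φ) (K : ConvexBody (ℂ × ℂ)) {R : ℝ}
    (hR : ∀ x ∈ (K : Set (ℂ × ℂ)), |x.1.re| ≤ R ∧ |x.1.im| ≤ R) (n : ℕ) :
    Φ K = ∑ i ∈ Finset.range (n + 1), ∑ j ∈ Finset.range (n + 1),
      bext Φ (overSq K ⟨-R + i * (2 * R / (n + 1)), -R + j * (2 * R / (n + 1))⟩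
        (2 * R / (n + 1))) := by
  have hpos : (0 : ℝ) < (n : ℝ) + 1 := by positivity
  have hR0 : 0 ≤ R := by
    obtain ⟨x, hx⟩ := K.nonempty
    exact (abs_nonneg _).trans (hR x hx).1
  have hh : 0 ≤ 2 * R / ((n : ℝ) + 1) := by positivity
  have hre : ∀ c, ∀ S' ⊆ (K : Set (ℂ × ℂ)), bext Φ (S' ∩ {x | reFst x = c}) = 0 := by
    intro c S' _
    refine bext_eq_zero fun T hT => ?_
    refine hΦ.eq_zero_of_line Complex.reCLM Complex.imCLM
      (fun x => Complex.norm_le_abs_re_add_abs_im x) (c := c) fun x hx => ?_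
    rw [hT] at hx
    exact hx.2
  have him : ∀ c, ∀ S' ⊆ (K : Set (ℂ × ℂ)), bext Φ (S' ∩ {x | imFst x = c}) = 0 := by
    intro c S' _
    refine bext_eq_zero fun T hT => ?_
    refine hΦ.eq_zero_of_line Complex.imCLM Complex.reCLM
      (fun x => (Complex.norm_le_abs_re_add_abs_im x).trans_eq (add_comm _ _)) (c := c)
      fun x hx => ?_
    rw [hT] at hx
    exact hx.2
  have hend : -R + ((n + 1 : ℕ) : ℝ) * (2 * R / (n + 1)) = R := by
    push_cast
    rw [mul_div_cancel₀ _ hpos.ne']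
    ring
  have h1 := bext_strip_eq_sum hΦ.val K.convex K.isCompact reFst hre (-R) hh (n + 1)
  have hK : (K : Set (ℂ × ℂ)) ∩ {x | -R ≤ reFst x} ∩
      {x | reFst x ≤ -R + ((n + 1 : ℕ) : ℝ) * (2 * R / (n + 1))} = K := by
    refine Set.Subset.antisymm (Set.inter_subset_left.trans Set.inter_subset_left) fun x hx => ?_
    have h2 := abs_le.1 (hR x hx).1
    rw [hend]
    exact ⟨⟨hx, h2.1⟩, h2.2⟩
  rw [hK, bext_coe] at h1
  rw [h1]
  refine Finset.sum_congr rfl fun i _ => ?_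
  set S : Set (ℂ × ℂ) := (K : Set (ℂ × ℂ)) ∩ {x | -R + i * (2 * R / (n + 1)) ≤ reFst x} ∩
    {x | reFst x ≤ -R + (i + 1) * (2 * R / (n + 1))} with hS
  have hSK : S ⊆ K := Set.inter_subset_left.trans Set.inter_subset_left
  have h3 := bext_strip_eq_sum hΦ.val (S := S)
    ((K.convex.inter (convex_ge_clm _ _)).inter (convex_le_clm _ _))
    ((K.isCompact.inter_right (isClosed_ge_clm _ _)).inter_right (isClosed_le_clm _ _)) imFst
    (fun c S' hS' => him c S' (hS'.trans hSK)) (-R) hh (n + 1)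
  have hS2 : S ∩ {x | -R ≤ imFst x} ∩
      {x | imFst x ≤ -R + ((n + 1 : ℕ) : ℝ) * (2 * R / (n + 1))} = S := by
    refine Set.Subset.antisymm (Set.inter_subset_left.trans Set.inter_subset_left) fun x hx => ?_
    have h2 := abs_le.1 (hR x (hSK hx)).2
    rw [hend]
    exact ⟨⟨hx, h2.1⟩, h2.2⟩
  rw [hS2] at h3
  rw [h3]
  refine Finset.sum_congr rfl fun j _ => ?_
  congr 1
  ext x
  constructor
  · rintro ⟨⟨⟨⟨h1, h2⟩, h3⟩, h4⟩, h5⟩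
    refine ⟨h1, h2, ?_, h4, ?_⟩
    · have : x.1.re ≤ _ := h3
      change x.1.re ≤ -R + i * (2 * R / (n + 1)) + 2 * R / (n + 1)
      linarith
    · have : x.1.im ≤ _ := h5
      change x.1.im ≤ -R + j * (2 * R / (n + 1)) + 2 * R / (n + 1)
      linarith
  · rintro ⟨h1, h2, h3, h4, h5⟩
    refine ⟨⟨⟨⟨h1, h2⟩, ?_⟩, h4⟩, ?_⟩
    · change x.1.re ≤ -R + (i + 1) * (2 * R / (n + 1))
      simp only at h3
      linarith
    · change x.1.im ≤ -R + (j + 1) * (2 * R / (n + 1))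
      simp only at h5
      linarith

end Slicing

section Slicing

/-- A half-open square in the complex plane. -/
def cell (c : ℂ) (h : ℝ) : Set ℂ :=
  {x | (c.re ≤ x.re ∧ x.re < c.re + h) ∧ c.im ≤ x.im ∧ x.im < c.im + h}

theorem measurableSet_cell (c : ℂ) (h : ℝ) : MeasurableSet (cell c h) :=
  ((measurableSet_le measurable_const Complex.measurable_re).inter
    (measurableSet_lt Complex.measurable_re measurable_const)).inter
    ((measurableSet_le measurable_const Complex.measurable_im).inter
    (measurableSet_lt Complex.measurable_im measurable_const))

theorem volume_cell (c : ℂ) {h : ℝ} (hh : 0 ≤ h) : volume (cell c h) = ENNReal.ofReal (h ^ 2) := by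
  have e : cell c h = Complex.measurableEquivRealProd ⁻¹'
      (Set.Ico c.re (c.re + h) ×ˢ Set.Ico c.im (c.im + h)) := rfl
  rw [e, Complex.volume_preserving_equiv_real_prod.measure_preimage
    (measurableSet_Ico.prod measurableSet_Ico).nullMeasurableSet, Measure.volume_eq_prod,
    Measure.prod_prod, Real.volume_Ico, Real.volume_Ico, add_sub_cancel_left, add_sub_cancel_left,
    ← ENNReal.ofReal_mul hh, sq]

theorem norm_sub_le_of_mem_cell {c x y : ℂ} {h : ℝ}
    (hx : c.re ≤ x.re ∧ x.re ≤ c.re + h ∧ c.im ≤ x.im ∧ x.im ≤ c.im + h)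
    (hy : c.re ≤ y.re ∧ y.re ≤ c.re + h ∧ c.im ≤ y.im ∧ y.im ≤ c.im + h) :
    ‖x - y‖ ≤ 2 * h := by
  refine (Complex.norm_le_abs_re_add_abs_im _).trans ?_
  have h1 : |(x - y).re| ≤ h := by
    rw [Complex.sub_re, abs_le]; constructor <;> linarith
  have h2 : |(x - y).im| ≤ h := by
    rw [Complex.sub_im, abs_le]; constructor <;> linarith
  linarith

/-- The function with the value `g c` on the cells `cell c h` of a square grid. -/
def stepFn (g : ℂ → ℝ) (R h : ℝ) (N : ℕ) (x : ℂ) : ℝ :=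
  ∑ i ∈ Finset.range N, ∑ j ∈ Finset.range N,
    (cell ⟨-R + i * h, -R + j * h⟩ h).indicator (fun _ => g ⟨-R + i * h, -R + j * h⟩) x

theorem eq_of_grid {h s : ℝ} (hh : 0 < h) {i j : ℕ} (h1 : i * h ≤ s) (h2 : s < i * h + h)
    (h3 : j * h ≤ s) (h4 : s < j * h + h) : i = j := by
  have a : (i : ℝ) < j + 1 := lt_of_mul_lt_mul_right (by linarith) hh.le
  have b : (j : ℝ) < i + 1 := lt_of_mul_lt_mul_right (by linarith) hh.le
  norm_cast at a b
  omega

theorem exists_grid {h s : ℝ} (hh : 0 < h) {N : ℕ} (h0 : 0 ≤ s) (h1 : s < N * h) :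
    ∃ i < N, (i : ℝ) * h ≤ s ∧ s < i * h + h := by
  refine ⟨⌊s / h⌋₊, ?_, ?_, ?_⟩
  · rw [Nat.floor_lt (by positivity), div_lt_iff₀ hh]; exact h1
  · exact (le_div_iff₀ hh).1 (Nat.floor_le (by positivity))
  · have := (div_lt_iff₀ hh).1 (Nat.lt_floor_add_one (s / h))
    linarith

theorem stepFn_eq {g : ℂ → ℝ} {R h : ℝ} (hh : 0 < h) {N i j : ℕ} (hi : i < N) (hj : j < N) {x : ℂ}
    (hx : x ∈ cell ⟨-R + i * h, -R + j * h⟩ h) :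
    stepFn g R h N x = g ⟨-R + i * h, -R + j * h⟩ := by
  have hx0 := hx
  obtain ⟨⟨h1, h2⟩, h3, h4⟩ := hx
  simp only at h1 h2 h3 h4
  rw [stepFn, Finset.sum_eq_single i, Finset.sum_eq_single j]
  · exact Set.indicator_of_mem hx0 _
  · intro j' _ hj'
    refine Set.indicator_of_notMem (fun hx' => hj' ?_) _
    obtain ⟨_, h7, h8⟩ := hx'
    simp only at h7 h8
    exact eq_of_grid (s := x.im + R) hh (by linarith) (by linarith) (by linarith) (by linarith)
  · intro h'; exact absurd (Finset.mem_range.2 hj) h'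
  · intro i' _ hi'
    refine Finset.sum_eq_zero fun j' _ => ?_
    refine Set.indicator_of_notMem (fun hx' => hi' ?_) _
    obtain ⟨⟨h7, h8⟩, _⟩ := hx'
    simp only at h7 h8
    exact eq_of_grid (s := x.re + R) hh (by linarith) (by linarith) (by linarith) (by linarith)
  · intro h'; exact absurd (Finset.mem_range.2 hi) h'

theorem stepFn_eq_or (g : ℂ → ℝ) (R : ℝ) {h : ℝ} (hh : 0 < h) (N : ℕ) (x : ℂ) :
    (((-R ≤ x.re ∧ x.re < -R + N * h) ∧ -R ≤ x.im ∧ x.im < -R + N * h) ∧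
      ∃ c, x ∈ cell c h ∧ stepFn g R h N x = g c) ∨ (stepFn g R h N x = 0 ∧
      ¬ ((-R ≤ x.re ∧ x.re < -R + N * h) ∧ -R ≤ x.im ∧ x.im < -R + N * h)) := by
  by_cases hx : (-R ≤ x.re ∧ x.re < -R + N * h) ∧ -R ≤ x.im ∧ x.im < -R + N * h
  · obtain ⟨i, hi, h1, h2⟩ := exists_grid (s := x.re + R) (N := N) hh (by linarith [hx.1.1])
      (by linarith [hx.1.2])
    obtain ⟨j, hj, h3, h4⟩ := exists_grid (s := x.im + R) (N := N) hh (by linarith [hx.2.1])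
      (by linarith [hx.2.2])
    have hc : x ∈ cell ⟨-R + i * h, -R + j * h⟩ h := by
      refine ⟨⟨?_, ?_⟩, ?_, ?_⟩ <;> simp only <;> linarith
    exact Or.inl ⟨hx, _, hc, stepFn_eq hh hi hj hc⟩
  · refine Or.inr ⟨?_, hx⟩
    refine Finset.sum_eq_zero fun i hi => Finset.sum_eq_zero fun j hj => ?_
    refine Set.indicator_of_notMem (fun hx' => hx ?_) _
    obtain ⟨⟨h5, h6⟩, h7, h8⟩ := hx'
    simp only at h5 h6 h7 h8
    have hi' : ((i : ℝ) + 1) * h ≤ N * h := by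
      gcongr; exact_mod_cast Finset.mem_range.1 hi
    have hj' : ((j : ℝ) + 1) * h ≤ N * h := by
      gcongr; exact_mod_cast Finset.mem_range.1 hj
    have hi0 : 0 ≤ (i : ℝ) * h := by positivity
    have hj0 : 0 ≤ (j : ℝ) * h := by positivity
    refine ⟨⟨?_, ?_⟩, ?_, ?_⟩ <;> linarith

theorem integrable_indicator_cell (c : ℂ) {h : ℝ} (hh : 0 ≤ h) (a : ℝ) :
    Integrable ((cell c h).indicator fun _ => a) := by
  rw [integrable_indicator_iff (measurableSet_cell c h)]
  refine integrableOn_const ?_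
  rw [volume_cell c hh]
  exact ENNReal.ofReal_ne_top

theorem measurable_stepFn (g : ℂ → ℝ) (R h : ℝ) (N : ℕ) : Measurable (stepFn g R h N) :=
  Finset.measurable_fun_sum _ fun _ _ => Finset.measurable_fun_sum _ fun _ _ =>
    measurable_const.indicator (measurableSet_cell _ _)

theorem integral_stepFn (g : ℂ → ℝ) (R : ℝ) {h : ℝ} (hh : 0 ≤ h) (N : ℕ) :
    ∫ x, stepFn g R h N x = ∑ i ∈ Finset.range N, ∑ j ∈ Finset.range N,
      h ^ 2 * g ⟨-R + i * h, -R + j * h⟩ := by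
  simp only [stepFn]
  rw [integral_finsetSum _ fun i _ => integrable_finsetSum _ fun j _ =>
    integrable_indicator_cell _ hh _]
  refine Finset.sum_congr rfl fun i _ => ?_
  rw [integral_finsetSum _ fun j _ => integrable_indicator_cell _ hh _]
  refine Finset.sum_congr rfl fun j _ => ?_
  rw [integral_indicator_const _ (measurableSet_cell _ _), Measure.real, volume_cell _ hh,
    ENNReal.toReal_ofReal (by positivity), smul_eq_mul]

/-- The product of two planar convex bodies. -/
def prodBody (A L : ConvexBody ℂ) : ConvexBody (ℂ × ℂ) :=
  ⟨(A : Set ℂ) ×ˢ (L : Set ℂ), A.convex.prod L.convex, A.isCompact.prod L.isCompact,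
    A.nonempty.prod L.nonempty⟩

/-- The unit square. -/
def unitSq : ConvexBody ℂ :=
  ⟨{z | (0 ≤ z.re ∧ z.re ≤ 1) ∧ 0 ≤ z.im ∧ z.im ≤ 1},
    ((convex_ge_clm Complex.reCLM 0).inter (convex_le_clm Complex.reCLM 1)).inter
      ((convex_ge_clm Complex.imCLM 0).inter (convex_le_clm Complex.imCLM 1)),
    (isCompact_Icc (a := (0 : ℝ)) (b := 1)).reProdIm (isCompact_Icc (a := (0 : ℝ)) (b := 1)),
    ⟨0, by simp⟩⟩

theorem mem_unitSq {z : ℂ} :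
    z ∈ (unitSq : Set ℂ) ↔ (0 ≤ z.re ∧ z.re ≤ 1) ∧ 0 ≤ z.im ∧ z.im ≤ 1 := Iff.rfl

/-- The slice of a set over a point of the first factor. -/
def fib (K : Set (ℂ × ℂ)) (x : ℂ) : Set ℂ := {y | (x, y) ∈ K}

/-- A nonempty slice as a convex body. -/
def fibBody (K : ConvexBody (ℂ × ℂ)) (x : ℂ) (h : (fib K x).Nonempty) : ConvexBody ℂ :=
  ⟨fib K x, by
    intro y hy z hz s t hs ht hst
    have := K.convex hy hz hs ht hst
    have e : s • (x, y) + t • (x, z) = (x, s • y + t • z) := by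
      ext1
      · change s • x + t • x = x
        rw [← add_smul, hst, one_smul]
      · rfl
    rw [e] at this
    exact this,
    by
      refine (K.isCompact.image continuous_snd).of_isClosed_subset
        (K.isClosed.preimage (Continuous.prodMk_right x)) fun y hy => ⟨(x, y), hy, rfl⟩, h⟩

theorem mem_fibBody {K : ConvexBody (ℂ × ℂ)} {x : ℂ} {h : (fib K x).Nonempty} {y : ℂ} :
    y ∈ (fibBody K x h : Set ℂ) ↔ (x, y) ∈ (K : Set (ℂ × ℂ)) := Iff.rfl

variable {Φ : ConvexBody (ℂ × ℂ) → ℝ}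

theorem overSq_convex_compact (K : ConvexBody (ℂ × ℂ)) (c : ℂ) (h : ℝ) :
    Convex ℝ (overSq K c h) ∧ IsCompact (overSq K c h) := by
  have e : overSq K c h = (K : Set (ℂ × ℂ)) ∩ (({x | c.re ≤ reFst x} ∩ {x | reFst x ≤ c.re + h}) ∩
      ({x | c.im ≤ imFst x} ∩ {x | imFst x ≤ c.im + h})) := by
    ext x
    constructor
    · rintro ⟨h1, h2, h3, h4, h5⟩; exact ⟨h1, ⟨h2, h3⟩, h4, h5⟩
    · rintro ⟨h1, ⟨h2, h3⟩, h4, h5⟩; exact ⟨h1, h2, h3, h4, h5⟩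
  rw [e]
  exact ⟨K.convex.inter (((convex_ge_clm _ _).inter (convex_le_clm _ _)).inter
    ((convex_ge_clm _ _).inter (convex_le_clm _ _))),
    K.isCompact.inter_right (((isClosed_ge_clm _ _).inter (isClosed_le_clm _ _)).inter
    ((isClosed_ge_clm _ _).inter (isClosed_le_clm _ _)))⟩

/-- Near an interior point of the projection, the rescaled part of `K` over a small square is close
to the product of the unit square with the slice. -/
theorem dist_zoom_le {K : ConvexBody (ℂ × ℂ)} {x c : ℂ} {h r τ D : ℝ} (hh : 0 < h) (hr : 0 < r)
    (hτ : τ * r = 2 * h) (hτ1 : τ ≤ 1)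
    (hball : Metric.closedBall x r ⊆ Prod.fst '' (K : Set (ℂ × ℂ)))
    (hD : ∀ p ∈ (K : Set (ℂ × ℂ)), ∀ q ∈ (K : Set (ℂ × ℂ)), ‖p.2 - q.2‖ ≤ D)
    (hx : x ∈ cell c h) (hne : (fib K x).Nonempty) {T : ConvexBody (ℂ × ℂ)}
    (hT : (T : Set (ℂ × ℂ)) = overSq K c h) :
    dist (zoom c h T) (prodBody unitSq (fibBody K x hne)) ≤ τ * D := by
  have hτ0 : 0 < τ := by
    by_contra h'
    nlinarith [not_lt.1 h']
  have hD0 : 0 ≤ D := by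
    obtain ⟨p, hp⟩ := K.nonempty
    exact (norm_nonneg _).trans (hD p hp p hp)
  obtain ⟨⟨hx1, hx2⟩, hx3, hx4⟩ := hx
  refine ConvexBody.dist_le_of (by positivity) ?_ ?_
  · rintro ⟨u, y⟩ huy
    rw [mem_zoom hh.ne', hT] at huy
    obtain ⟨hK, h1, h2, h3, h4⟩ := huy
    simp only at hK h1 h2 h3 h4
    set x' := c + h * u with hx'
    have hn : ‖x' - x‖ ≤ 2 * h := norm_sub_le_of_mem_cell ⟨h1, h2, h3, h4⟩
      ⟨hx1, hx2.le, hx3, hx4.le⟩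
    obtain ⟨⟨z, yz⟩, hz, hze⟩ := hball (show x - τ⁻¹ • (x' - x) ∈ Metric.closedBall x r by
      rw [Metric.mem_closedBall, dist_eq_norm, sub_sub_cancel_left, norm_neg, norm_smul,
        Real.norm_of_nonneg (by positivity), inv_mul_le_iff₀ hτ0]
      linarith)
    simp only at hze
    have hmem := K.convex hK hz (by positivity : 0 ≤ (1 + τ)⁻¹) (by positivity : 0 ≤ (1 + τ)⁻¹ * τ)
      (by field_simp)
    have e : (1 + τ)⁻¹ • x' + ((1 + τ)⁻¹ * τ) • z = x := by
      rw [hze, smul_sub, smul_smul, mul_assoc, mul_inv_cancel₀ hτ0.ne', mul_one]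
      have : ((1 + τ)⁻¹ + (1 + τ)⁻¹ * τ) • x = x := by
        rw [show (1 + τ)⁻¹ + (1 + τ)⁻¹ * τ = 1 by field_simp, one_smul]
      rw [add_smul] at this
      rw [smul_sub]
      linear_combination (exp := 1) this
    refine ⟨(u, (1 + τ)⁻¹ • y + ((1 + τ)⁻¹ * τ) • yz), ⟨?_, ?_⟩, ?_⟩
    · change u ∈ (unitSq : Set ℂ)
      rw [mem_unitSq]
      simp only [hx', Complex.add_re, Complex.mul_re, Complex.ofReal_re, Complex.ofReal_im,
        zero_mul, sub_zero, Complex.add_im, Complex.mul_im, add_zero] at h1 h2 h3 h4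
      refine ⟨⟨?_, ?_⟩, ?_, ?_⟩ <;> nlinarith
    · rw [mem_fibBody]
      convert hmem using 1
      ext1
      · exact e.symm
      · rfl
    · rw [Prod.dist_eq]
      simp only [dist_self]
      refine max_le (by positivity) ?_
      rw [dist_eq_norm]
      have e2 : y - ((1 + τ)⁻¹ • y + ((1 + τ)⁻¹ * τ) • yz) = ((1 + τ)⁻¹ * τ) • (y - yz) := by
        have : ((1 + τ)⁻¹ + (1 + τ)⁻¹ * τ) • y = y := by
          rw [show (1 + τ)⁻¹ + (1 + τ)⁻¹ * τ = 1 by field_simp, one_smul]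
        rw [add_smul] at this
        rw [smul_sub]
        linear_combination (exp := 1) -this
      rw [e2, norm_smul, Real.norm_of_nonneg (by positivity)]
      refine mul_le_mul ?_ (hD _ hK _ hz) (norm_nonneg _) hτ0.le
      rw [inv_mul_le_iff₀ (by positivity)]
      nlinarith
  · rintro ⟨u, y⟩ ⟨hu, hy⟩
    change u ∈ (unitSq : Set ℂ) at hu
    change y ∈ (fibBody K x hne : Set ℂ) at hy
    rw [mem_unitSq] at hu
    rw [mem_fibBody] at hy
    obtain ⟨⟨u1, u2⟩, u3, u4⟩ := hu
    set x' := c + h * u with hx'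
    have hcell : c.re ≤ x'.re ∧ x'.re ≤ c.re + h ∧ c.im ≤ x'.im ∧ x'.im ≤ c.im + h := by
      simp only [hx', Complex.add_re, Complex.mul_re, Complex.ofReal_re, Complex.ofReal_im,
        zero_mul, sub_zero, Complex.add_im, Complex.mul_im, add_zero]
      refine ⟨?_, ?_, ?_, ?_⟩ <;> nlinarith
    have hn : ‖x' - x‖ ≤ 2 * h := norm_sub_le_of_mem_cell hcell ⟨hx1, hx2.le, hx3, hx4.le⟩
    obtain ⟨⟨z, yz⟩, hz, hze⟩ := hball (show x + τ⁻¹ • (x' - x) ∈ Metric.closedBall x r by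
      rw [Metric.mem_closedBall, dist_eq_norm, add_sub_cancel_left, norm_smul,
        Real.norm_of_nonneg (by positivity), inv_mul_le_iff₀ hτ0]
      linarith)
    simp only at hze
    have hmem := K.convex hy hz (sub_nonneg.2 hτ1) hτ0.le (by ring)
    have e : (1 - τ) • x + τ • z = x' := by
      rw [hze, smul_add, smul_smul, mul_inv_cancel₀ hτ0.ne', one_smul, sub_smul, one_smul]
      ring
    refine ⟨(u, (1 - τ) • y + τ • yz), ?_, ?_⟩
    · rw [mem_zoom hh.ne', hT]
      refine ⟨?_, hcell⟩
      convert hmem using 1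
      ext1
      · exact e.symm
      · rfl
    · rw [Prod.dist_eq]
      simp only [dist_self]
      refine max_le (by positivity) ?_
      rw [dist_eq_norm]
      have e2 : y - ((1 - τ) • y + τ • yz) = τ • (y - yz) := by
        rw [sub_smul, one_smul, smul_sub]; ring
      rw [e2, norm_smul, Real.norm_of_nonneg hτ0.le]
      exact mul_le_mul_of_nonneg_left (hD _ hy _ hz) hτ0.le

open Filter Topology in
/-- A valuation that is homogeneous in the first factor is the integral over the slices of the
induced valuation on the second factor. -/
theorem IsBaseVal.integral_fib (hΦ : IsBaseVal Φ) {Ψ : ConvexBody ℂ → ℝ}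
    (hΨ : ∀ L, Φ (prodBody unitSq L) = Ψ L) (K : ConvexBody (ℂ × ℂ)) :
    Integrable (fun x => bext Ψ (fib K x)) ∧ Φ K = ∫ x, bext Ψ (fib K x) := by
  obtain ⟨R₀, hR₀, hKR⟩ := K.exists_norm_le
  set R := R₀ + 1 with hR
  have hRpos : 0 < R := by positivity
  have hbox : ∀ p ∈ (K : Set (ℂ × ℂ)), |p.1.re| < R ∧ |p.1.im| < R := by
    intro p hp
    have h1 : ‖p.1‖ ≤ R₀ := (norm_fst_le p).trans (hKR p hp)
    exact ⟨by linarith [Complex.abs_re_le_norm p.1], by linarith [Complex.abs_im_le_norm p.1]⟩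
  obtain ⟨C, hC0, hC⟩ := hΦ.exists_bound K
  set h : ℕ → ℝ := fun n => 2 * R / (n + 1) with hh
  have hpos : ∀ n, 0 < h n := fun n => by positivity
  have hlim : Tendsto h atTop (𝓝 0) := by
    have := (tendsto_one_div_add_atTop_nhds_zero_nat (𝕜 := ℝ)).const_mul (2 * R)
    rw [mul_zero] at this
    refine this.congr fun n => ?_
    simp only [hh]; ring
  have hNh : ∀ n : ℕ, -R + ((n + 1 : ℕ) : ℝ) * h n = R := by
    intro n
    simp only [hh]
    push_cast
    field_simp
    ring
  set g : ℕ → ℂ → ℝ := fun n c => (h n ^ 2)⁻¹ * bext Φ (overSq K c (h n)) with hg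
  set F : ℕ → ℂ → ℝ := fun n => stepFn (g n) R (h n) (n + 1) with hF
  have h_int : ∀ n, ∫ x, F n x = Φ K := by
    intro n
    rw [hΦ.eq_sum K (fun p hp => ⟨(hbox p hp).1.le, (hbox p hp).2.le⟩) n]
    simp only [hF]
    rw [integral_stepFn _ _ (hpos n).le]
    refine Finset.sum_congr rfl fun i _ => Finset.sum_congr rfl fun j _ => ?_
    simp only [hg]
    rw [mul_inv_cancel_left₀ (by have := hpos n; positivity)]
  have hgC : ∀ n c, |g n c| ≤ 4 * C := by
    intro n c
    have h1 := hC (overSq K c (h n)) c (2 * h n) (by linarith [hpos n]) (fun p hp => hp.1)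
      fun p hp => norm_sub_le_of_mem_cell hp.2
        ⟨le_rfl, by linarith [hpos n], le_rfl, by linarith [hpos n]⟩
    simp only [hg]
    have := hpos n
    rw [abs_mul, abs_of_pos (by positivity), inv_mul_le_iff₀ (by positivity)]
    linarith
  set B : Set ℂ := Metric.closedBall 0 (2 * R) with hB
  have hbd : ∀ n x, ‖F n x‖ ≤ B.indicator (fun _ => 4 * C) x := by
    intro n x
    rcases stepFn_eq_or (g n) R (hpos n) (n + 1) x with ⟨hbx, c, hc, he⟩ | ⟨he, _⟩
    · rw [hNh] at hbx
      have hx : x ∈ B := by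
        rw [hB, mem_closedBall_zero_iff]
        refine (Complex.norm_le_abs_re_add_abs_im x).trans ?_
        have h1 : |x.re| ≤ R := abs_le.2 ⟨hbx.1.1, hbx.1.2.le⟩
        have h2 : |x.im| ≤ R := abs_le.2 ⟨hbx.2.1, hbx.2.2.le⟩
        linarith
      rw [Set.indicator_of_mem hx, Real.norm_eq_abs]
      simp only [hF]
      rw [he]
      exact hgC n c
    · simp only [hF]
      rw [he, norm_zero]
      exact Set.indicator_nonneg (fun _ _ => by positivity) _
  have hBint : Integrable (B.indicator fun _ => 4 * C) := by
    rw [integrable_indicator_iff measurableSet_closedBall]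
    exact integrableOn_const measure_closedBall_lt_top.ne
  set P : Set ℂ := Prod.fst '' (K : Set (ℂ × ℂ)) with hP
  have hPcl : IsClosed P := (K.isCompact.image continuous_fst).isClosed
  have hPconv : Convex ℝ P := K.convex.linear_image (LinearMap.fst ℝ ℂ ℂ)
  have hae : ∀ᵐ x : ℂ, Tendsto (fun n => F n x) atTop (𝓝 (bext Ψ (fib K x))) := by
    have hfr : ∀ᵐ x : ℂ, x ∉ frontier P := by
      rw [ae_iff]
      simp only [not_not]
      exact hPconv.addHaar_frontier volume
    filter_upwards [hfr] with x hx
    by_cases hxP : x ∈ P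
    · have hxint : x ∈ interior P := by
        by_contra hni
        exact hx ⟨subset_closure hxP, hni⟩
      obtain ⟨r, hr, hball⟩ := Metric.nhds_basis_closedBall.mem_iff.1 (mem_interior_iff_mem_nhds.1
        hxint)
      obtain ⟨⟨x₀, y₀⟩, hy₀, hxe⟩ := hxP
      simp only at hxe
      subst hxe
      have hne : (fib K x₀).Nonempty := ⟨y₀, hy₀⟩
      have hlimit : bext Ψ (fib K x₀) = Φ (prodBody unitSq (fibBody K x₀ hne)) := by
        rw [hΨ]; exact bext_coe Ψ (fibBody K x₀ hne)
      rw [hlimit, Metric.tendsto_atTop]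
      intro ε hε
      obtain ⟨δ, hδ, hδΦ⟩ := Metric.continuous_iff.1 hΦ.cont (prodBody unitSq (fibBody K x₀ hne)) ε
        hε
      have hev : ∀ᶠ n in atTop, 2 * h n / r < 1 ∧ 2 * h n / r * (2 * R) < δ := by
        have t1 : Tendsto (fun n => 2 * h n / r) atTop (𝓝 0) := by
          simpa using (hlim.const_mul 2).div_const r
        have t2 : Tendsto (fun n => 2 * h n / r * (2 * R)) atTop (𝓝 0) := by
          simpa using t1.mul_const (2 * R)
        exact (t1.eventually_lt_const one_pos).and (t2.eventually_lt_const hδ)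
      obtain ⟨N, hN⟩ := eventually_atTop.1 hev
      refine ⟨N, fun n hn => ?_⟩
      obtain ⟨hn1, hn2⟩ := hN n hn
      rcases stepFn_eq_or (g n) R (hpos n) (n + 1) x₀ with ⟨hbx, c, hc, he⟩ | ⟨_, hn'⟩
      · have hTne : (overSq K c (h n)).Nonempty :=
          ⟨(x₀, y₀), hy₀, hc.1.1, hc.1.2.le, hc.2.1, hc.2.2.le⟩
        set T : ConvexBody (ℂ × ℂ) := ⟨overSq K c (h n), (overSq_convex_compact K c (h n)).1,
          (overSq_convex_compact K c (h n)).2, hTne⟩ with hT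
        have hFv : F n x₀ = Φ (zoom c (h n) T) := by
          simp only [hF]
          rw [he]
          simp only [hg]
          rw [show overSq (K : Set (ℂ × ℂ)) c (h n) = (T : Set (ℂ × ℂ)) from rfl, bext_coe,
            hΦ.eq_zoom c (hpos n) T, inv_mul_cancel_left₀ (by have := hpos n; positivity)]
        rw [hFv]
        refine hδΦ _ (lt_of_le_of_lt ?_ hn2)
        refine dist_zoom_le (hpos n) hr (by field_simp) hn1.le hball (fun p hp q hq => ?_) hc hne
          rfl
        have h1 : ‖p.2‖ ≤ R₀ := (norm_snd_le p).trans (hKR p hp)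
        have h2 : ‖q.2‖ ≤ R₀ := (norm_snd_le q).trans (hKR q hq)
        linarith [norm_sub_le p.2 q.2]
      · exfalso
        rw [hNh] at hn'
        have h1 := hbox _ hy₀
        have h2 := abs_lt.1 h1.1
        have h3 := abs_lt.1 h1.2
        exact hn' ⟨⟨h2.1.le, h2.2⟩, h3.1.le, h3.2⟩
    · have hfib : fib K x = ∅ := by
        rw [Set.eq_empty_iff_forall_notMem]
        exact fun y hy => hxP ⟨(x, y), hy, rfl⟩
      rw [hfib, bext_empty]
      obtain ⟨r, hr, hball⟩ := Metric.nhds_basis_closedBall.mem_iff.1 (hPcl.isOpen_compl.mem_nhds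
        hxP)
      have hev : ∀ᶠ n in atTop, 2 * h n < r :=
        Tendsto.eventually_lt_const hr (by simpa using hlim.const_mul 2)
      refine tendsto_const_nhds.congr' ?_
      filter_upwards [hev] with n hn
      rcases stepFn_eq_or (g n) R (hpos n) (n + 1) x with ⟨hbx, c, hc, he⟩ | ⟨he, _⟩
      · simp only [hF]
        rw [he]
        simp only [hg]
        have : overSq (K : Set (ℂ × ℂ)) c (h n) = ∅ := by
          rw [Set.eq_empty_iff_forall_notMem]
          intro p hp
          refine hball (?_ : p.1 ∈ Metric.closedBall x r) ⟨p, hp.1, rfl⟩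
          rw [Metric.mem_closedBall, dist_eq_norm]
          exact (norm_sub_le_of_mem_cell hp.2 ⟨hc.1.1, hc.1.2.le, hc.2.1, hc.2.2.le⟩).trans hn.le
        rw [this, bext_empty, mul_zero]
      · exact he.symm
  have hmeas : ∀ n, AEStronglyMeasurable (F n) volume := fun n =>
    (measurable_stepFn _ _ _ _).aestronglyMeasurable
  have hI : Integrable (fun x => bext Ψ (fib K x)) := by
    refine hBint.mono' (aestronglyMeasurable_of_tendsto_ae atTop hmeas hae) ?_
    filter_upwards [hae] with x hx
    exact le_of_tendsto hx.norm (Eventually.of_forall fun n => hbd n x)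
  refine ⟨hI, ?_⟩
  have hT := tendsto_integral_of_dominated_convergence _ hmeas hBint
    (fun n => Eventually.of_forall (hbd n)) hae
  simp only [h_int] at hT
  exact tendsto_nhds_unique tendsto_const_nhds hT

end Slicing

section DegreeThree

variable {φ : ℂ × ℂ → ConvexBody (ℂ × ℂ) → ℝ} {Φ : ConvexBody (ℂ × ℂ) → ℝ}
  {ψ : ConvexBody ℂ → ℝ}

theorem IsContra.isBaseVal (h : IsContra 3 φ) : IsBaseVal (φ (0, 1)) where
  val := h.val _
  cont := h.cont _
  inv := h.inv _
  base t K ht := by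
    have e : K.mapCLM (matC t 0 0 1) = t • K.mapCLM (matC 1 0 0 ((√t ^ 2)⁻¹ : ℝ)) := by
      rw [ConvexBody.smul_eq_mapCLM, ConvexBody.mapCLM_mapCLM, Real.sq_sqrt ht.le]
      congr 1
      refine ContinuousLinearMap.ext fun x => ?_
      change _ = t • matC 1 0 0 (t⁻¹ : ℝ) x
      rw [matC_apply, matC_apply]
      have ht' : (t : ℂ) ≠ 0 := by exact_mod_cast ht.ne'
      ext1
      · simp
      · simp [ht']
    rw [e, h.hom _ _ _ ht, h.diag (k := 2) (Real.sqrt_pos.2 ht), Real.sq_sqrt ht.le]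
    field_simp

/-- The inclusion of the second factor. -/
def inrC : ℂ →L[ℝ] ℂ × ℂ := ContinuousLinearMap.inr ℝ ℂ ℂ

theorem inrC_injective : Function.Injective inrC := fun _ _ h => congrArg Prod.snd h

theorem prodBody_eq_add (A L : ConvexBody ℂ) :
    prodBody A L = L.mapCLM inrC + A.mapCLM inlC := by
  apply ConvexBody.ext
  rw [ConvexBody.coe_add]
  ext x
  rw [Set.mem_add]
  constructor
  · rintro ⟨h1, h2⟩
    exact ⟨_, ⟨x.2, h2, rfl⟩, _, ⟨x.1, h1, rfl⟩, Prod.ext (zero_add _) (add_zero _)⟩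
  · rintro ⟨_, ⟨y, hy, rfl⟩, _, ⟨z, hz, rfl⟩, rfl⟩
    constructor
    · change 0 + z ∈ (A : Set ℂ)
      rwa [zero_add]
    · change y + 0 ∈ (L : Set ℂ)
      rwa [add_zero]

theorem IsContra.isLinVal (h : IsContra 3 φ) :
    IsLinVal fun L => φ (0, 1) (prodBody unitSq L) where
  val := by
    simp only [prodBody_eq_add]
    exact ((h.val (0, 1)).comp_add (unitSq.mapCLM inlC)).comp_mapCLM inrC_injective
  cont := by
    simp only [prodBody_eq_add]
    exact (h.cont _).comp ((ConvexBody.continuous_mapCLM _).add continuous_const)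
  inv L x := by
    change φ (0, 1) (prodBody unitSq (L.translate x)) = φ (0, 1) (prodBody unitSq L)
    rw [prodBody_eq_add, ConvexBody.mapCLM_translate, ← ConvexBody.translate_add, h.inv,
      ← prodBody_eq_add]
  hom t L ht := by
    have ht' : (t : ℂ) ≠ 0 := by exact_mod_cast ht.ne'
    have e : prodBody unitSq (t • L) = t • (prodBody unitSq L).mapCLM (matC (t⁻¹ : ℝ) 0 0 1) := by
      rw [ConvexBody.smul_eq_mapCLM t ((prodBody unitSq L).mapCLM _), ConvexBody.mapCLM_mapCLM,
        prodBody_eq_add, prodBody_eq_add, ConvexBody.mapCLM_add, ConvexBody.mapCLM_mapCLM,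
        ConvexBody.mapCLM_mapCLM, ConvexBody.smul_eq_mapCLM, ConvexBody.mapCLM_mapCLM]
      congr 2
      · refine ContinuousLinearMap.ext fun x => ?_
        change ((0 : ℂ), t • x) = t • matC (t⁻¹ : ℝ) 0 0 1 (0, x)
        rw [matC_apply]
        ext1 <;> simp
      · refine ContinuousLinearMap.ext fun x => ?_
        change (x, (0 : ℂ)) = t • matC (t⁻¹ : ℝ) 0 0 1 (x, 0)
        rw [matC_apply]
        ext1 <;> simp [ht']
    rw [e, h.hom _ _ _ ht, h.isBaseVal.base _ _ (inv_pos.2 ht)]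
    field_simp

theorem mem_segB_smul {V : Type*} [NormedAddCommGroup V] [NormedSpace ℝ V] {r : ℝ} (hr : 0 ≤ r)
    (p x : V) : x ∈ (segB 0 (r • p) : Set V) ↔ ∃ t : ℝ, 0 ≤ t ∧ t ≤ r ∧ x = t • p := by
  rw [coe_segB, segment_eq_image]
  constructor
  · rintro ⟨t, ⟨h0, h1⟩, rfl⟩
    exact ⟨t * r, by positivity, by nlinarith, by simp [smul_smul]⟩
  · rintro ⟨t, h0, h1, rfl⟩
    rcases hr.eq_or_lt with rfl | hr
    · have : t = 0 := le_antisymm h1 h0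
      exact ⟨0, by simp, by simp [this]⟩
    · refine ⟨t / r, ⟨by positivity, by rw [div_le_one hr]; exact h1⟩, ?_⟩
      simp only [smul_zero, zero_add, smul_smul]
      rw [div_mul_cancel₀ _ hr.ne']

theorem mem_segB_zero {V : Type*} [NormedAddCommGroup V] [NormedSpace ℝ V]
    (p x : V) : x ∈ (segB 0 p : Set V) ↔ ∃ t : ℝ, 0 ≤ t ∧ t ≤ 1 ∧ x = t • p := by
  simpa using mem_segB_smul zero_le_one p x

theorem mem_smul_tri {V : Type*} [NormedAddCommGroup V] [NormedSpace ℝ V] {δ : ℝ} (hδ : 0 ≤ δ)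
    (p q x : V) : x ∈ ((δ • tri 0 p q : ConvexBody V) : Set V) ↔
      ∃ s t : ℝ, 0 ≤ s ∧ 0 ≤ t ∧ s + t ≤ δ ∧ x = s • p + t • q := by
  rw [ConvexBody.coe_smul, Set.mem_smul_set]
  constructor
  · rintro ⟨_, ⟨v, w, hv, hw, hvw, rfl⟩, rfl⟩
    refine ⟨δ * v, δ * w, by positivity, by positivity, by nlinarith, ?_⟩
    simp [smul_smul]
  · rintro ⟨s, t, hs, ht, hst, rfl⟩
    rcases hδ.eq_or_lt with rfl | hδ
    · have h1 : s = 0 := by linarith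
      have h2 : t = 0 := by linarith
      exact ⟨0, ⟨0, 0, le_rfl, le_rfl, by norm_num, by simp⟩, by simp [h1, h2]⟩
    · refine ⟨_, ⟨s / δ, t / δ, by positivity, by positivity, ?_, rfl⟩, ?_⟩
      · rw [← add_div, div_le_one hδ]; exact hst
      · simp only [sub_zero, zero_add, smul_add, smul_smul]
        rw [mul_div_cancel₀ _ hδ.ne', mul_div_cancel₀ _ hδ.ne']

theorem om_coord {a b : ℂ} (h : om a b ≠ 0) {m s m' s' : ℝ}
    (e : m • a + s • b = m' • a + s' • b) : m = m' ∧ s = s' := by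
  have h1 := congrArg (fun x => om x b) e
  have h2 := congrArg (fun x => om a x) e
  simp only [om_add_left, om_add_right, om_smul_left, om_smul_right, om_self, mul_zero, add_zero,
    zero_add] at h1 h2
  exact ⟨mul_right_cancel₀ h h1, mul_right_cancel₀ h h2⟩

theorem vl_par (a b : ℂ) : vl (segB 0 a + segB 0 b) = |om a b| := by
  rw [vl_add_segB, vl_segB_zero, hs_segB_zero, hs_segB_zero, om_neg_right]
  rcases le_total 0 (om a b) with h | h
  · rw [abs_of_nonneg h, max_eq_right h, max_eq_left (by linarith)]; ring
  · rw [abs_of_nonpos h, max_eq_left h, max_eq_right (by linarith)]; ring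

theorem IsLinVal.par_smul (h : IsLinVal ψ) {a b : ℂ} (hab : om a b ≠ 0) {r : ℝ} (hr : 0 ≤ r) :
    ψ (segB 0 (r • a) + segB 0 b) = r * sg ψ a + sg ψ b := by
  rcases hr.eq_or_lt with rfl | hr
  · rw [zero_smul, add_comm, add_segB_zero_self, zero_mul, zero_add]; rfl
  · rw [h.par (by rw [om_smul_left]; exact mul_ne_zero hr.ne' hab), h.sg_smul hr.le]

/-- The body used to compare the values of a valuation in different directions. -/
def wedge (δ : ℝ) (p q p' q' : ℂ) : ConvexBody (ℂ × ℂ) :=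
  segB 0 ((p, 0) : ℂ × ℂ) + segB 0 ((0, q') : ℂ × ℂ) + δ • tri 0 ((q, 0) : ℂ × ℂ) (0, p')

theorem mem_wedge {δ : ℝ} (hδ : 0 ≤ δ) {p q p' q' : ℂ} {x : ℂ × ℂ} :
    x ∈ (wedge δ p q p' q' : Set (ℂ × ℂ)) ↔ ∃ m n s t : ℝ, (0 ≤ m ∧ m ≤ 1) ∧ (0 ≤ n ∧ n ≤ 1) ∧
      0 ≤ s ∧ 0 ≤ t ∧ s + t ≤ δ ∧ x = (m • p + s • q, t • p' + n • q') := by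
  rw [wedge, ConvexBody.coe_add, ConvexBody.coe_add]
  simp only [Set.mem_add, mem_segB_zero, mem_smul_tri hδ]
  constructor
  · rintro ⟨_, ⟨_, ⟨m, hm0, hm1, rfl⟩, _, ⟨n, hn0, hn1, rfl⟩, rfl⟩, _,
      ⟨s, t, hs, ht, hst, rfl⟩, rfl⟩
    refine ⟨m, n, s, t, ⟨hm0, hm1⟩, ⟨hn0, hn1⟩, hs, ht, hst, ?_⟩
    ext1
    · simp
    · simp [add_comm]
  · rintro ⟨m, n, s, t, ⟨hm0, hm1⟩, ⟨hn0, hn1⟩, hs, ht, hst, rfl⟩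
    refine ⟨_, ⟨_, ⟨m, hm0, hm1, rfl⟩, _, ⟨n, hn0, hn1, rfl⟩, rfl⟩, _,
      ⟨s, t, hs, ht, hst, rfl⟩, ?_⟩
    ext1
    · simp
    · simp [add_comm]

theorem integrable_indicator_body (P : ConvexBody ℂ) (c : ℝ) :
    Integrable ((P : Set ℂ).indicator fun _ => c) := by
  rw [integrable_indicator_iff P.isClosed.measurableSet]
  exact integrableOn_const P.isCompact.measure_lt_top.ne

theorem integral_indicator_body (P : ConvexBody ℂ) (c : ℝ) :
    ∫ x, (P : Set ℂ).indicator (fun _ => c) x = vl P * c := by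
  rw [integral_indicator_const _ P.isClosed.measurableSet, smul_eq_mul]; rfl

theorem wedge_le (hΦ : IsBaseVal Φ) (hψ : IsLinVal ψ) (hΨ : ∀ L, Φ (prodBody unitSq L) = ψ L)
    (h0 : ∀ a, 0 ≤ sg ψ a) {p q p' q' : ℂ} (hpq : om p q ≠ 0) (hpq' : om p' q' ≠ 0) {δ : ℝ}
    (hδ : 0 < δ) :
    Φ (wedge δ p q p' q') ≤ δ * |om p q| * (δ * sg ψ p' + sg ψ q') := by
  obtain ⟨hI, hK⟩ := hΦ.integral_fib hΨ (wedge δ p q p' q')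
  set P : ConvexBody ℂ := segB 0 (δ • q) + segB 0 p with hP
  have hvl : vl P = δ * |om p q| := by
    rw [hP, vl_par, om_smul_left, abs_mul, abs_of_pos hδ, om_swap, abs_neg]
  rw [hK, ← hvl, ← integral_indicator_body]
  refine integral_mono hI (integrable_indicator_body _ _) fun x => ?_
  by_cases hx : (fib (wedge δ p q p' q') x).Nonempty
  · obtain ⟨y, hy⟩ := hx
    obtain ⟨m, n, s, t, hm, hn, hs, ht, hst, he⟩ := (mem_wedge hδ.le).1 hy
    have hxe : x = m • p + s • q := congrArg Prod.fst he
    have hxP : x ∈ (P : Set ℂ) := by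
      rw [hP, ConvexBody.coe_add, Set.mem_add]
      refine ⟨s • q, (mem_segB_smul hδ.le _ _).2 ⟨s, hs, by linarith, rfl⟩, m • p,
        (mem_segB_zero _ _).2 ⟨m, hm.1, hm.2, rfl⟩, by rw [hxe, add_comm]⟩
    have hfib : ∀ y, y ∈ fib (wedge δ p q p' q') x ↔
        y ∈ ((segB 0 ((δ - s) • p') + segB 0 q' : ConvexBody ℂ) : Set ℂ) := by
      intro y
      rw [ConvexBody.coe_add, Set.mem_add]
      constructor
      · intro hy
        obtain ⟨m', n', s', t', hm', hn', hs', ht', hst', he'⟩ := (mem_wedge hδ.le).1 hy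
        have h1 : m • p + s • q = m' • p + s' • q := hxe.symm.trans (congrArg Prod.fst he')
        obtain ⟨-, rfl⟩ := om_coord hpq h1
        exact ⟨t' • p', (mem_segB_smul (by linarith) _ _).2 ⟨t', ht', by linarith, rfl⟩, n' • q',
          (mem_segB_zero _ _).2 ⟨n', hn'.1, hn'.2, rfl⟩, (congrArg Prod.snd he').symm⟩
      · rintro ⟨_, h1, _, h2, rfl⟩
        obtain ⟨t', h3, h4, rfl⟩ := (mem_segB_smul (by linarith) _ _).1 h1
        obtain ⟨n', h5, h6, rfl⟩ := (mem_segB_zero _ _).1 h2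
        exact (mem_wedge hδ.le).2 ⟨m, n', s, t', hm, ⟨h5, h6⟩, hs, h3, by linarith, by rw [hxe]⟩
    change bext ψ (fib (wedge δ p q p' q') x) ≤ _
    rw [bext_eq_of_mem_iff ψ _ hfib, Set.indicator_of_mem hxP, hψ.par_smul hpq' (by linarith)]
    have := h0 p'
    nlinarith
  · change bext ψ (fib (wedge δ p q p' q') x) ≤ _
    rw [Set.not_nonempty_iff_eq_empty.1 hx, bext_empty]
    refine Set.indicator_nonneg (fun _ _ => ?_) _
    have h1 := h0 p'
    have h2 := h0 q'
    positivity

theorem IsContra.sg_nonneg (h : IsContra 3 φ) (a : ℂ) :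
    0 ≤ sg (fun L => φ (0, 1) (prodBody unitSq L)) a := by
  set K := prodBody unitSq (segB 0 a) with hK
  have h1 := h.sub (0, 1) (0, -1) K
  have h2 := h.sl (-1) 0 0 (-1) (0, -1) K (by norm_num)
  have e1 : matC (-1) 0 0 (-1) ((0, -1) : ℂ × ℂ) = (0, 1) := by
    rw [matC_apply]; ext1 <;> simp
  have e2 : K.mapCLM (matC (-1) 0 0 (-1)) = K.translate (-(1 + Complex.I), -a) := by
    apply ConvexBody.ext
    ext x
    rw [ConvexBody.coe_mapCLM, ConvexBody.mem_translate]
    constructor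
    · rintro ⟨y, ⟨hy1, hy2⟩, rfl⟩
      change _ ∈ (unitSq : Set ℂ) at hy1
      change _ ∈ (segB 0 a : Set ℂ) at hy2
      obtain ⟨t, ht0, ht1, hty⟩ := (mem_segB_zero _ _).1 hy2
      rw [mem_unitSq] at hy1
      rw [matC_apply]
      constructor
      · rw [mem_unitSq]
        simp
        refine ⟨⟨?_, ?_⟩, ?_, ?_⟩ <;> linarith
      · change _ ∈ (segB 0 a : Set ℂ)
        refine (mem_segB_zero _ _).2 ⟨1 - t, by linarith, by linarith, ?_⟩
        simp [hty]
        ring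
    · rintro ⟨hy1, hy2⟩
      change _ ∈ (unitSq : Set ℂ) at hy1
      change _ ∈ (segB 0 a : Set ℂ) at hy2
      obtain ⟨t, ht0, ht1, hty⟩ := (mem_segB_zero _ _).1 hy2
      rw [mem_unitSq] at hy1
      refine ⟨-x, ⟨?_, ?_⟩, ?_⟩
      · rw [mem_unitSq]
        simp at hy1
        simp
        refine ⟨⟨?_, ?_⟩, ?_, ?_⟩ <;> linarith
      · change _ ∈ (segB 0 a : Set ℂ)
        refine (mem_segB_zero _ _).2 ⟨1 - t, by linarith, by linarith, ?_⟩
        simp at hty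
        simp
        linear_combination -hty
      · rw [matC_apply]
        ext1 <;> simp
  rw [e1, e2, h.inv] at h2
  have e3 : ((0, 1) : ℂ × ℂ) + (0, -1) = 0 := by ext1 <;> simp
  rw [e3, h.zero, ← h2] at h1
  change 0 ≤ φ (0, 1) K
  linarith

end DegreeThree

section DegreeThree

variable {φ : ℂ × ℂ → ConvexBody (ℂ × ℂ) → ℝ} {Φ : ConvexBody (ℂ × ℂ) → ℝ}
  {ψ : ConvexBody ℂ → ℝ}

/-- A sheared copy of the body `wedge δ a (-b) a b`. -/
def shear (δ : ℝ) (a b : ℂ) : ConvexBody (ℂ × ℂ) :=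
  (wedge δ a (-b) a b).mapCLM (matC 1 (-1) 0 1)

theorem mem_fib_shear {δ : ℝ} (hδ : 0 ≤ δ) {a b z y : ℂ} :
    y ∈ fib (shear δ a b) z ↔ ∃ m n s t : ℝ, (0 ≤ m ∧ m ≤ 1) ∧ (0 ≤ n ∧ n ≤ 1) ∧
      0 ≤ s ∧ 0 ≤ t ∧ s + t ≤ δ ∧ z = (m - t) • a + (s + n) • (-b) ∧ y = t • a + n • b := by
  change (z, y) ∈ (shear δ a b : Set (ℂ × ℂ)) ↔ _
  rw [shear, ConvexBody.coe_mapCLM]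
  constructor
  · rintro ⟨x, hx, he⟩
    obtain ⟨m, n, s, t, hm, hn, hs, ht, hst, rfl⟩ := (mem_wedge hδ).1 hx
    rw [matC_apply] at he
    have h1 := congrArg Prod.fst he
    have h2 := congrArg Prod.snd he
    simp only at h1 h2
    refine ⟨m, n, s, t, hm, hn, hs, ht, hst, ?_, ?_⟩
    · rw [← h1]
      simp only [Complex.real_smul]; push_cast; ring
    · rw [← h2]
      ring
  · rintro ⟨m, n, s, t, hm, hn, hs, ht, hst, rfl, rfl⟩
    refine ⟨_, (mem_wedge hδ).2 ⟨m, n, s, t, hm, hn, hs, ht, hst, rfl⟩, ?_⟩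
    rw [matC_apply]
    ext1
    · simp only [Complex.real_smul]; push_cast; ring
    · simp

theorem abs_bext_fib_shear_le (hψ : IsLinVal ψ) {a b : ℂ} (hab : om a b ≠ 0) {C : ℝ} (hC0 : 0 ≤ C)
    (hC : ∀ S ⊆ ((segB 0 a + segB 0 (-b) : ConvexBody ℂ) : Set ℂ), |bext ψ S| ≤ C) {δ : ℝ}
    (hδ : 0 < δ) (z : ℂ) : |bext ψ (fib (shear δ a b) z)| ≤ δ * C := by
  rcases (fib (shear δ a b) z).eq_empty_or_nonempty with h | h
  · rw [h, bext_empty, abs_zero]; positivity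
  obtain ⟨y₀, hy₀⟩ := h
  obtain ⟨m, n, s, t, hm, hn, hs, ht, hst, hz, hy⟩ := (mem_fib_shear hδ.le).1 hy₀
  set F := fibBody (shear δ a b) z ⟨y₀, hy₀⟩ with hF
  have hab' : om a (-b) ≠ 0 := by rw [om_neg_right]; exact neg_ne_zero.2 hab
  have h1 : ψ (δ⁻¹ • F.translate (-((s + n) • b))) = δ⁻¹ * ψ F := by
    rw [hψ.hom _ _ (inv_pos.2 hδ), hψ.inv]
  have h2 := hC (δ⁻¹ • F.translate (-((s + n) • b)) : ConvexBody ℂ) (by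
    rw [ConvexBody.coe_smul, ConvexBody.coe_translate]
    rintro _ ⟨_, ⟨y, hy, rfl⟩, rfl⟩
    obtain ⟨m', n', s', t', hm', hn', hs', ht', hst', hz', rfl⟩ := (mem_fib_shear hδ.le).1 hy
    obtain ⟨-, h3⟩ := om_coord hab' (hz.symm.trans hz')
    rw [ConvexBody.coe_add, Set.mem_add]
    refine ⟨(δ⁻¹ * t') • a, (mem_segB_zero _ _).2 ⟨_, by positivity, ?_, rfl⟩, (δ⁻¹ * s') • (-b),
      (mem_segB_zero _ _).2 ⟨_, by positivity, ?_, rfl⟩, ?_⟩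
    · rw [inv_mul_le_iff₀ hδ]; linarith
    · rw [inv_mul_le_iff₀ hδ]; linarith
    · rw [h3]
      simp only [Complex.real_smul]; push_cast; ring)
  rw [bext_coe, h1, abs_mul, abs_of_pos (inv_pos.2 hδ), inv_mul_le_iff₀ hδ] at h2
  rwa [show fib (shear δ a b : Set (ℂ × ℂ)) z = (F : Set ℂ) from rfl, bext_coe]

theorem le_shear (hΦ : IsBaseVal Φ) (hψ : IsLinVal ψ) (hΨ : ∀ L, Φ (prodBody unitSq L) = ψ L)
    {a b : ℂ} (hab : om a b ≠ 0) {C : ℝ} (hC0 : 0 ≤ C)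
    (hC : ∀ S ⊆ ((segB 0 a + segB 0 (-b) : ConvexBody ℂ) : Set ℂ), |bext ψ S| ≤ C) {δ : ℝ}
    (hδ : 0 < δ) (hδ1 : δ < 1) :
    (1 - δ) ^ 2 * |om a b| * (δ * (ψ (tri 0 (-b) a) + C)) - (1 + δ) ^ 2 * |om a b| * (δ * C) ≤
      Φ (shear δ a b) := by
  obtain ⟨hI, hK⟩ := hΦ.integral_fib hΨ (shear δ a b)
  have hab' : om a (-b) ≠ 0 := by rw [om_neg_right]; exact neg_ne_zero.2 hab
  set P : ConvexBody ℂ :=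
    (segB 0 ((1 - δ) • a) + segB 0 ((1 - δ) • (-b))).translate (δ • (-b)) with hP
  set Q : ConvexBody ℂ :=
    (segB 0 ((1 + δ) • a) + segB 0 ((1 + δ) • (-b))).translate (-(δ • a)) with hQ
  have hvP : vl P = (1 - δ) ^ 2 * |om a b| := by
    rw [hP, vl_translate, vl_par, om_smul_left, om_smul_right, om_neg_right, abs_mul, abs_mul,
      abs_neg, abs_of_nonneg (by linarith : 0 ≤ 1 - δ)]
    ring
  have hvQ : vl Q = (1 + δ) ^ 2 * |om a b| := by
    rw [hQ, vl_translate, vl_par, om_smul_left, om_smul_right, om_neg_right, abs_mul, abs_mul,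
      abs_neg, abs_of_nonneg (by linarith : 0 ≤ 1 + δ)]
    ring
  have hmemQ : ∀ p q : ℝ, -δ ≤ p → p ≤ 1 → 0 ≤ q → q ≤ 1 + δ → p • a + q • (-b) ∈ (Q : Set ℂ) := by
    intro p q h1 h2 h3 h4
    rw [hQ, ConvexBody.mem_translate, ConvexBody.coe_add, Set.mem_add]
    refine ⟨(p + δ) • a, (mem_segB_smul (by linarith) _ _).2 ⟨_, by linarith, by linarith, rfl⟩,
      q • (-b), (mem_segB_smul (by linarith) _ _).2 ⟨q, h3, h4, rfl⟩, ?_⟩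
    rw [add_smul]
    abel
  rw [hK, ← hvP, ← hvQ, ← integral_indicator_body, ← integral_indicator_body,
    ← integral_sub (integrable_indicator_body _ _) (integrable_indicator_body _ _)]
  refine integral_mono ((integrable_indicator_body _ _).sub (integrable_indicator_body _ _)) hI
    fun z => ?_
  change (P : Set ℂ).indicator (fun _ => δ * (ψ (tri 0 (-b) a) + C)) z -
    (Q : Set ℂ).indicator (fun _ => δ * C) z ≤ bext ψ (fib (shear δ a b) z)
  by_cases hz : z ∈ (P : Set ℂ)
  · have hz' := hz
    rw [hP, ConvexBody.mem_translate, ConvexBody.coe_add, Set.mem_add] at hz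
    obtain ⟨_, h1, _, h2, he⟩ := hz
    obtain ⟨p, hp0, hp1, rfl⟩ := (mem_segB_smul (by linarith) _ _).1 h1
    obtain ⟨q, hq0, hq1, rfl⟩ := (mem_segB_smul (by linarith) _ _).1 h2
    have hze : z = p • a + (q + δ) • (-b) := by
      rw [add_smul, ← add_assoc, he]; abel
    have hzQ : z ∈ (Q : Set ℂ) := by
      rw [hze]; exact hmemQ _ _ (by linarith) (by linarith) (by linarith) (by linarith)
    have hfib : ∀ y, y ∈ fib (shear δ a b) z ↔
        y ∈ ((δ • tri 0 (-b) a).translate ((q + δ) • b) : Set ℂ) := by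
      intro y
      rw [ConvexBody.mem_translate, mem_smul_tri hδ.le, mem_fib_shear hδ.le]
      constructor
      · rintro ⟨m', n', s', t', hm', hn', hs', ht', hst', hz', rfl⟩
        obtain ⟨-, h3⟩ := om_coord hab' (hze.symm.trans hz')
        refine ⟨s', t', hs', ht', hst', ?_⟩
        rw [h3]
        simp only [Complex.real_smul]; push_cast; ring
      · rintro ⟨s', t', hs', ht', hst', hy⟩
        refine ⟨p + t', q + δ - s', s', t', ⟨by linarith, by linarith⟩,
          ⟨by linarith, by linarith⟩, hs', ht', hst', ?_, ?_⟩
        · rw [hze]; congr 2 <;> ring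
        · rw [← sub_add_cancel y ((q + δ) • b), hy]
          simp only [Complex.real_smul]; push_cast; ring
    rw [Set.indicator_of_mem hz', Set.indicator_of_mem hzQ, bext_eq_of_mem_iff ψ _ hfib, hψ.inv,
      hψ.hom _ _ hδ]
    linarith
  · rw [Set.indicator_of_notMem hz, zero_sub]
    rcases (fib (shear δ a b) z).eq_empty_or_nonempty with h | ⟨y, hy⟩
    · rw [h, bext_empty, neg_nonpos]
      exact Set.indicator_nonneg (fun _ _ => by positivity) _
    · obtain ⟨m, n, s, t, hm, hn, hs, ht, hst, rfl, -⟩ := (mem_fib_shear hδ.le).1 hy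
      rw [Set.indicator_of_mem (hmemQ _ _ (by linarith) (by linarith) (by linarith) (by linarith))]
      exact neg_le_of_abs_le (abs_bext_fib_shear_le hψ hab hC0 hC hδ _)

open Filter Topology in
theorem IsContra.tri_le (h : IsContra 3 φ) (hψ : ∀ L, φ (0, 1) (prodBody unitSq L) = ψ L) {a b : ℂ}
    (hab : 0 < om a b) : ψ (tri 0 b (a + b)) ≤ sg ψ a + sg ψ b := by
  have hlin : IsLinVal ψ := by
    have := h.isLinVal
    simp only [hψ] at this
    exact this
  have h0 : ∀ c, 0 ≤ sg ψ c := fun c => by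
    have := h.sg_nonneg c
    simp only [hψ] at this
    exact this
  obtain ⟨C, hC0, hC⟩ := ConvexBody.exists_bound hlin.cont
    (segB 0 a + segB 0 (-b) : ConvexBody ℂ).isCompact
  have hne : om a b ≠ 0 := hab.ne'
  have key : ∀ δ : ℝ, 0 < δ → δ < 1 →
      (1 - δ) ^ 2 * (ψ (tri 0 (-b) a) + C) - (1 + δ) ^ 2 * C ≤ (1 + δ) * (sg ψ a + sg ψ b) := by
    intro δ hδ hδ1
    have h1 := h.sub (0, 1) (1, 0) (wedge δ a (-b) a b)
    rw [show ((0, 1) : ℂ × ℂ) + (1, 0) = (1, 1) by ext1 <;> simp] at h1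
    have h2 := h.sl 1 (-1) 0 1 (1, 1) (wedge δ a (-b) a b) (by ring)
    rw [matC_apply, show ((1 : ℂ) * ((1, 1) : ℂ × ℂ).1 + -1 * ((1, 1) : ℂ × ℂ).2,
      (0 : ℂ) * ((1, 1) : ℂ × ℂ).1 + 1 * ((1, 1) : ℂ × ℂ).2) = (0, 1) by ext1 <;> simp] at h2
    have h3 := h.sl 0 (-1) 1 0 (1, 0) (wedge δ a (-b) a b) (by ring)
    rw [matC_apply, show ((0 : ℂ) * ((1, 0) : ℂ × ℂ).1 + -1 * ((1, 0) : ℂ × ℂ).2,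
      (1 : ℂ) * ((1, 0) : ℂ × ℂ).1 + 0 * ((1, 0) : ℂ × ℂ).2) = (0, 1) by ext1 <;> simp] at h3
    have h4 : (wedge δ a (-b) a b).mapCLM (matC 0 (-1) 1 0) = wedge δ (-b) (-a) (-b) a := by
      rw [wedge, ConvexBody.mapCLM_add, ConvexBody.mapCLM_add, wedge]
      simp only [ConvexBody.smul_eq_mapCLM]
      rw [ConvexBody.mapCLM_mapCLM, mapCLM_segB, mapCLM_segB, mapCLM_tri, mapCLM_tri]
      rw [add_comm (segB (matC 0 (-1) 1 0 0) _) (segB (matC 0 (-1) 1 0 0) _), tri_swap]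
      simp only [map_zero, matC_apply, ContinuousLinearMap.comp_apply]
      congr 1
      · congr 1 <;> congr 1 <;> ext1 <;> simp
      · congr 1
        · simp
        · change matC 0 (-1) 1 0 (δ • _) = _
          rw [matC_apply]
          ext1 <;> simp
    have h5 := wedge_le h.isBaseVal hlin hψ h0 (p := a) (q := -b) (p' := a) (q' := b)
      (by rw [om_neg_right]; exact neg_ne_zero.2 hne) hne hδ
    have h6 := wedge_le h.isBaseVal hlin hψ h0 (p := -b) (q := -a) (p' := -b) (q' := a)
      (by rw [om_neg_right, om_neg_left, om_swap]; simpa using hne)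
      (by rw [om_neg_left, om_swap]; simpa using hne) hδ
    have h7 := le_shear h.isBaseVal hlin hψ hne hC0 hC hδ hδ1
    rw [shear] at h7
    rw [h4] at h3
    rw [hlin.sg_neg, om_neg_right, om_neg_left, om_swap, neg_neg, abs_neg] at h6
    rw [om_neg_right, abs_neg] at h5
    have hpos : 0 < δ * |om a b| := mul_pos hδ (abs_pos.2 hne)
    refine le_of_mul_le_mul_left ?_ hpos
    rw [← h2, ← h3] at h1
    linear_combination h1 + h5 + h6 + h7
  have hlim : ψ (tri 0 (-b) a) ≤ sg ψ a + sg ψ b := by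
    have c1 : Continuous fun δ : ℝ =>
      (1 - δ) ^ 2 * (ψ (tri 0 (-b) a) + C) - (1 + δ) ^ 2 * C := by fun_prop
    have c2 : Continuous fun δ : ℝ => (1 + δ) * (sg ψ a + sg ψ b) := by fun_prop
    have := le_of_tendsto_of_tendsto (c1.tendsto 0 |>.mono_left nhdsWithin_le_nhds)
      (c2.tendsto 0 |>.mono_left nhdsWithin_le_nhds)
      (Filter.mem_of_superset (Ioo_mem_nhdsGT one_pos) fun δ hδ => key δ hδ.1 hδ.2)
    simpa using this
  have e : tri 0 b (a + b) = (tri 0 (-b) a).translate b := by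
    rw [translate_tri, add_zero, add_neg_cancel, add_comm b a, tri_rotate 0 b, tri_swap]
  rw [e, hlin.inv]
  exact hlim

theorem IsContra.exists_mv_of_degree_three (h : IsContra 3 φ) :
    ∃ N, ∀ L, φ (0, 1) (prodBody unitSq L) = mv N L :=
  h.isLinVal.exists_eq_mv h.sg_nonneg fun _ _ hab => h.tri_le (fun _ => rfl) hab

end DegreeThree

section MixedVolume

theorem mixedVol_four {V : Type*} [NormedAddCommGroup V] [NormedSpace ℝ V] [MeasurableSpace V]
    (μ : Measure V) (K L : ConvexBody V) :
    mixedVol μ ![K, K, K, L] = (24 : ℝ)⁻¹ *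
      ((μ.real ((K + K + K + L : ConvexBody V) : Set V) - μ.real ((K + K + K : ConvexBody V) : Set
        V))
        - 3 * (μ.real ((K + K + L : ConvexBody V) : Set V) - μ.real ((K + K : ConvexBody V) : Set
          V))
        + 3 * (μ.real ((K + L : ConvexBody V) : Set V) - μ.real (K : Set V))
        - (μ.real (L : Set V) - μ.real (0 : Set V))) := by
  have e : (Finset.univ : Finset (Finset (Fin 4))) = {∅, {0}, {1}, {2}, {3}, {0, 1}, {0, 2}, {1, 2},
    {0, 3}, {1, 3}, {2, 3}, {0, 1, 2}, {0, 1, 3}, {0, 2, 3}, {1, 2, 3}, {0, 1, 2, 3}} := by decide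
  set A : Fin 4 → Set V := fun i => (![K, K, K, L] i : ConvexBody V) with hA
  set f : Finset (Fin 4) → ℝ := fun S => (-1 : ℝ) ^ (4 - S.card) * (μ (∑ i ∈ S, A i)).toReal with hf
  have p0 : f ∅ = μ.real (0 : Set V) := by
    rw [hf]; norm_num [measureReal_def]
  have p1 : ∀ i, f {i} = -μ.real (A i) := fun i => by
    simp only [hf, Finset.sum_singleton, Finset.card_singleton, measureReal_def]; norm_num
  have p2 : ∀ i j, i ≠ j → f {i, j} = μ.real (A i + A j) := fun i j h => by
    simp only [hf, Finset.sum_pair h, Finset.card_pair h, measureReal_def]; norm_num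
  have p3 : ∀ i j k, i ≠ j → i ≠ k → j ≠ k → f {i, j, k} = -μ.real (A i + A j + A k) :=
    fun i j k h1 h2 h3 => by
      have h : i ∉ ({j, k} : Finset (Fin 4)) := by simp [h1, h2]
      simp only [hf, Finset.sum_insert h, Finset.sum_pair h3, Finset.card_insert_of_notMem h,
        Finset.card_pair h3, measureReal_def, ← add_assoc]
      norm_num
  have p4 : f {0, 1, 2, 3} = μ.real (A 0 + A 1 + A 2 + A 3) := by
    have h : (∑ i ∈ {0, 1, 2, 3}, A i) = A 0 + A 1 + A 2 + A 3 := Fin.sum_univ_four A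
    simp only [hf, h, measureReal_def]
    simp
  have h0 : A 0 = K := rfl
  have h1 : A 1 = K := rfl
  have h2 : A 2 = K := rfl
  have h3 : A 3 = L := rfl
  change _ * ∑ S, f S = _
  rw [e]
  iterate 15 rw [Finset.sum_insert (by decide)]
  rw [Finset.sum_singleton, p0, p4]
  iterate 6 rw [p2 _ _ (by decide)]
  iterate 4 rw [p3 _ _ _ (by decide) (by decide) (by decide)]
  simp only [p1, h0, h1, h2, h3, ConvexBody.coe_add, Nat.factorial]
  push_cast
  ring

/-- Mixed volumes depend on the measure only through the volumes of convex bodies. -/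
theorem mixedVol_mapCLM {V V' : Type*} [NormedAddCommGroup V] [NormedSpace ℝ V] [MeasurableSpace V]
    [NormedAddCommGroup V'] [NormedSpace ℝ V'] [MeasurableSpace V'] {μ : Measure V} {ν : Measure V'}
    (f : V →L[ℝ] V') {c : ℝ} (hc : ∀ S : ConvexBody V, ν.real (S.mapCLM f : Set V') = c * μ.real (S
      : Set V))
    (K L : ConvexBody V) :
    mixedVol ν ![K.mapCLM f, K.mapCLM f, K.mapCLM f, L.mapCLM f] =
      c * mixedVol μ ![K, K, K, L] := by
  have h0 := hc 0
  have e : (((0 : ConvexBody V).mapCLM f : ConvexBody V') : Set V') = 0 := by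
    rw [ConvexBody.coe_mapCLM, ConvexBody.coe_zero, ← Set.singleton_zero, Set.image_singleton,
      map_zero,
      Set.singleton_zero]
  rw [e, ConvexBody.coe_zero] at h0
  rw [mixedVol_four, mixedVol_four]
  simp only [← ConvexBody.mapCLM_add, hc, h0]
  ring

end MixedVolume

section FiberIntegral

theorem integrable_volume_fib (K : ConvexBody (ℂ × ℂ)) :
    Integrable fun x => volume.real (fib K x) :=
  Measure.integrable_measure_prodMk_left K.isClosed.measurableSet K.isCompact.measure_lt_top.ne

theorem volume_eq_integral_fib (K : ConvexBody (ℂ × ℂ)) :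
    volume.real (K : Set (ℂ × ℂ)) = ∫ x, volume.real (fib K x) := by
  have h := Measure.prod_apply (μ := (volume : Measure ℂ)) (ν := (volume : Measure ℂ))
    K.isClosed.measurableSet
  rw [measureReal_def]
  change ((volume.prod volume : Measure (ℂ × ℂ)) _).toReal = _
  rw [h, ← integral_toReal (measurable_measure_prodMk_left K.isClosed.measurableSet).aemeasurable]
  · rfl
  · exact Measure.ae_measure_lt_top K.isClosed.measurableSet K.isCompact.measure_lt_top.ne

theorem volume_fib_add (K : ConvexBody (ℂ × ℂ)) (N : ConvexBody ℂ) (x : ℂ) :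
    volume.real (fib (K + N.mapCLM inrC : ConvexBody (ℂ × ℂ)) x) = volume.real (fib K x) +
      bext (mv N) (fib K x) +
      (K.mapCLM (ContinuousLinearMap.fst ℝ ℂ ℂ) : Set ℂ).indicator (fun _ => vl N) x := by
  have e : fib (K + N.mapCLM inrC : ConvexBody (ℂ × ℂ)) x = fib K x + (N : Set ℂ) := by
    ext y
    rw [Set.mem_add, ConvexBody.coe_add]
    constructor
    · rintro ⟨⟨a, b⟩, h, -, ⟨n, hn, rfl⟩, h'⟩
      obtain ⟨h1, h2⟩ := Prod.ext_iff.1 h'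
      change a + 0 = x at h1
      change b + n = y at h2
      rw [add_zero] at h1
      subst h1
      exact ⟨b, h, n, hn, h2⟩
    · rintro ⟨b, hb, n, hn, rfl⟩
      refine ⟨(x, b), hb, inrC n, ⟨n, hn, rfl⟩, ?_⟩
      ext1
      · change x + 0 = x; simp
      · rfl
  rw [e]
  clear e
  rcases (fib (K : Set (ℂ × ℂ)) x).eq_empty_or_nonempty with h | h
  · rw [h, bext_empty, Set.indicator_of_notMem]
    · simp
    · rintro ⟨⟨a, b⟩, h', rfl⟩
      have : b ∈ fib (K : Set (ℂ × ℂ)) a := h'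
      change fib (K : Set (ℂ × ℂ)) a = ∅ at h
      rw [h] at this
      exact this
  · rw [Set.indicator_of_mem]
    · change volume.real ((fibBody K x h : Set ℂ) + (N : Set ℂ)) = volume.real (fibBody K x h : Set
      ℂ) +
        bext (mv N) (fibBody K x h : Set ℂ) + _
      rw [bext_coe, mv, ← ConvexBody.coe_add, add_comm N]
      simp only [vl]
      ring
    · obtain ⟨y, hy⟩ := h
      exact ⟨(x, y), hy, rfl⟩

theorem integrable_bext_mv_fib (K : ConvexBody (ℂ × ℂ)) (N : ConvexBody ℂ) :
    Integrable fun x => bext (mv N) (fib K x) := by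
  have := ((integrable_volume_fib (K + N.mapCLM inrC)).sub (integrable_volume_fib K)).sub
    (integrable_indicator_body (K.mapCLM (ContinuousLinearMap.fst ℝ ℂ ℂ)) (vl N))
  refine this.congr (Filter.Eventually.of_forall fun x => ?_)
  change volume.real (fib (K + N.mapCLM inrC : ConvexBody (ℂ × ℂ)) x) - volume.real (fib K x) - _ =
    _
  rw [volume_fib_add]
  ring

theorem volume_add_sub (K : ConvexBody (ℂ × ℂ)) (N : ConvexBody ℂ) :
    volume.real ((K + N.mapCLM inrC : ConvexBody (ℂ × ℂ)) : Set (ℂ × ℂ)) -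
      volume.real (K : Set (ℂ × ℂ)) = (∫ x, bext (mv N) (fib K x)) +
        vl (K.mapCLM (ContinuousLinearMap.fst ℝ ℂ ℂ)) * vl N := by
  rw [volume_eq_integral_fib, volume_eq_integral_fib]
  simp only [volume_fib_add]
  have h1 := integral_add ((integrable_volume_fib K).add (integrable_bext_mv_fib K N))
    (integrable_indicator_body (K.mapCLM (ContinuousLinearMap.fst ℝ ℂ ℂ)) (vl N))
  have h2 := integral_add (integrable_volume_fib K) (integrable_bext_mv_fib K N)
  simp only [Pi.add_apply] at h1
  rw [h1, h2, integral_indicator_body]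
  ring

theorem integral_bext_mv_smul (K : ConvexBody (ℂ × ℂ)) (N : ConvexBody ℂ) {t : ℝ} (ht : 0 < t) :
    ∫ x, bext (mv N) (fib (t • K : ConvexBody (ℂ × ℂ)) x) =
      t ^ 3 * ∫ x, bext (mv N) (fib K x) := by
  have h1 := Measure.integral_comp_smul (volume : Measure ℂ)
    (fun x => bext (mv N) (fib (t • K : ConvexBody (ℂ × ℂ)) x)) t
  have h2 : ∀ x : ℂ, bext (mv N) (fib (t • K : ConvexBody (ℂ × ℂ)) (t • x)) =
      t * bext (mv N) (fib K x) := by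
    intro x
    have hm : ∀ y, t • y ∈ fib (t • K : ConvexBody (ℂ × ℂ)) (t • x) ↔ y ∈ fib (K : Set (ℂ × ℂ)) x
      := by
      intro y
      change t • (x, y) ∈ t • (K : Set (ℂ × ℂ)) ↔ _
      rw [Set.smul_mem_smul_set_iff₀ ht.ne']
      rfl
    rcases (fib (K : Set (ℂ × ℂ)) x).eq_empty_or_nonempty with h | h
    · have : fib (t • K : ConvexBody (ℂ × ℂ)) (t • x) = ∅ := by
        refine Set.eq_empty_of_forall_notMem fun y hy => ?_
        rw [← smul_inv_smul₀ ht.ne' y, hm, h] at hy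
        exact hy
      rw [h, this, bext_empty, mul_zero]
    · rw [show bext (mv N) (fib K x) = mv N (fibBody K x h) from bext_coe _ (fibBody K x h),
        ← mv_smul N ht.le]
      refine bext_eq_of_mem_iff _ _ fun y => ?_
      rw [← smul_inv_smul₀ ht.ne' y, hm]
      change _ ↔ t • _ ∈ t • ((fibBody K x h : ConvexBody ℂ) : Set ℂ)
      rw [Set.smul_mem_smul_set_iff₀ ht.ne']
      rfl
  simp only [h2] at h1
  rw [integral_const_mul, Complex.finrank_real_complex, abs_of_pos (by positivity),
    smul_eq_mul] at h1
  have h3 : (t ^ 2)⁻¹ * t ^ 2 = 1 := inv_mul_cancel₀ (by positivity)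
  linear_combination (-t ^ 2) * h1 - (∫ x, bext (mv N) (fib (t • K : ConvexBody (ℂ × ℂ)) x)) * h3

theorem mixedVol_inrC (K : ConvexBody (ℂ × ℂ)) (N : ConvexBody ℂ) :
    mixedVol volume ![K, K, K, N.mapCLM inrC] = (∫ x, bext (mv N) (fib K x)) / 4 := by
  have e2 : K + K = (2 : ℝ) • K := by
    apply ConvexBody.ext
    rw [ConvexBody.coe_add, ConvexBody.coe_smul, ← one_add_one_eq_two,
      K.convex.add_smul zero_le_one zero_le_one, one_smul]
  have e3 : K + K + K = (3 : ℝ) • K := by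
    apply ConvexBody.ext
    rw [e2, ConvexBody.coe_add, ConvexBody.coe_smul, ConvexBody.coe_smul,
      show (3 : ℝ) = 2 + 1 by norm_num, K.convex.add_smul zero_le_two zero_le_one, one_smul]
  have hv : ∀ t : ℝ, vl ((t • K).mapCLM (ContinuousLinearMap.fst ℝ ℂ ℂ)) =
      t ^ 2 * vl (K.mapCLM (ContinuousLinearMap.fst ℝ ℂ ℂ)) := fun t => by
    rw [← vl_smul]
    congr 1
    rw [ConvexBody.smul_eq_mapCLM, ConvexBody.smul_eq_mapCLM, ConvexBody.mapCLM_mapCLM,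
      ConvexBody.mapCLM_mapCLM]
    rfl
  have hL : volume.real ((N.mapCLM inrC : ConvexBody (ℂ × ℂ)) : Set (ℂ × ℂ)) = 0 := by
    have : ((N.mapCLM inrC : ConvexBody (ℂ × ℂ)) : Set (ℂ × ℂ)) = {0} ×ˢ (N : Set ℂ) := by
      ext ⟨x, y⟩
      constructor
      · rintro ⟨n, hn, h⟩
        obtain ⟨h1, h2⟩ := Prod.ext_iff.1 h
        exact ⟨h1.symm, h2 ▸ hn⟩
      · rintro ⟨h1, h2⟩
        exact ⟨y, h2, Prod.ext h1.symm rfl⟩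
    rw [this, measureReal_def]
    change ((volume.prod volume : Measure (ℂ × ℂ)) _).toReal = 0
    rw [Measure.prod_prod]
    simp
  have h0 : volume.real (0 : Set (ℂ × ℂ)) = 0 := by
    rw [← Set.singleton_zero, show ({0} : Set (ℂ × ℂ)) = {0} ×ˢ {0} from
      Set.singleton_prod_singleton.symm, measureReal_def]
    change ((volume.prod volume : Measure (ℂ × ℂ)) _).toReal = 0
    rw [Measure.prod_prod]
    simp
  rw [mixedVol_four, e3, e2, volume_add_sub, volume_add_sub, volume_add_sub, hL, h0, hv, hv,
    integral_bext_mv_smul K N two_pos, integral_bext_mv_smul K N three_pos]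
  ring

theorem integral_bext_fib_prodBody (ψ : ConvexBody ℂ → ℝ) (L : ConvexBody ℂ) :
    ∫ x, bext ψ (fib (prodBody unitSq L) x) = ψ L := by
  have : (fun x => bext ψ (fib (prodBody unitSq L) x)) =
      (unitSq : Set ℂ).indicator fun _ => ψ L := by
    funext x
    by_cases hx : x ∈ (unitSq : Set ℂ)
    · rw [Set.indicator_of_mem hx]
      exact bext_eq_of_mem_iff _ _ fun y => ⟨fun h => h.2, fun h => ⟨hx, h⟩⟩
    · rw [Set.indicator_of_notMem hx]
      have : fib (prodBody unitSq L) x = ∅ := Set.eq_empty_of_forall_notMem fun y hy => hx hy.1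
      rw [this, bext_empty]
  have hvl : vl unitSq = 1 := by
    rw [vl, measureReal_def, volume_fiber _ unitSq.isClosed.measurableSet]
    have : ∀ y : ℝ, volume {x : ℝ | (⟨x, y⟩ : ℂ) ∈ (unitSq : Set ℂ)} =
        (Set.Icc (0 : ℝ) 1).indicator (fun _ => 1) y := by
      intro y
      by_cases hy : y ∈ Set.Icc (0 : ℝ) 1
      · rw [Set.indicator_of_mem hy, show {x : ℝ | (⟨x, y⟩ : ℂ) ∈ (unitSq : Set ℂ)} = Set.Icc 0 1
        from
          Set.ext fun x => ⟨fun h => h.1, fun h => ⟨h, hy⟩⟩]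
        simp
      · rw [Set.indicator_of_notMem hy, show {x : ℝ | (⟨x, y⟩ : ℂ) ∈ (unitSq : Set ℂ)} = ∅ from
          Set.eq_empty_of_forall_notMem fun x h => hy h.2]
        simp
    simp only [this]
    rw [lintegral_indicator measurableSet_Icc]
    simp
  rw [this, integral_indicator_body, hvl, one_mul]

end FiberIntegral

section Coordinates

/-- The complex `2 × 2` matrix with the given entries as a complex-linear map of `ℂ × ℂ`. -/
def matLin (a b c d : ℂ) : ℂ × ℂ →ₗ[ℂ] ℂ × ℂ :=
  Matrix.toLin (Basis.finTwoProd ℂ) (Basis.finTwoProd ℂ) !![a, b; c, d]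

theorem matLin_apply (a b c d : ℂ) (x : ℂ × ℂ) : matLin a b c d x = matC a b c d x :=
  Matrix.toLin_finTwoProd_apply a b c d x

theorem det_matLin (a b c d : ℂ) : LinearMap.det (matLin a b c d) = a * d - b * c := by
  rw [matLin, LinearMap.det_toLin, Matrix.det_fin_two_of]

instance isAddHaarMeasure_volume_prod : (volume : Measure (ℂ × ℂ)).IsAddHaarMeasure :=
  inferInstanceAs (volume.prod volume : Measure (ℂ × ℂ)).IsAddHaarMeasure

theorem volume_mapCLM_matC {a b c d : ℂ} (h : a * d - b * c = 1) (S : ConvexBody (ℂ × ℂ)) :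
    volume.real (S.mapCLM (matC a b c d) : Set (ℂ × ℂ)) = volume.real (S : Set (ℂ × ℂ)) := by
  have e : ((matC a b c d : ℂ × ℂ →L[ℝ] ℂ × ℂ) : ℂ × ℂ →ₗ[ℝ] ℂ × ℂ) =
      (matLin a b c d).restrictScalars ℝ :=
    LinearMap.ext fun x => (matLin_apply a b c d x).symm
  rw [ConvexBody.coe_mapCLM, measureReal_def, measureReal_def,
    Measure.addHaar_image_continuousLinearMap, e, LinearMap.det_restrictScalars, det_matLin, h]
  simp

theorem bext_mv_smul_left {t : ℝ} (ht : 0 ≤ t) (N : ConvexBody ℂ) (S : Set ℂ) :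
    bext (mv (t • N)) S = t * bext (mv N) S := by
  by_cases h : Convex ℝ S ∧ IsCompact S ∧ S.Nonempty
  · rw [bext_of _ h.1 h.2.1 h.2.2, bext_of _ h.1 h.2.1 h.2.2, mv_smul_left ht]
  · rw [bext, bext, dif_neg h, dif_neg h, mul_zero]

theorem matC_comp_inv {a b c d : ℂ} (h : a * d - b * c = 1) :
    (matC a b c d).comp (matC d (-b) (-c) a) = ContinuousLinearMap.id ℝ _ := by
  refine ContinuousLinearMap.ext fun x => ?_
  change matC a b c d (matC d (-b) (-c) a x) = x
  rw [matC_apply, matC_apply]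
  ext1
  · linear_combination x.1 * h
  · linear_combination x.2 * h

theorem ConvexBody.mapCLM_id {V : Type*} [NormedAddCommGroup V] [NormedSpace ℝ V]
    (K : ConvexBody V) : K.mapCLM (ContinuousLinearMap.id ℝ V) = K :=
  ConvexBody.ext (Set.image_id _)

variable {W : Type*} [NormedAddCommGroup W] [NormedSpace ℂ W]

/-- Evaluation at `w`, as a real functional on the complex dual. -/
def evRe (w : W) : (W →L[ℂ] ℂ) →L[ℝ] ℝ :=
  Complex.reCLM.comp ((ContinuousLinearMap.apply ℂ ℂ w).restrictScalars ℝ)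

theorem evRe_apply (w : W) (ξ : W →L[ℂ] ℂ) : evRe w ξ = (ξ w).re := rfl

/-- A complex-linear coordinate system as a real-linear map. -/
def coordR (E : (ℂ × ℂ) ≃L[ℂ] W) : ℂ × ℂ →L[ℝ] W := (E : ℂ × ℂ →L[ℂ] W).restrictScalars ℝ

/-- The inverse of a complex-linear coordinate system as a real-linear map. -/
def coordRSymm (E : (ℂ × ℂ) ≃L[ℂ] W) : W →L[ℝ] ℂ × ℂ :=
  (E.symm : W →L[ℂ] ℂ × ℂ).restrictScalars ℝ

theorem mapCLM_coordR_symm (E : (ℂ × ℂ) ≃L[ℂ] W) (K : ConvexBody W) :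
    (K.mapCLM (coordRSymm E)).mapCLM (coordR E) = K := by
  rw [ConvexBody.mapCLM_mapCLM]
  convert ConvexBody.mapCLM_id K
  exact ContinuousLinearMap.ext fun x => E.apply_symm_apply x

/-- The coordinates with respect to a basis of a two-dimensional space. -/
def basisCoord (b : Basis (Fin 2) ℂ W) : (ℂ × ℂ) ≃L[ℂ] W :=
  ((Basis.finTwoProd ℂ).equiv b (Equiv.refl _)).toContinuousLinearEquiv

theorem coord_basisCoord (b : Basis (Fin 2) ℂ W) (x : ℂ × ℂ) :
    b.coord 0 (basisCoord b x) = x.1 ∧ b.coord 1 (basisCoord b x) = x.2 := by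
  have : basisCoord b x = x.1 • b 0 + x.2 • b 1 := by
    have hx : x = x.1 • Basis.finTwoProd ℂ 0 + x.2 • Basis.finTwoProd ℂ 1 := by
      ext1 <;> simp
    conv_lhs => rw [hx]
    rw [map_add, map_smul, map_smul]
    congr 2 <;> exact (Basis.finTwoProd ℂ).equiv_apply _ _ _
  rw [this]
  simp

theorem exists_volume_coordR [FiniteDimensional ℂ W] [MeasurableSpace W] [BorelSpace W]
    (μ : Measure W) [μ.IsAddHaarMeasure] (E : (ℂ × ℂ) ≃L[ℂ] W) :
    ∃ c : ℝ, 0 < c ∧ ∀ S : ConvexBody (ℂ × ℂ),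
      μ.real (S.mapCLM (coordR E) : Set W) = c * volume.real (S : Set (ℂ × ℂ)) := by
  have h1 : (μ.map E.symm).IsAddHaarMeasure := E.symm.isAddHaarMeasure_map μ
  have h2 := Measure.isAddLeftInvariant_eq_smul (μ.map E.symm) (volume : Measure (ℂ × ℂ))
  set c := Measure.addHaarScalarFactor (μ.map E.symm) (volume : Measure (ℂ × ℂ)) with hc
  have h3 : 0 < c := Measure.addHaarScalarFactor_pos_of_isAddHaarMeasure _ _
  refine ⟨c, h3, fun S => ?_⟩
  have h4 : μ.map E.symm (S : Set (ℂ × ℂ)) = μ (S.mapCLM (coordR E) : Set W) := by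
    rw [Measure.map_apply E.symm.continuous.measurable S.isClosed.measurableSet]
    congr 1
    exact (E.image_eq_preimage_symm _).symm
  rw [measureReal_def, ← h4, h2]
  simp [measureReal_def]

theorem hSupp_mul_left {V : Type*} [NormedAddCommGroup V] [NormedSpace ℝ V] {t : ℝ} (ht : 0 ≤ t)
    (K : ConvexBody V) (p : V → ℝ) : hSupp K (fun x => t * p x) = t * hSupp K p := by
  rw [hSupp, hSupp, ← smul_eq_mul, ← Real.sSup_smul_of_nonneg ht, ← Set.image_smul, Set.image_image]
  rfl

/-- The support functions of a contravariant Minkowski valuation in coordinates. -/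
theorem isContra_of_minkowski [FiniteDimensional ℂ W] {k : ℕ}
    {Z : ConvexBody W → ConvexBody (W →L[ℂ] ℂ)}
    (hZc : Continuous Z) (hZt : IsTranslationInvariant Z)
    (hZv : IsMinkowskiValuation Z) (hZg : IsSLContravariant Z)
    (hZh : ∀ (K : ConvexBody W) (l : ℝ), 0 < l → Z (l • K) = l ^ k • Z K)
    (E : (ℂ × ℂ) ≃L[ℂ] W) :
    IsContra k fun w K => hSupp (Z (K.mapCLM (coordR E))) (evRe (E w)) where
  val w := by
    have : IsValuation fun K : ConvexBody W => hSupp (Z K) (evRe (E w)) := fun K L hU hI => by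
      simp only [← ConvexBody.hSupp_add]
      rw [hZv K L hU hI]
    exact this.comp_mapCLM (f := coordR E) E.injective
  cont w := (ConvexBody.continuous_hSupp _).comp (hZc.comp (ConvexBody.continuous_mapCLM _))
  inv w K x := by
    simp only [ConvexBody.mapCLM_translate, hZt _ _]
  hom w t K ht := by
    have : (t • K).mapCLM (coordR E) = t • K.mapCLM (coordR E) := by
      rw [ConvexBody.smul_eq_mapCLM, ConvexBody.smul_eq_mapCLM, ConvexBody.mapCLM_mapCLM,
        ConvexBody.mapCLM_mapCLM]
      congr 1
      exact ContinuousLinearMap.ext fun x => (coordR E).map_smul t x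
    simp only [this]
    rw [hZh _ _ ht, ConvexBody.hSupp_smul (pow_nonneg ht.le k)]
  smul w t K ht := by
    rw [← hSupp_mul_left ht]
    congr 1
    funext ξ
    rw [evRe_apply, evRe_apply]
    have : E (t • w) = (t : ℂ) • E w := by
      rw [← E.map_smul]; rfl
    rw [this, map_smul]
    simp
  sub w w' K := by
    refine ConvexBody.hSupp_le _ fun ξ hξ => ?_
    have h1 := ConvexBody.le_hSupp _ (evRe (E w)).continuous hξ
    have h2 := ConvexBody.le_hSupp _ (evRe (E w')).continuous hξ
    rw [evRe_apply] at h1 h2 ⊢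
    rw [map_add, map_add, Complex.add_re]
    exact add_le_add h1 h2
  sl a b c d w K h := by
    have hdet : LinearMap.det (matLin a b c d) = 1 := by rw [det_matLin, h]
    let g0 := LinearMap.equivOfDetNeZero (matLin a b c d) (by rw [hdet]; exact one_ne_zero)
    have hg0 : ∀ x, g0 x = matC a b c d x := matLin_apply a b c d
    let g : W ≃L[ℂ] W :=
      ((E.toLinearEquiv.symm.trans g0).trans E.toLinearEquiv).toContinuousLinearEquiv
    have hg : ∀ x, g x = E (matC a b c d (E.symm x)) := fun x => by
      rw [← hg0]; rfl
    have hgdet : LinearMap.det ((g : W →L[ℂ] W) : W →ₗ[ℂ] W) = 1 := by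
      rw [← hdet, ← LinearMap.det_conj (matLin a b c d) E.toLinearEquiv]
      rfl
    have e1 : (K.mapCLM (matC a b c d)).mapCLM (coordR E) =
        (K.mapCLM (coordR E)).mapCLM (cReal (g : W →ₗ[ℂ] W)) := by
      rw [ConvexBody.mapCLM_mapCLM, ConvexBody.mapCLM_mapCLM]
      congr 1
      refine ContinuousLinearMap.ext fun x => ?_
      change E (matC a b c d x) = g (E x)
      rw [hg, E.symm_apply_apply]
    have e2 : g.symm (E (matC a b c d w)) = E w := by
      rw [g.symm_apply_eq, hg, E.symm_apply_apply]
    rw [e1, hZg g hgdet, ConvexBody.hSupp_mapCLM]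
    congr 1
    funext ξ
    change (ξ (g.symm (E (matC a b c d w)))).re = (ξ (E w)).re
    rw [e2]

/-- The operator `Π_N` in coordinates. -/
theorem mixedVol_coordR [MeasurableSpace W] [FiniteDimensional ℂ W] {μ : Measure W}
    (E : (ℂ × ℂ) ≃L[ℂ] W) {t : ℝ} (ht : ∀ S : ConvexBody (ℂ × ℂ),
      μ.real (S.mapCLM (coordR E) : Set W) = t * volume.real (S : Set (ℂ × ℂ)))
    {a b c d : ℂ} (h : a * d - b * c = 1) (K : ConvexBody (ℂ × ℂ)) (N : ConvexBody ℂ) :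
    mixedVol μ ![(K.mapCLM (matC a b c d)).mapCLM (coordR E),
      (K.mapCLM (matC a b c d)).mapCLM (coordR E), (K.mapCLM (matC a b c d)).mapCLM (coordR E),
      dotBody N (E (b, d))] = t * ((∫ x, bext (mv N) (fib K x)) / 4) := by
  have e : dotBody N (E (b, d)) = ((N.mapCLM inrC).mapCLM (matC a b c d)).mapCLM (coordR E) := by
    rw [ConvexBody.mapCLM_mapCLM, ConvexBody.mapCLM_mapCLM, dotBody]
    congr 1
    refine ContinuousLinearMap.ext fun x => ?_
    change x • E (b, d) = E (matC a b c d (0, x))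
    rw [← E.map_smul, matC_apply]
    congr 1
    ext1 <;> simp [mul_comm]
  rw [e, mixedVol_mapCLM (coordR E) ht, mixedVol_mapCLM (c := 1) (matC a b c d)
    (fun S => by rw [volume_mapCLM_matC h, one_mul]), one_mul, mixedVol_inrC]

theorem mixedVol_dotBody_zero [MeasurableSpace W] [FiniteDimensional ℂ W] (μ : Measure W)
    (K : ConvexBody W) (N : ConvexBody ℂ) : mixedVol μ ![K, K, K, dotBody N 0] = 0 := by
  have e : dotBody N (0 : W) = 0 := by
    apply ConvexBody.ext
    rw [ConvexBody.coe_zero, dotBody, ConvexBody.coe_mapCLM, ← Set.singleton_zero]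
    have : ∀ x : ℂ, LinearMap.toContinuousLinearMap
        ((LinearMap.toSpanSingleton ℂ W 0).restrictScalars ℝ) x = 0 := fun x => smul_zero x
    simp only [this]
    exact N.nonempty.image_const 0
  rw [e, mixedVol_four]
  simp

end Coordinates

section Classification

variable {W : Type*} [NormedAddCommGroup W] [NormedSpace ℂ W] [FiniteDimensional ℂ W]
variable {Z : ConvexBody W → ConvexBody (W →L[ℂ] ℂ)}

theorem exists_eq_mixedVol [MeasurableSpace W] [BorelSpace W] (μ : Measure W) [μ.IsAddHaarMeasure]
    (E : (ℂ × ℂ) ≃L[ℂ] W)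
    (h : IsContra 3 fun w K => hSupp (Z (K.mapCLM (coordR E))) (evRe (E w))) :
    ∃ N : ConvexBody ℂ,
      (∀ (K : ConvexBody W) (w : W),
        hSupp (Z K) (fun ξ => (ξ w).re) = mixedVol μ ![K, K, K, dotBody N w]) ∧
      ∀ N' : ConvexBody ℂ,
        (∀ (K : ConvexBody W) (w : W),
          hSupp (Z K) (fun ξ => (ξ w).re) = mixedVol μ ![K, K, K, dotBody N' w]) →
        ∃ x : ℂ, N' = N.translate x := by
  obtain ⟨N, hN⟩ := h.exists_mv_of_degree_three
  obtain ⟨t, ht0, ht⟩ := exists_volume_coordR μ E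
  have hfib := fun K => (h.isBaseVal.integral_fib (Ψ := mv N) hN K).2
  have hexists : ∀ (K : ConvexBody W) (w : W),
      hSupp (Z K) (fun ξ => (ξ w).re) = mixedVol μ ![K, K, K, dotBody ((4 / t) • N) w] := by
    intro K w
    obtain ⟨w, rfl⟩ := E.surjective w
    rw [← mapCLM_coordR_symm E K]
    generalize K.mapCLM (coordRSymm E) = K
    by_cases hw : w = 0
    · subst hw
      rw [map_zero, mixedVol_dotBody_zero, ← h.zero K, map_zero]
      rfl
    · obtain ⟨a, c, hac⟩ := exists_det_eq_one hw
      have hK : K = (K.mapCLM (matC w.2 (-w.1) (-c) a)).mapCLM (matC a w.1 c w.2) := by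
        rw [ConvexBody.mapCLM_mapCLM, matC_comp_inv hac, ConvexBody.mapCLM_id]
      rw [hK]
      generalize K.mapCLM (matC w.2 (-w.1) (-c) a) = K
      rw [mixedVol_coordR E ht hac]
      simp only [bext_mv_smul_left (div_pos four_pos ht0).le]
      rw [integral_const_mul, ← hfib K]
      have h1 := h.sl a w.1 c w.2 (0, 1) K hac
      rw [matC_apply, show ((a * ((0, 1) : ℂ × ℂ).1 + w.1 * ((0, 1) : ℂ × ℂ).2,
        c * ((0, 1) : ℂ × ℂ).1 + w.2 * ((0, 1) : ℂ × ℂ).2) : ℂ × ℂ) = w by ext1 <;> simp] at h1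
      change hSupp _ (evRe (E w)) = _
      rw [h1]
      field_simp
  refine ⟨(4 / t) • N, hexists, fun N' hN' => exists_translate_of_mv_eq fun L => ?_⟩
  have h1 := (hexists ((prodBody unitSq L).mapCLM (coordR E)) (E (0, 1))).symm.trans (hN' _ _)
  have h2 : prodBody unitSq L = (prodBody unitSq L).mapCLM (matC 1 0 0 1) := by
    convert (ConvexBody.mapCLM_id _).symm
    refine ContinuousLinearMap.ext fun x => ?_
    rw [matC_apply]
    ext1 <;> simp
  rw [h2, mixedVol_coordR E ht (by simp), mixedVol_coordR E ht (by simp),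
    integral_bext_fib_prodBody, integral_bext_fib_prodBody] at h1
  have h3 := mul_left_cancel₀ ht0.ne' h1
  linarith

theorem exists_eq_integral (b : Basis (Fin 2) ℂ W) (E : (ℂ × ℂ) ≃L[ℂ] W)
    (hE : ∀ x, b.coord 0 (E x) = x.1 ∧ b.coord 1 (E x) = x.2)
    (h : IsContra 1 fun w K => hSupp (Z (K.mapCLM (coordR E))) (evRe (E w))) :
    ∃ (M : ConvexBody ℂ) (σ : Measure ℂ), IsSurfaceAreaMeasure M σ ∧
      (∀ (K : ConvexBody W) (w : W),
        hSupp (Z K) (fun ξ => (ξ w).re) =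
          ∫ α, hSupp (detBody b K w) (fun c => (c * (starRingEnd ℂ) α).re) ∂σ) ∧
      ∀ (M' : ConvexBody ℂ) (σ' : Measure ℂ), IsSurfaceAreaMeasure M' σ' →
        (∀ (K : ConvexBody W) (w : W),
          hSupp (Z K) (fun ξ => (ξ w).re) =
            ∫ α, hSupp (detBody b K w) (fun c => (c * (starRingEnd ℂ) α).re) ∂σ') →
        ∃ x : ℂ, M' = M.translate x := by
  obtain ⟨M, hM⟩ := h.exists_mv_of_degree_one
  obtain ⟨σ, hσ⟩ := exists_isSurfaceAreaMeasure M
  have h_int : ∀ {M : ConvexBody ℂ} {σ : Measure ℂ}, IsSurfaceAreaMeasure M σ → ∀ L : ConvexBody ℂ,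
      ∫ α, hSupp L (fun c => (c * (starRingEnd ℂ) α).re) ∂σ = mv M L := fun hσ L => by
    rw [hσ.2.2, mixedVol_pair]; ring
  have hdet : ∀ (K : ConvexBody (ℂ × ℂ)) (w : ℂ × ℂ),
      detBody b (K.mapCLM (coordR E)) (E w) = K.mapCLM (detC w) := by
    intro K w
    rw [detBody, ConvexBody.mapCLM_mapCLM]
    congr 1
    refine ContinuousLinearMap.ext fun x => ?_
    change b.coord 1 (E w) * b.coord 0 (E x) - b.coord 0 (E w) * b.coord 1 (E x) = _
    rw [(hE w).1, (hE w).2, (hE x).1, (hE x).2, detC_apply]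
  have hexists : ∀ (K : ConvexBody W) (w : W), hSupp (Z K) (fun ξ => (ξ w).re) =
      ∫ α, hSupp (detBody b K w) (fun c => (c * (starRingEnd ℂ) α).re) ∂σ := by
    intro K w
    obtain ⟨w, rfl⟩ := E.surjective w
    rw [← mapCLM_coordR_symm E K, h_int hσ, hdet, ← hM]
    rfl
  refine ⟨M, σ, hσ, hexists, fun M' σ' hσ' hM' => exists_translate_of_mv_eq fun L => ?_⟩
  have h1 := (hexists ((L.mapCLM inlC).mapCLM (coordR E)) (E (0, 1))).symm.trans (hM' _ _)
  have h2 : (L.mapCLM inlC).mapCLM (detC (0, 1)) = L := by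
    rw [ConvexBody.mapCLM_mapCLM]
    convert ConvexBody.mapCLM_id L
    refine ContinuousLinearMap.ext fun x => ?_
    change detC (0, 1) (x, 0) = x
    rw [detC_apply]
    simp
  rw [h_int hσ, h_int hσ', hdet, h2] at h1
  exact h1.symm

end Classification

/-- Let `W` be a 2-dimensional complex vector space with a fixed basis
`b` (and a fixed Lebesgue measure `μ`), and let `Z : 𝒦(W) → 𝒦(W*)` be a continuous,
translation invariant, `SL(W,ℂ)`-contravariant Minkowski valuation. If `Z` is homogeneous
of degree `3` then there is an `N ∈ 𝒦(ℂ)`, unique up to translation, with `Z = Π_N`;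
if `Z` is homogeneous of degree `1` then there is an `M ∈ 𝒦(ℂ)`, unique up to
translation, with `Z = D̃_M`. -/
theorem homogeneous_contravariant_classification_dim_two
    {W : Type*} [NormedAddCommGroup W] [NormedSpace ℂ W] [FiniteDimensional ℂ W]
    (hW : Module.finrank ℂ W = 2) (b : Basis (Fin 2) ℂ W)
    [MeasurableSpace W] [BorelSpace W] (μ : Measure W) [μ.IsAddHaarMeasure]
    (Z : ConvexBody W → ConvexBody (W →L[ℂ] ℂ))
    (hZc : Continuous Z) (hZt : IsTranslationInvariant Z)
    (hZv : IsMinkowskiValuation Z) (hZg : IsSLContravariant Z) :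
    ((∀ (K : ConvexBody W) (l : ℝ), 0 < l → Z (l • K) = l ^ 3 • Z K) →
      ∃ N : ConvexBody ℂ,
        (∀ (K : ConvexBody W) (w : W),
          hSupp (Z K) (fun ξ => (ξ w).re) = mixedVol μ ![K, K, K, dotBody N w]) ∧
        ∀ N' : ConvexBody ℂ,
          (∀ (K : ConvexBody W) (w : W),
            hSupp (Z K) (fun ξ => (ξ w).re) = mixedVol μ ![K, K, K, dotBody N' w]) →
          ∃ x : ℂ, N' = N.translate x) ∧
    ((∀ (K : ConvexBody W) (l : ℝ), 0 < l → Z (l • K) = l • Z K) →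
      ∃ (M : ConvexBody ℂ) (σ : Measure ℂ), IsSurfaceAreaMeasure M σ ∧
        (∀ (K : ConvexBody W) (w : W),
          hSupp (Z K) (fun ξ => (ξ w).re) =
            ∫ α, hSupp (detBody b K w) (fun c => (c * (starRingEnd ℂ) α).re) ∂σ) ∧
        ∀ (M' : ConvexBody ℂ) (σ' : Measure ℂ), IsSurfaceAreaMeasure M' σ' →
          (∀ (K : ConvexBody W) (w : W),
            hSupp (Z K) (fun ξ => (ξ w).re) =
              ∫ α, hSupp (detBody b K w) (fun c => (c * (starRingEnd ℂ) α).re) ∂σ') →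
          ∃ x : ℂ, M' = M.translate x) := by
  have hE := coord_basisCoord b
  refine ⟨fun h3 => exists_eq_mixedVol μ (basisCoord b)
    (isContra_of_minkowski hZc hZt hZv hZg h3 _), fun h1 => exists_eq_integral b (basisCoord b) hE
      (isContra_of_minkowski hZc hZt hZv hZg (fun K l hl => ?_) _)⟩
  rw [pow_one]
  exact h1 K l hl
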